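/- Let d ≥ 1, p,q ∈ (1,∞), r ∈ [p,∞), γ ∈ {0,1}, and κ := γ + d/p + 2/q − d/r < 2. There is a constant N depending only on d, p, q, r, γ such that for every ρ ∈ (0,1], every ε > 0, and every u with u, Du, D²u, ∂_t u ∈ L_{p,q}(C_{2ρ}) (where C_{2ρ} = [0,4ρ²) × B_{2ρ}(0)), the trace D^γ u(0,·), defined as the limit in L_r(B_ρ(0)) of D^γ u^{(ε')}(0,·) as ε' ↓ 0, satisfies (⨍_{B_ρ} |D^γ u(0,·)|^r dx)^{1/r} ≤ N·ε·⨍‖∂_t u, D²u‖_{L_{p,q}(C_{2ρ})} + N·(ε·ρ^{−2} + ε^{−κ/(2−κ)}·ρ^{(2κ−2γ)/(2−κ)})·⨍‖u‖_{L_{p,q}(C_{2ρ})}. -/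

import Mathlib

open MeasureTheory ENNReal NNReal Metric Set Filter Topology

noncomputable section

/-- Euclidean space `ℝ^d`. -/
abbrev Spc (d : ℕ) : Type := EuclideanSpace ℝ (Fin d)

/-- Space-time `ℝ^{d+1} = ℝ × ℝ^d`, a point is `(t, x)`. -/
abbrev SpT (d : ℕ) : Type := ℝ × Spc d

/-- The parabolic cylinder `C_ρ(t₀,x₀) = [t₀, t₀+ρ²) × B_ρ(x₀)`. -/
def pCyl (d : ℕ) (ρ t₀ : ℝ) (x₀ : Spc d) : Set (SpT d) :=
  (Set.Ico t₀ (t₀ + ρ ^ 2)) ×ˢ (Metric.ball x₀ ρ)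

/-- The (unnormalized) norm `‖f‖_{L_{p,q}(A)}
    = (∫_ℝ (∫_{ℝ^d} |f(t,x)|^p 1_A(t,x) dx)^{q/p} dt)^{1/q}`. -/
def lpqNorm (d : ℕ) (p q : ℝ) (f : SpT d → ℝ) (A : Set (SpT d)) : ℝ≥0∞ :=
  (∫⁻ t : ℝ, (∫⁻ x : Spc d, A.indicator (fun z => ENNReal.ofReal |f z| ^ p) (t, x)) ^ (q / p)) ^ (1 / q)

/-- The normalized norm `⨍‖f‖_{L_{p,q}(C)}` over the cylinder `C_ρ(t₀,x₀)`:
    inner integral replaced by the average over the spatial ball, outer one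
    by the average over the time interval. -/
def avgLpq (d : ℕ) (p q ρ t₀ : ℝ) (x₀ : Spc d) (f : SpT d → ℝ) : ℝ≥0∞ :=
  ((∫⁻ t in Set.Ico t₀ (t₀ + ρ ^ 2),
      ((∫⁻ x in Metric.ball x₀ ρ, ENNReal.ofReal |f (t, x)| ^ p) / volume (Metric.ball x₀ ρ)) ^ (q / p))
      / ENNReal.ofReal (ρ ^ 2)) ^ (1 / q)

/-- The parabolic Morrey norm `‖f‖_{E_{p,q,β}}
    = sup { ρ^β ⨍‖f‖_{L_{p,q}(C)} : 0 < ρ ≤ 1, C ∈ ℂ_ρ }`. -/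
def morreyNorm (d : ℕ) (p q β : ℝ) (f : SpT d → ℝ) : ℝ≥0∞ :=
  ⨆ (ρ : ℝ) (_ : 0 < ρ) (_ : ρ ≤ 1) (t₀ : ℝ) (x₀ : Spc d),
    ENNReal.ofReal (ρ ^ β) * avgLpq d p q ρ t₀ x₀ f

/-- The homogeneous parabolic Morrey norm `‖f‖_{Ė_{p,q,β}}` (all radii `ρ > 0`). -/
def morreyNormH (d : ℕ) (p q β : ℝ) (f : SpT d → ℝ) : ℝ≥0∞ :=
  ⨆ (ρ : ℝ) (_ : 0 < ρ) (t₀ : ℝ) (x₀ : Spc d),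
    ENNReal.ofReal (ρ ^ β) * avgLpq d p q ρ t₀ x₀ f

/-- Membership `f ∈ E_{p,q,β}`. -/
def MemE (d : ℕ) (p q β : ℝ) (f : SpT d → ℝ) : Prop :=
  AEStronglyMeasurable f volume ∧ morreyNorm d p q β f ≠ ⊤

/-- Membership `f ∈ Ė_{p,q,β}` (homogeneous). -/
def MemEH (d : ℕ) (p q β : ℝ) (f : SpT d → ℝ) : Prop :=
  AEStronglyMeasurable f volume ∧ morreyNormH d p q β f ≠ ⊤

/-- The elliptic Morrey norm `‖f‖_{E_{p,β}(ℝ^d)}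
    = sup { ρ^β (⨍_{B_ρ(x)} |f|^p)^{1/p} : 0 < ρ ≤ 1, x ∈ ℝ^d }`. -/
def morreyNormE (d : ℕ) (p β : ℝ) (f : Spc d → ℝ) : ℝ≥0∞ :=
  ⨆ (ρ : ℝ) (_ : 0 < ρ) (_ : ρ ≤ 1) (x₀ : Spc d),
    ENNReal.ofReal (ρ ^ β) *
      ((∫⁻ y in Metric.ball x₀ ρ, ENNReal.ofReal |f y| ^ p) / volume (Metric.ball x₀ ρ)) ^ (1 / p)

/-- The homogeneous elliptic Morrey norm on `ℝ^d` (all radii `ρ > 0`). -/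
def morreyNormEH (d : ℕ) (p β : ℝ) (f : Spc d → ℝ) : ℝ≥0∞ :=
  ⨆ (ρ : ℝ) (_ : 0 < ρ) (x₀ : Spc d),
    ENNReal.ofReal (ρ ^ β) *
      ((∫⁻ y in Metric.ball x₀ ρ, ENNReal.ofReal |f y| ^ p) / volume (Metric.ball x₀ ρ)) ^ (1 / p)

/-- A mollifying kernel: nonnegative, smooth, compactly supported in
    `[-1,0) × B_1(0)`, with unit integral. -/
def IsMollifier (d : ℕ) (ζ : SpT d → ℝ) : Prop :=
  ContDiff ℝ (⊤ : ℕ∞) ζ ∧ (∀ z, 0 ≤ ζ z) ∧ (∫ z, ζ z) = 1 ∧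
    Function.support ζ ⊆ (Set.Ico (-1 : ℝ) 0) ×ˢ (Metric.ball (0 : Spc d) 1)

/-- The mollification `f^{(ε)} = f * ζ_ε`, where
    `ζ_ε(t,x) = ε^{-d-2} ζ(t/ε², x/ε)`. -/
def mollify (d : ℕ) (ζ : SpT d → ℝ) (ε : ℝ) (f : SpT d → ℝ) (z : SpT d) : ℝ :=
  ∫ w : SpT d, (ε ^ (-(d : ℝ) - 2) * ζ (w.1 / ε ^ 2, ε⁻¹ • w.2)) * f (z.1 - w.1, z.2 - w.2)

/-- The time direction in space-time. -/
def dirT (d : ℕ) : SpT d := (1, 0)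

/-- The `i`-th spatial direction in space-time. -/
def dirS (d : ℕ) (i : Fin d) : SpT d := (0, EuclideanSpace.single i 1)

/-- `v` is the weak derivative of `u` in the direction `e`. -/
def IsWeakDeriv (d : ℕ) (u v : SpT d → ℝ) (e : SpT d) : Prop :=
  ∀ φ : SpT d → ℝ, ContDiff ℝ (⊤ : ℕ∞) φ → HasCompactSupport φ →
    ∫ z, u z * fderiv ℝ φ z e = - ∫ z, v z * φ z

/-- `v` is the second weak derivative of `u` in the directions `e₁, e₂`. -/
def IsWeakDeriv2 (d : ℕ) (u v : SpT d → ℝ) (e₁ e₂ : SpT d) : Prop :=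
  ∀ φ : SpT d → ℝ, ContDiff ℝ (⊤ : ℕ∞) φ → HasCompactSupport φ →
    ∫ z, u z * fderiv ℝ (fun w => fderiv ℝ φ w e₁) z e₂ = ∫ z, v z * φ z

/-- The magnitude `|Du|` of the spatial gradient. -/
def gradMag (d : ℕ) (Du : Fin d → SpT d → ℝ) (z : SpT d) : ℝ :=
  Real.sqrt (∑ i, (Du i z) ^ 2)

/-- The magnitude `|D²u|` of the spatial Hessian. -/
def hessMag (d : ℕ) (D2u : Fin d → Fin d → SpT d → ℝ) (z : SpT d) : ℝ :=
  Real.sqrt (∑ i, ∑ j, (D2u i j z) ^ 2)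

/-- `u ∈ E^{1,2}_{p,q,β}`, with weak spatial gradient `Du`, weak spatial Hessian
    `D2u`, and weak time derivative `ut`, all in `E_{p,q,β}`. -/
def Mem12 (d : ℕ) (p q β : ℝ) (u : SpT d → ℝ) (Du : Fin d → SpT d → ℝ)
    (D2u : Fin d → Fin d → SpT d → ℝ) (ut : SpT d → ℝ) : Prop :=
  MemE d p q β u ∧ (∀ i, IsWeakDeriv d u (Du i) (dirS d i)) ∧
    (∀ i j, IsWeakDeriv2 d u (D2u i j) (dirS d i) (dirS d j)) ∧
    IsWeakDeriv d u ut (dirT d) ∧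
    (∀ i, MemE d p q β (Du i)) ∧ (∀ i j, MemE d p q β (D2u i j)) ∧ MemE d p q β ut

/-- `u ∈ Ė^{1,2}_{p,q,β}` (homogeneous version). -/
def Mem12H (d : ℕ) (p q β : ℝ) (u : SpT d → ℝ) (Du : Fin d → SpT d → ℝ)
    (D2u : Fin d → Fin d → SpT d → ℝ) (ut : SpT d → ℝ) : Prop :=
  MemEH d p q β u ∧ (∀ i, IsWeakDeriv d u (Du i) (dirS d i)) ∧
    (∀ i j, IsWeakDeriv2 d u (D2u i j) (dirS d i) (dirS d j)) ∧
    IsWeakDeriv d u ut (dirT d) ∧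
    (∀ i, MemEH d p q β (Du i)) ∧ (∀ i j, MemEH d p q β (D2u i j)) ∧ MemEH d p q β ut

/-- The norm `‖u‖_{E^{1,2}_{p,q,β}} = ‖u‖ + ‖Du‖ + ‖D²u‖ + ‖∂ₜu‖`. -/
def norm12 (d : ℕ) (p q β : ℝ) (u : SpT d → ℝ) (Du : Fin d → SpT d → ℝ)
    (D2u : Fin d → Fin d → SpT d → ℝ) (ut : SpT d → ℝ) : ℝ≥0∞ :=
  morreyNorm d p q β u + morreyNorm d p q β (gradMag d Du)
    + morreyNorm d p q β (hessMag d D2u) + morreyNorm d p q β ut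

/-- Membership `f ∈ L_{p,q}(ℝ^{d+1})`. -/
def MemLpq (d : ℕ) (p q : ℝ) (f : SpT d → ℝ) : Prop :=
  AEStronglyMeasurable f volume ∧ lpqNorm d p q f Set.univ ≠ ⊤

/-- `u ∈ W^{1,2}_{p,q}(ℝ^{d+1})`: `u`, its weak spatial gradient `Du`,
    weak spatial Hessian `D2u` and weak time derivative `ut` are in `L_{p,q}`. -/
def MemW12 (d : ℕ) (p q : ℝ) (u : SpT d → ℝ) (Du : Fin d → SpT d → ℝ)
    (D2u : Fin d → Fin d → SpT d → ℝ) (ut : SpT d → ℝ) : Prop :=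
  MemLpq d p q u ∧ (∀ i, IsWeakDeriv d u (Du i) (dirS d i)) ∧
    (∀ i j, IsWeakDeriv2 d u (D2u i j) (dirS d i) (dirS d j)) ∧
    IsWeakDeriv d u ut (dirT d) ∧
    (∀ i, MemLpq d p q (Du i)) ∧ (∀ i j, MemLpq d p q (D2u i j)) ∧ MemLpq d p q ut

/-- Convergence `F ε → v` in `L_r(B)` as `ε ↓ 0`. -/
def TendstoLr (d : ℕ) (r : ℝ) (B : Set (Spc d)) (F : ℝ → Spc d → ℝ) (v : Spc d → ℝ) : Prop :=
  Tendsto (fun ε => (∫⁻ x in B, ENNReal.ofReal |F ε x - v x| ^ r) ^ (1 / r))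
    (𝓝[>] (0 : ℝ)) (𝓝 0)

/-- `v` is the weak derivative of `u` in direction `e` on the open set `Ω`. -/
def IsWeakDerivOn (d : ℕ) (Ω : Set (SpT d)) (u v : SpT d → ℝ) (e : SpT d) : Prop :=
  ∀ φ : SpT d → ℝ, ContDiff ℝ (⊤ : ℕ∞) φ → HasCompactSupport φ → tsupport φ ⊆ Ω →
    ∫ z, u z * fderiv ℝ φ z e = - ∫ z, v z * φ z

/-- `v` is the second weak derivative of `u` in directions `e₁, e₂` on `Ω`. -/
def IsWeakDeriv2On (d : ℕ) (Ω : Set (SpT d)) (u v : SpT d → ℝ) (e₁ e₂ : SpT d) : Prop :=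
  ∀ φ : SpT d → ℝ, ContDiff ℝ (⊤ : ℕ∞) φ → HasCompactSupport φ → tsupport φ ⊆ Ω →
    ∫ z, u z * fderiv ℝ (fun w => fderiv ℝ φ w e₁) z e₂ = ∫ z, v z * φ z

/-- Membership `f ∈ L_{p,q}(A)`. -/
def MemLpqOn (d : ℕ) (p q : ℝ) (f : SpT d → ℝ) (A : Set (SpT d)) : Prop :=
  AEStronglyMeasurable f (volume.restrict A) ∧ lpqNorm d p q f A ≠ ⊤

/-- Hölder's inequality on a space of finite measure, against the constant function `1`. -/
theorem lintegral_le_rpow_mul_measure {α : Type*} [MeasurableSpace α] (μ : Measure α) {p : ℝ}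
    (hp : 1 < p) {f : α → ℝ≥0∞} (hf : AEMeasurable f μ) :
    ∫⁻ a, f a ∂μ ≤ (∫⁻ a, f a ^ p ∂μ) ^ (1 / p) * μ univ ^ (1 - 1 / p) := by
  have hpq := Real.HolderConjugate.conjExponent hp
  have h := ENNReal.lintegral_mul_le_Lp_mul_Lq μ hpq hf (aemeasurable_const (b := (1 : ℝ≥0∞)))
  have h2 : 1 / p.conjExponent = 1 - 1 / p := by
    rw [Real.conjExponent]
    have : p ≠ 0 := by linarith
    have : p - 1 ≠ 0 := by linarith
    field_simp
  simpa [h2] using h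

/-- Minkowski's integral inequality. -/
theorem minkowski_lintegral {α β : Type*} [MeasurableSpace α] [MeasurableSpace β]
    (μ : Measure α) (ν : Measure β) [SFinite μ] [SFinite ν] {r : ℝ} (hr : 1 ≤ r)
    {h : α → β → ℝ≥0∞} (hh : Measurable (Function.uncurry h)) :
    (∫⁻ x, (∫⁻ s, h x s ∂ν) ^ r ∂μ) ^ (1 / r)
      ≤ ∫⁻ s, (∫⁻ x, h x s ^ r ∂μ) ^ (1 / r) ∂ν := by
  rcases hr.eq_or_lt with rfl | hr1
  · simp only [ENNReal.rpow_one, div_one]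
    exact (lintegral_lintegral_swap hh.aemeasurable).le
  have hr0 : 0 < r := by linarith
  set m : β → ℝ≥0∞ := fun s => (∫⁻ x, h x s ^ r ∂μ) ^ (1 / r) with hm
  have hhr : Measurable (Function.uncurry fun x s => h x s ^ r) := hh.pow_const r
  have hmm : Measurable m := (hhr.lintegral_prod_left').pow_const _
  have hmr : ∀ s, m s ^ r = ∫⁻ x, h x s ^ r ∂μ := fun s => by
    simp only [hm]; rw [← ENNReal.rpow_mul, one_div_mul_cancel hr0.ne', ENNReal.rpow_one]
  set M := ∫⁻ s, m s ∂ν with hM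
  rcases eq_or_ne M ∞ with hMt | hMt
  · simp [hMt]
  have hfin : ∀ᵐ s ∂ν, m s < ∞ := ae_lt_top hmm hMt
  have hzero : ∀ᵐ x ∂μ, ∀ᵐ s ∂ν, m s = 0 → h x s = 0 := by
    have hms : MeasurableSet {z : α × β | m z.2 = 0 → h z.1 z.2 = 0} := by
      have h1 : MeasurableSet {z : α × β | m z.2 = 0} :=
        (hmm.comp measurable_snd) (measurableSet_singleton 0)
      have h2 : MeasurableSet {z : α × β | h z.1 z.2 = 0} := hh (measurableSet_singleton 0)
      exact h1.imp h2
    rw [Measure.ae_ae_comm hms]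
    refine ae_of_all _ fun s => ?_
    by_cases hs : m s = 0
    · have h0 : ∫⁻ x, h x s ^ r ∂μ = 0 := by
        rw [← hmr, hs, ENNReal.zero_rpow_of_pos hr0]
      rw [lintegral_eq_zero_iff ((hh.of_uncurry_right).pow_const r)] at h0
      filter_upwards [h0] with x hx _
      simpa [hr0.le, hr0.not_gt, hr0] using hx
    · exact ae_of_all _ fun x hx => absurd hx hs
  have hpq := Real.HolderConjugate.conjExponent hr1
  have hc : 1 / r.conjExponent = 1 - 1 / r := by
    rw [Real.conjExponent]
    have : r - 1 ≠ 0 := by linarith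
    field_simp
  have key : ∀ᵐ x ∂μ, (∫⁻ s, h x s ∂ν) ^ r ≤
      (∫⁻ s, h x s ^ r * m s ^ (-(r - 1)) ∂ν) * M ^ (r - 1) := by
    filter_upwards [hzero] with x hx
    have h1 : ∫⁻ s, h x s ∂ν ≤
        ∫⁻ s, ((fun s => h x s * m s ^ (-(1 - 1 / r))) * fun s => m s ^ (1 - 1 / r)) s ∂ν := by
      refine lintegral_mono_ae ?_
      filter_upwards [hx, hfin] with s hs hs2
      rcases eq_or_ne (m s) 0 with h0 | h0
      · simp [hs h0]
      · simp only [Pi.mul_apply]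
        rw [mul_assoc, ← ENNReal.rpow_add _ _ h0 hs2.ne]
        simp
    have h2 := ENNReal.lintegral_mul_le_Lp_mul_Lq ν hpq
      (f := fun s => h x s * m s ^ (-(1 - 1 / r))) (g := fun s => m s ^ (1 - 1 / r))
      ((hh.of_uncurry_left).mul (hmm.pow_const _)).aemeasurable (hmm.pow_const _).aemeasurable
    have h3 := h1.trans h2
    have h4 : ∀ s, (m s ^ (1 - 1 / r)) ^ r.conjExponent = m s := fun s => by
      rw [← ENNReal.rpow_mul, ← hc, one_div_mul_cancel hpq.symm.ne_zero, ENNReal.rpow_one]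
    have h5 : ∀ s, (h x s * m s ^ (-(1 - 1 / r))) ^ r = h x s ^ r * m s ^ (-(r - 1)) := fun s => by
      rw [ENNReal.mul_rpow_of_nonneg _ _ hr0.le, ← ENNReal.rpow_mul]
      congr 2
      field_simp
    simp only [h4, h5, hc] at h3
    calc (∫⁻ s, h x s ∂ν) ^ r ≤ _ := ENNReal.rpow_le_rpow h3 hr0.le
      _ = _ := by
        rw [ENNReal.mul_rpow_of_nonneg _ _ hr0.le, ← ENNReal.rpow_mul, ← ENNReal.rpow_mul,
          one_div_mul_cancel hr0.ne', ENNReal.rpow_one]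
        congr 2
        field_simp
  have hmeas2 : Measurable (Function.uncurry fun x s => h x s ^ r * m s ^ (-(r - 1))) :=
    hhr.mul ((hmm.pow_const _).comp measurable_snd)
  have total : ∫⁻ x, (∫⁻ s, h x s ∂ν) ^ r ∂μ ≤ M ^ r := by
    calc ∫⁻ x, (∫⁻ s, h x s ∂ν) ^ r ∂μ
        ≤ ∫⁻ x, (∫⁻ s, h x s ^ r * m s ^ (-(r - 1)) ∂ν) * M ^ (r - 1) ∂μ :=
          lintegral_mono_ae key
      _ = (∫⁻ x, ∫⁻ s, h x s ^ r * m s ^ (-(r - 1)) ∂ν ∂μ) * M ^ (r - 1) :=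
          lintegral_mul_const _ hmeas2.lintegral_prod_right'
      _ = (∫⁻ s, m s ^ r * m s ^ (-(r - 1)) ∂ν) * M ^ (r - 1) := by
          rw [lintegral_lintegral_swap hmeas2.aemeasurable]
          congr 2 with s
          rw [lintegral_mul_const _ ((hh.of_uncurry_right).pow_const r), hmr]
      _ ≤ M * M ^ (r - 1) := by
          gcongr
          rw [hM]
          refine lintegral_mono fun s => ?_
          rcases eq_or_ne (m s) 0 with h0 | h0
          · simp [h0, hr0]
          rcases eq_or_ne (m s) ∞ with ht | ht
          · simp [ht]
          rw [← ENNReal.rpow_add _ _ h0 ht]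
          simp
      _ = M ^ r := by
          conv_lhs => rw [← ENNReal.rpow_one M]
          rw [← ENNReal.rpow_mul, one_mul, ← ENNReal.rpow_add_of_nonneg _ _ zero_le_one (by linarith)]
          simp
  calc _ ≤ (M ^ r) ^ (1 / r) := ENNReal.rpow_le_rpow total (by positivity)
    _ = M := by rw [← ENNReal.rpow_mul, mul_one_div_cancel hr0.ne', ENNReal.rpow_one]

/-- Local averages map `L_p` to `L_r` for `r ≥ p`. -/
theorem lintegral_ball_rpow_le (d : ℕ) {p r δ : ℝ} (hp : 1 < p) (hr : p ≤ r)
    {h : Spc d → ℝ≥0∞} (hh : Measurable h) :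
    (∫⁻ x, (∫⁻ y in ball x δ, h y) ^ r) ^ (1 / r) ≤
      volume (ball (0 : Spc d) δ) ^ (1 - 1 / p + 1 / r) * (∫⁻ y, h y ^ p) ^ (1 / p) := by
  have hp0 : 0 < p := by linarith
  have hr0 : 0 < r := by linarith
  set V := volume (ball (0 : Spc d) δ) with hV
  have hVx : ∀ x : Spc d, volume (ball x δ) = V := fun x => by
    rw [hV, Measure.addHaar_ball_center]
  set I := ∫⁻ y, h y ^ p with hI
  have hexp : 0 ≤ 1 - 1 / p := by
    rw [sub_nonneg, div_le_one hp0]; exact hp.le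
  have h1 : ∀ x, (∫⁻ y in ball x δ, h y) ^ r ≤
      V ^ ((1 - 1 / p) * r) * I ^ (r / p - 1) * ∫⁻ y in ball x δ, h y ^ p := fun x => by
    have a := lintegral_le_rpow_mul_measure (volume.restrict (ball x δ)) hp hh.aemeasurable
    rw [Measure.restrict_apply_univ, hVx] at a
    have hb : (0 : ℝ) ≤ r / p - 1 := by
      rw [sub_nonneg, le_div_iff₀ hp0]; linarith
    calc _ ≤ _ := ENNReal.rpow_le_rpow a hr0.le
      _ = (∫⁻ y in ball x δ, h y ^ p) ^ (1 + (r / p - 1)) * V ^ ((1 - 1 / p) * r) := by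
        rw [ENNReal.mul_rpow_of_nonneg _ _ hr0.le, ← ENNReal.rpow_mul, ← ENNReal.rpow_mul]
        congr 2; ring
      _ = (∫⁻ y in ball x δ, h y ^ p) * (∫⁻ y in ball x δ, h y ^ p) ^ (r / p - 1) *
            V ^ ((1 - 1 / p) * r) := by
        rw [ENNReal.rpow_add_of_nonneg _ _ zero_le_one hb, ENNReal.rpow_one]
      _ ≤ (∫⁻ y in ball x δ, h y ^ p) * I ^ (r / p - 1) * V ^ ((1 - 1 / p) * r) := by
        gcongr
        exact setLIntegral_le_lintegral _ _
      _ = _ := by ring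
  have hset : MeasurableSet {z : Spc d × Spc d | z.2 ∈ ball z.1 δ} := by
    simp only [mem_ball]
    exact measurableSet_lt (measurable_snd.dist measurable_fst) measurable_const
  have hswap : ∫⁻ x : Spc d, ∫⁻ y in ball x δ, h y ^ p = V * I := by
    have e1 : ∀ x : Spc d, ∫⁻ y in ball x δ, h y ^ p =
        ∫⁻ y, {z : Spc d × Spc d | z.2 ∈ ball z.1 δ}.indicator (fun z => h z.2 ^ p) (x, y) := by
      intro x
      rw [← lintegral_indicator measurableSet_ball]
      rfl
    simp_rw [e1]
    rw [lintegral_lintegral_swap]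
    · have e2 : ∀ y : Spc d,
          ∫⁻ x, {z : Spc d × Spc d | z.2 ∈ ball z.1 δ}.indicator (fun z => h z.2 ^ p) (x, y) =
            V * h y ^ p := by
        intro y
        have : ∀ x, {z : Spc d × Spc d | z.2 ∈ ball z.1 δ}.indicator (fun z => h z.2 ^ p) (x, y) =
            (ball y δ).indicator (fun _ => h y ^ p) x := fun x => by
          simp only [indicator, mem_ofPred_eq, mem_ball, dist_comm]
        simp_rw [this]
        rw [lintegral_indicator_const measurableSet_ball, hVx, mul_comm]
      simp_rw [e2]
      rw [lintegral_const_mul _ (hh.pow_const p)]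
    · exact (((hh.comp measurable_snd).pow_const p).indicator hset).aemeasurable
  have h2 : ∫⁻ x, (∫⁻ y in ball x δ, h y) ^ r ≤
      V ^ ((1 - 1 / p) * r) * I ^ (r / p - 1) * (V * I) := by
    refine (lintegral_mono h1).trans ?_
    rw [lintegral_const_mul, hswap]
    have : Measurable fun x : Spc d => ∫⁻ y,
        {z : Spc d × Spc d | z.2 ∈ ball z.1 δ}.indicator (fun z => h z.2 ^ p) (x, y) :=
      Measurable.lintegral_prod_right' (((hh.comp measurable_snd).pow_const p).indicator hset)
    have e : (fun x : Spc d => ∫⁻ y in ball x δ, h y ^ p) = fun x : Spc d => ∫⁻ y,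
        {z : Spc d × Spc d | z.2 ∈ ball z.1 δ}.indicator (fun z => h z.2 ^ p) (x, y) := by
      ext x
      rw [← lintegral_indicator measurableSet_ball]
      rfl
    rw [e]
    exact this
  have hb : (0 : ℝ) ≤ r / p - 1 := by
    rw [sub_nonneg, le_div_iff₀ hp0]; linarith
  calc _ ≤ _ := ENNReal.rpow_le_rpow h2 (by positivity)
    _ = (V ^ ((1 - 1 / p) * r + 1) * I ^ (r / p - 1 + 1)) ^ (1 / r) := by
      rw [ENNReal.rpow_add_of_nonneg _ _ hb zero_le_one,
        ENNReal.rpow_add_of_nonneg _ _ (by positivity) zero_le_one, ENNReal.rpow_one,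
        ENNReal.rpow_one]
      congr 1; ring
    _ = _ := by
      rw [ENNReal.mul_rpow_of_nonneg _ _ (by positivity), ← ENNReal.rpow_mul, ← ENNReal.rpow_mul]
      congr 2
      · field_simp
      · field_simp; ring

/-- The mixed norm `(∫ (∫ g^p dx)^{q/p} dt)^{1/q}` of a nonnegative function. -/
def mixNorm (d : ℕ) (p q : ℝ) (g : SpT d → ℝ≥0∞) : ℝ≥0∞ :=
  (∫⁻ t : ℝ, (∫⁻ x : Spc d, g (t, x) ^ p) ^ (q / p)) ^ (1 / q)

/-- Space-time averages over small cylinders map `L_{p,q}` to `L_r`, at a fixed time. -/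
theorem lintegral_cyl_rpow_le (d : ℕ) {p q r δ : ℝ} (hp : 1 < p) (hq : 1 < q) (hr : p ≤ r)
    (t : ℝ) {g : SpT d → ℝ≥0∞} (hg : Measurable g) :
    (∫⁻ x, (∫⁻ z in Ioo t (t + δ ^ 2) ×ˢ ball x δ, g z) ^ r) ^ (1 / r) ≤
      volume (ball (0 : Spc d) δ) ^ (1 - 1 / p + 1 / r) *
        ENNReal.ofReal (δ ^ 2) ^ (1 - 1 / q) * mixNorm d p q g := by
  have hp0 : 0 < p := by linarith
  have hq0 : 0 < q := by linarith
  have hr0 : 0 < r := by linarith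
  set V := volume (ball (0 : Spc d) δ) with hV
  have e1 : ∀ x : Spc d, ∫⁻ z in Ioo t (t + δ ^ 2) ×ˢ ball x δ, g z =
      ∫⁻ s in Ioo t (t + δ ^ 2), ∫⁻ y in ball x δ, g (s, y) := fun x => by
    rw [Measure.volume_eq_prod, ← Measure.prod_restrict, lintegral_prod _ hg.aemeasurable]
  have hset : MeasurableSet {z : (Spc d × ℝ) × Spc d | z.2 ∈ ball z.1.1 δ} := by
    simp only [mem_ball]
    exact measurableSet_lt (measurable_snd.dist (measurable_fst.fst)) measurable_const
  have hmeas : Measurable (Function.uncurry fun (x : Spc d) (s : ℝ) =>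
      ∫⁻ y in ball x δ, g (s, y)) := by
    have : Measurable fun w : Spc d × ℝ => ∫⁻ y,
        {z : (Spc d × ℝ) × Spc d | z.2 ∈ ball z.1.1 δ}.indicator
          (fun z => g (z.1.2, z.2)) (w, y) :=
      Measurable.lintegral_prod_right' ((hg.comp (by fun_prop)).indicator hset)
    convert this using 2 with w
    obtain ⟨x, s⟩ := w
    simp only [Function.uncurry]
    rw [← lintegral_indicator measurableSet_ball]
    rfl
  have hI : Measurable fun s : ℝ => ∫⁻ y, g (s, y) ^ p :=
    Measurable.lintegral_prod_right' (f := fun z : ℝ × Spc d => g z ^ p) (hg.pow_const p)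
  calc (∫⁻ x, (∫⁻ z in Ioo t (t + δ ^ 2) ×ˢ ball x δ, g z) ^ r) ^ (1 / r)
      = (∫⁻ x, (∫⁻ s in Ioo t (t + δ ^ 2), ∫⁻ y in ball x δ, g (s, y)) ^ r) ^ (1 / r) := by
        simp_rw [e1]
    _ ≤ ∫⁻ s in Ioo t (t + δ ^ 2), (∫⁻ x, (∫⁻ y in ball x δ, g (s, y)) ^ r) ^ (1 / r) :=
        minkowski_lintegral _ _ (by linarith) hmeas
    _ ≤ ∫⁻ s in Ioo t (t + δ ^ 2), V ^ (1 - 1 / p + 1 / r) * (∫⁻ y, g (s, y) ^ p) ^ (1 / p) :=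
        lintegral_mono fun s => lintegral_ball_rpow_le d hp hr (hg.comp measurable_prodMk_left)
    _ = V ^ (1 - 1 / p + 1 / r) * ∫⁻ s in Ioo t (t + δ ^ 2), (∫⁻ y, g (s, y) ^ p) ^ (1 / p) :=
        lintegral_const_mul _ (hI.pow_const _)
    _ ≤ V ^ (1 - 1 / p + 1 / r) *
          ((∫⁻ s in Ioo t (t + δ ^ 2), ((∫⁻ y, g (s, y) ^ p) ^ (1 / p)) ^ q) ^ (1 / q) *
            (volume.restrict (Ioo t (t + δ ^ 2))) univ ^ (1 - 1 / q)) := by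
        gcongr
        exact lintegral_le_rpow_mul_measure _ hq (hI.pow_const _).aemeasurable
    _ ≤ V ^ (1 - 1 / p + 1 / r) *
          ((∫⁻ s, (∫⁻ y, g (s, y) ^ p) ^ (q / p)) ^ (1 / q) *
            ENNReal.ofReal (δ ^ 2) ^ (1 - 1 / q)) := by
        have : (volume.restrict (Ioo t (t + δ ^ 2))) univ = ENNReal.ofReal (δ ^ 2) := by
          simp
        rw [this]
        refine mul_le_mul' le_rfl (mul_le_mul' (ENNReal.rpow_le_rpow ?_ (by positivity)) le_rfl)
        have e : ∀ s, ((∫⁻ y, g (s, y) ^ p) ^ (1 / p)) ^ q = (∫⁻ y, g (s, y) ^ p) ^ (q / p) :=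
          fun s => by rw [← ENNReal.rpow_mul]; congr 1; ring
        calc _ = ∫⁻ s in Ioo t (t + δ ^ 2), (∫⁻ y, g (s, y) ^ p) ^ (q / p) :=
              lintegral_congr fun s => e s
          _ ≤ _ := setLIntegral_le_lintegral _ _
    _ = _ := by rw [mixNorm]; ring

/-- Tensor products `θ(t) ∏ cⱼ(xⱼ)`. -/
def prodKer (d : ℕ) (θ : ℝ → ℝ) (c : Fin d → ℝ → ℝ) (z : SpT d) : ℝ :=
  θ z.1 * ∏ j, c j (z.2 j)

theorem contDiff_prodKer (d : ℕ) {θ : ℝ → ℝ} {c : Fin d → ℝ → ℝ}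
    (hθ : ContDiff ℝ (⊤ : ℕ∞) θ) (hc : ∀ j, ContDiff ℝ (⊤ : ℕ∞) (c j)) :
    ContDiff ℝ (⊤ : ℕ∞) (prodKer d θ c) := by
  have h : ∀ j : Fin d, ContDiff ℝ (⊤ : ℕ∞) fun z : SpT d => z.2 j := fun j =>
    (EuclideanSpace.proj (𝕜 := ℝ) j).contDiff.comp contDiff_snd
  exact (hθ.comp contDiff_fst).mul (contDiff_prod fun j _ => (hc j).comp (h j))

theorem fderiv_eq_deriv_line {E : Type*} [NormedAddCommGroup E] [NormedSpace ℝ E] {f : E → ℝ}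
    {z : E} (hf : DifferentiableAt ℝ f z) (v : E) :
    fderiv ℝ f z v = deriv (fun s : ℝ => f (z + s • v)) 0 :=
  (hf.lineDeriv_eq_fderiv (v := v)).symm

theorem fderiv_prodKer_dirT (d : ℕ) {θ : ℝ → ℝ} {c : Fin d → ℝ → ℝ}
    (hθ : ContDiff ℝ (⊤ : ℕ∞) θ) (hc : ∀ j, ContDiff ℝ (⊤ : ℕ∞) (c j)) (z : SpT d) :
    fderiv ℝ (prodKer d θ c) z (dirT d) = prodKer d (deriv θ) c z := by
  rw [fderiv_eq_deriv_line ((contDiff_prodKer d hθ hc).differentiable (by simp) z)]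
  have : (fun s : ℝ => prodKer d θ c (z + s • dirT d)) =
      fun s => θ (z.1 + s) * ∏ j, c j (z.2 j) := by
    ext s; simp [prodKer, dirT]
  rw [this, deriv_mul_const_field, prodKer, deriv_comp_const_add, add_zero]

theorem fderiv_prodKer_dirS (d : ℕ) {θ : ℝ → ℝ} {c : Fin d → ℝ → ℝ}
    (hθ : ContDiff ℝ (⊤ : ℕ∞) θ) (hc : ∀ j, ContDiff ℝ (⊤ : ℕ∞) (c j)) (i : Fin d) (z : SpT d) :
    fderiv ℝ (prodKer d θ c) z (dirS d i) =
      prodKer d θ (Function.update c i (deriv (c i))) z := by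
  rw [fderiv_eq_deriv_line ((contDiff_prodKer d hθ hc).differentiable (by simp) z)]
  have : (fun s : ℝ => prodKer d θ c (z + s • dirS d i)) =
      fun s => (θ z.1 * ∏ j ∈ Finset.univ.erase i, c j (z.2 j)) * c i (z.2 i + s) := by
    ext s
    simp only [prodKer, dirS, Prod.fst_add, Prod.smul_fst, Prod.snd_add,
      Prod.smul_snd, PiLp.add_apply, PiLp.smul_apply, PiLp.single_apply, smul_eq_mul]
    rw [← Finset.mul_prod_erase _ _ (Finset.mem_univ i)]
    rw [Finset.prod_congr rfl (g := fun j => c j (z.2 j))]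
    · simp; ring
    · intro j hj
      simp [Finset.ne_of_mem_erase hj]
  rw [this, deriv_const_mul_field, deriv_comp_const_add, add_zero, prodKer,
    ← Finset.mul_prod_erase _ _ (Finset.mem_univ i)]
  rw [Finset.prod_congr rfl (g := fun j => c j (z.2 j))
    (f := fun j => Function.update c i (deriv (c i)) j (z.2 j))]
  · simp; ring
  · intro j hj
    simp [Finset.ne_of_mem_erase hj]

/-- Smooth kernels with compact support in the unit forward cylinder `(0,1) × B₁`. -/
structure IsKer (d : ℕ) (k : SpT d → ℝ) : Prop where
  smooth : ContDiff ℝ (⊤ : ℕ∞) k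
  compact : HasCompactSupport k
  supp : tsupport k ⊆ Ioo (0 : ℝ) 1 ×ˢ ball (0 : Spc d) 1

theorem isKer_prodKer (d : ℕ) {θ : ℝ → ℝ} {c : Fin d → ℝ → ℝ} {a b R : ℝ}
    (hθ : ContDiff ℝ (⊤ : ℕ∞) θ) (hc : ∀ j, ContDiff ℝ (⊤ : ℕ∞) (c j))
    (ha : 0 < a) (hb : b < 1) (hR : R = 1 / ((d : ℝ) + 1))
    (hθs : ∀ t, t ∉ Icc a b → θ t = 0) (hcs : ∀ j x, x ∉ Icc (-R) R → c j x = 0) :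
    IsKer d (prodKer d θ c) := by
  have hsub : Function.support (prodKer d θ c) ⊆
      Icc a b ×ˢ {x : Spc d | ∀ j, x j ∈ Icc (-R) R} := by
    intro z hz
    rw [Function.mem_support, prodKer] at hz
    refine ⟨?_, fun j => ?_⟩
    · by_contra h
      exact hz (by rw [hθs _ h, zero_mul])
    · by_contra h
      exact hz (by rw [Finset.prod_eq_zero (Finset.mem_univ j) (hcs j _ h), mul_zero])
  have hR0 : 0 < R := by rw [hR]; positivity
  have hball : {x : Spc d | ∀ j, x j ∈ Icc (-R) R} ⊆ ball 0 1 := by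
    intro x hx
    rw [mem_ball_zero_iff, EuclideanSpace.norm_eq, Real.sqrt_lt' one_pos]
    calc ∑ j, ‖x j‖ ^ 2 ≤ ∑ _j : Fin d, R ^ 2 := by
          refine Finset.sum_le_sum fun j _ => ?_
          gcongr
          exact abs_le.2 (hx j)
      _ = d * R ^ 2 := by simp
      _ < 1 ^ 2 := by
          rw [hR]
          have : (0 : ℝ) ≤ d := Nat.cast_nonneg d
          rw [div_pow, ← mul_div_assoc, div_lt_iff₀ (by positivity)]
          nlinarith
  have hclosed : IsClosed {x : Spc d | ∀ j, x j ∈ Icc (-R) R} := by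
    have : {x : Spc d | ∀ j, x j ∈ Icc (-R) R} = ⋂ j, (fun x : Spc d => x j) ⁻¹' Icc (-R) R := by
      ext x; simp
    rw [this]
    exact isClosed_iInter fun j => isClosed_Icc.preimage (by fun_prop)
  have hcpt : IsCompact (Icc a b ×ˢ {x : Spc d | ∀ j, x j ∈ Icc (-R) R}) :=
    isCompact_Icc.prod ((isCompact_closedBall 0 1).of_isClosed_subset hclosed
      (hball.trans ball_subset_closedBall))
  have hts : tsupport (prodKer d θ c) ⊆ Icc a b ×ˢ {x : Spc d | ∀ j, x j ∈ Icc (-R) R} :=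
    closure_minimal hsub hcpt.isClosed
  exact ⟨contDiff_prodKer d hθ hc, hcpt.of_isClosed_subset isClosed_closure hts,
    hts.trans (prod_mono (Icc_subset_Ioo ha hb) hball)⟩

/-- A smooth function of zero mean vanishing off `[a,b]` has a primitive vanishing off `[a,b]`. -/
theorem exists_primitive {f : ℝ → ℝ} (hf : ContDiff ℝ (⊤ : ℕ∞) f) {a b : ℝ} (hab : a ≤ b)
    (hs : ∀ t, t ∉ Icc a b → f t = 0) (h0 : ∫ t, f t = 0) :
    ∃ F : ℝ → ℝ, ContDiff ℝ (⊤ : ℕ∞) F ∧ deriv F = f ∧ ∀ t, t ∉ Icc a b → F t = 0 := by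
  have hd : ∀ t, HasDerivAt (fun t => ∫ s in a..t, f s) (f t) t := fun t =>
    intervalIntegral.integral_hasDerivAt_right (hf.continuous.intervalIntegrable _ _)
      (hf.continuous.stronglyMeasurableAtFilter _ _) hf.continuous.continuousAt
  have hderiv : deriv (fun t => ∫ s in a..t, f s) = f := funext fun t => (hd t).deriv
  refine ⟨fun t => ∫ s in a..t, f s, ?_, hderiv, fun t ht => ?_⟩
  · rw [show ((⊤ : ℕ∞) : WithTop ℕ∞) = ((⊤ : ℕ∞) : WithTop ℕ∞) + 1 by rfl]
    rw [contDiff_succ_iff_deriv]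
    refine ⟨fun t => (hd t).differentiableAt, by simp, ?_⟩
    rw [hderiv]; exact hf
  · rw [mem_Icc, not_and_or, not_le, not_le] at ht
    rcases ht with ht | ht
    · refine intervalIntegral.integral_zero_ae ?_
      have : ∀ᵐ s : ℝ, s ≠ a := by simp [ae_iff]
      filter_upwards [this] with s hsa hsm
      rw [uIoc_of_ge ht.le] at hsm
      exact hs s fun h => hsa (le_antisymm hsm.2 h.1)
    · simp only []
      rw [intervalIntegral.integral_of_le (hab.trans ht.le), ← h0, ← integral_indicator measurableSet_Ioc]
      refine integral_congr_ae ?_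
      have : ∀ᵐ s : ℝ, s ≠ a := by simp [ae_iff]
      filter_upwards [this] with s hsa
      by_cases hm : s ∈ Ioc a t
      · rw [indicator_of_mem hm]
      · rw [indicator_of_notMem hm, hs s]
        rintro ⟨h1, h2⟩
        exact hm ⟨lt_of_le_of_ne h1 hsa.symm, h2.trans ht.le⟩

/-- A triple of kernels witnessing that the difference of `ω` at two consecutive dyadic parabolic
scales is a sum of a time derivative and of second spatial derivatives of kernels. -/
structure KerTriple (d γ : ℕ) (ω a : SpT d → ℝ) (b : Fin d → SpT d → ℝ) : Prop where
  isKer_ω : IsKer d ω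
  isKer_a : IsKer d a
  isKer_b : ∀ i, IsKer d (b i)
  eq : ∀ z : SpT d, 2 ^ (d + 2 + γ) * ω (4 * z.1, (2 : ℝ) • z.2) - ω z =
    fderiv ℝ a z (dirT d) +
      ∑ i, fderiv ℝ (fun w => fderiv ℝ (b i) w (dirS d i)) z (dirS d i)

theorem exists_timeKer : ∃ θ A : ℝ → ℝ, ∃ a b : ℝ, 0 < a ∧ a ≤ b ∧ b < 1 ∧
    ContDiff ℝ (⊤ : ℕ∞) θ ∧ ContDiff ℝ (⊤ : ℕ∞) A ∧ (∀ t, t ∉ Icc a b → θ t = 0) ∧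
    (∀ t, t ∉ Icc a b → θ (4 * t) = 0) ∧
    (∀ t, t ∉ Icc a b → A t = 0) ∧ (∫ t, θ t = 1) ∧ (∀ t, 0 ≤ θ t) ∧
      (∀ t, deriv A t = 4 * θ (4 * t) - θ t) := by
  let B : ContDiffBump (1 / 2 : ℝ) := ⟨1 / 8, 1 / 4, by norm_num, by norm_num⟩
  set θ : ℝ → ℝ := B.normed volume with hθ
  have hsm : ContDiff ℝ (⊤ : ℕ∞) θ := B.contDiff_normed
  have hsupp : ∀ t, t ∉ Icc (1 / 4 : ℝ) (3 / 4) → θ t = 0 := fun t ht => by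
    by_contra h
    have : t ∈ Function.support θ := h
    rw [hθ, B.support_normed_eq, Real.ball_eq_Ioo] at this
    have h1 := this.1
    have h2 := this.2
    simp only [B] at h1 h2
    exact ht ⟨by linarith, by linarith⟩
  have h_int : ∫ t, θ t = 1 := B.integral_normed
  have h4 : ∫ t, 4 * θ (4 * t) - θ t = 0 := by
    have hi : Integrable θ := hsm.continuous.integrable_of_hasCompactSupport
      B.hasCompactSupport_normed
    rw [integral_sub ((hi.comp_mul_left' (by norm_num)).const_mul _) hi, integral_const_mul,
      Measure.integral_comp_mul_left, h_int]
    norm_num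
  have hs4 : ∀ t, t ∉ Icc (1 / 16 : ℝ) (3 / 4) → θ (4 * t) = 0 := fun t ht =>
    hsupp _ fun h => ht ⟨by linarith [h.1], by linarith [h.2, h.1]⟩
  have hs1 : ∀ t, t ∉ Icc (1 / 16 : ℝ) (3 / 4) → θ t = 0 := fun t ht =>
    hsupp _ fun h => ht ⟨by linarith [h.1], h.2⟩
  obtain ⟨A, hA, hA', hAs⟩ := exists_primitive (f := fun t => 4 * θ (4 * t) - θ t)
    ((contDiff_const.mul (hsm.comp (contDiff_const.mul contDiff_id))).sub hsm)
    (a := 1 / 16) (b := 3 / 4) (by norm_num)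
    (fun t ht => by rw [hs4 t ht, hs1 t ht]; simp) h4
  exact ⟨θ, A, 1 / 16, 3 / 4, by norm_num, by norm_num, by norm_num, hsm, hA, hs1, hs4, hAs, h_int,
    fun t => B.nonneg_normed t,    fun t => congrFun hA' t⟩

theorem exists_spaceKer {R : ℝ} (hR : 0 < R) : ∃ φ ψ : ℝ → ℝ,
    ContDiff ℝ (⊤ : ℕ∞) φ ∧ ContDiff ℝ (⊤ : ℕ∞) ψ ∧ (∀ t, t ∉ Icc (-R) R → φ t = 0) ∧
    (∀ t, t ∉ Icc (-R) R → φ (2 * t) = 0) ∧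
    (∀ t, t ∉ Icc (-R) R → ψ t = 0) ∧ (∫ t, φ t = 1) ∧ (∀ t, 0 ≤ φ t) ∧
    (∀ t, deriv (deriv ψ) t = 2 * φ (2 * t) - φ t) := by
  let B : ContDiffBump (0 : ℝ) := ⟨R / 2, R, by positivity, by linarith⟩
  set θ : ℝ → ℝ := B.normed volume with hθ
  have hsm : ContDiff ℝ (⊤ : ℕ∞) θ := B.contDiff_normed
  have heven : ∀ t, θ (-t) = θ t := fun t => B.normed_neg (μ := volume) t
  have hsupp : ∀ t, t ∉ Icc (-R) R → θ t = 0 := fun t ht => by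
    by_contra h
    have : t ∈ Function.support θ := h
    rw [hθ, B.support_normed_eq, Real.ball_eq_Ioo] at this
    have h1 := this.1
    have h2 := this.2
    simp only [B] at h1 h2
    exact ht ⟨by linarith, by linarith⟩
  have h_int : ∫ t, θ t = 1 := B.integral_normed
  set f : ℝ → ℝ := fun t => 2 * θ (2 * t) - θ t with hf
  have h4 : ∫ t, f t = 0 := by
    have hi : Integrable θ := hsm.continuous.integrable_of_hasCompactSupport
      B.hasCompactSupport_normed
    rw [hf, integral_sub ((hi.comp_mul_left' (by norm_num)).const_mul _) hi, integral_const_mul,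
      Measure.integral_comp_mul_left, h_int]
    norm_num
  have hs2 : ∀ t, t ∉ Icc (-R) R → θ (2 * t) = 0 := fun t ht =>
    hsupp _ fun h => ht ⟨by linarith [h.1], by linarith [h.2]⟩
  obtain ⟨Φ, hΦ, hΦ', hΦs⟩ := exists_primitive (f := f)
    ((contDiff_const.mul (hsm.comp (contDiff_const.mul contDiff_id))).sub hsm)
    (a := -R) (b := R) (by linarith)
    (fun t ht => by simp only [hf]; rw [hs2 t ht, hsupp t ht]; simp) h4
  have hΦd : Differentiable ℝ Φ := hΦ.differentiable (by simp)
  have hodd : ∀ t, Φ (-t) = -Φ t := by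
    have hconst : ∀ x y, (fun t => Φ t + Φ (-t)) x = (fun t => Φ t + Φ (-t)) y := by
      refine is_const_of_deriv_eq_zero (hΦd.add (hΦd.comp differentiable_neg)) fun t => ?_
      have h1 : HasDerivAt (fun t => Φ t + Φ (-t)) (f t + f (-t) * (-1)) t := by
        rw [← hΦ']
        exact (hΦd t).hasDerivAt.add (HasDerivAt.comp t (hΦd (-t)).hasDerivAt (hasDerivAt_neg t))
      rw [h1.deriv]
      simp only [hf, heven, mul_neg]; ring
    intro t
    have h1 := hconst t (R + 1)
    simp only [] at h1
    rw [hΦs (R + 1) fun h => by linarith [h.2], hΦs (-(R + 1)) fun h => by linarith [h.1]] at h1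
    linarith
  have hΦ0 : ∫ t, Φ t = 0 := by
    have h1 : ∫ t, Φ (-t) = ∫ t, Φ t := integral_neg_eq_self Φ volume
    simp_rw [hodd] at h1
    rw [integral_neg] at h1
    linarith
  obtain ⟨ψ, hψ, hψ', hψs⟩ := exists_primitive hΦ (by linarith : -R ≤ R) hΦs hΦ0
  exact ⟨θ, ψ, hsm, hψ, hsupp, hs2, hψs, h_int, fun t => B.nonneg_normed t,
    fun t => by rw [hψ', hΦ']⟩

theorem integral_prodKer (d : ℕ) (θ : ℝ → ℝ) (c : Fin d → ℝ → ℝ) :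
    ∫ z, prodKer d θ c z = (∫ t, θ t) * ∏ j, ∫ x, c j x := by
  have h1 : ∫ x : Spc d, ∏ j, c j (x j) = ∏ j, ∫ x, c j x := by
    rw [← integral_fintype_prod_volume_eq_prod]
    exact (EuclideanSpace.volume_preserving_symm_measurableEquiv_toLp (Fin d)).integral_comp'
      (fun y : Fin d → ℝ => ∏ j, c j (y j))
  rw [← h1]
  exact integral_prod_mul θ fun x : Spc d => ∏ j, c j (x j)

theorem contDiff_deriv_infty {f : ℝ → ℝ} (hf : ContDiff ℝ (⊤ : ℕ∞) f) :
    ContDiff ℝ (⊤ : ℕ∞) (deriv f) :=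
  (contDiff_infty_iff_deriv.1 hf).2

theorem fderiv_fderiv_prodKer_dirS (d : ℕ) {θ : ℝ → ℝ} {c : Fin d → ℝ → ℝ}
    (hθ : ContDiff ℝ (⊤ : ℕ∞) θ) (hc : ∀ j, ContDiff ℝ (⊤ : ℕ∞) (c j)) (i : Fin d) (z : SpT d) :
    fderiv ℝ (fun w => fderiv ℝ (prodKer d θ c) w (dirS d i)) z (dirS d i) =
      prodKer d θ (Function.update c i (deriv (deriv (c i)))) z := by
  have h : (fun w => fderiv ℝ (prodKer d θ c) w (dirS d i)) =
      prodKer d θ (Function.update c i (deriv (c i))) :=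
    funext fun w => fderiv_prodKer_dirS d hθ hc i w
  rw [h, fderiv_prodKer_dirS d hθ, Function.update_self, Function.update_idem]
  intro j
  by_cases hj : j = i
  · subst hj; rw [Function.update_self]; exact contDiff_deriv_infty (hc j)
  · rw [Function.update_of_ne hj]; exact hc j

theorem exists_kerTriple_zero (d : ℕ) : ∃ ω a : SpT d → ℝ, ∃ b : Fin d → SpT d → ℝ,
    KerTriple d 0 ω a b ∧ (∫ z, ω z = 1) ∧ ∀ z, 0 ≤ ω z := by
  obtain ⟨θ, A, s, e, hs, hse, he, hθ, hA, hθs, hθ4, hAs, hθi, hθ0, hA'⟩ := exists_timeKer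
  obtain ⟨φ, ψ, hφ, hψ, hφs, hφ2, hψs, hφi, hφ0, hψ'⟩ :=
    exists_spaceKer (R := 1 / ((d : ℝ) + 1)) (by positivity)
  set φ₁ : ℝ → ℝ := fun x => 2 * φ (2 * x) with hφ₁
  set θ₁ : ℝ → ℝ := fun x => 4 * θ (4 * x) with hθ₁
  have hφ₁c : ContDiff ℝ (⊤ : ℕ∞) φ₁ :=
    contDiff_const.mul (hφ.comp (contDiff_const.mul contDiff_id))
  have hθ₁c : ContDiff ℝ (⊤ : ℕ∞) θ₁ :=
    contDiff_const.mul (hθ.comp (contDiff_const.mul contDiff_id))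
  set c : Fin d → Fin d → ℝ → ℝ := fun k j => if j < k then φ₁ else if j = k then ψ else φ with hc
  have hcc : ∀ k j, ContDiff ℝ (⊤ : ℕ∞) (c k j) := by
    intro k j; simp only [hc]; split_ifs <;> assumption
  have hcs : ∀ k j x, x ∉ Icc (-(1 / ((d : ℝ) + 1))) (1 / ((d : ℝ) + 1)) → c k j x = 0 := by
    intro k j x hx; simp only [hc]
    split_ifs
    · simp [hφ₁, hφ2 x hx]
    · exact hψs x hx
    · exact hφs x hx
  refine ⟨prodKer d θ fun _ => φ, prodKer d A fun _ => φ, fun k => prodKer d θ₁ (c k),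
    ⟨isKer_prodKer d hθ (fun _ => hφ) hs he rfl hθs fun _ => hφs,
      isKer_prodKer d hA (fun _ => hφ) hs he rfl hAs fun _ => hφs,
      fun k => isKer_prodKer d hθ₁c (hcc k) hs he rfl
        (fun t ht => by simp [hθ₁, hθ4 t ht]) (hcs k), fun z => ?_⟩, ?_, fun z =>
    mul_nonneg (hθ0 _) (Finset.prod_nonneg fun j _ => hφ0 _)⟩
  · have hb : ∀ k : Fin d, fderiv ℝ (fun w => fderiv ℝ (prodKer d θ₁ (c k)) w (dirS d k)) z
        (dirS d k) = θ₁ z.1 * ((φ₁ (z.2 k) - φ (z.2 k)) *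
          (∏ j with j < k, (φ (z.2 j) + (φ₁ (z.2 j) - φ (z.2 j)))) *
            ∏ j with k < j, φ (z.2 j)) := by
      intro k
      rw [fderiv_fderiv_prodKer_dirS d hθ₁c (hcc k), prodKer]
      congr 1
      have h1 : (Finset.univ : Finset (Fin d)) =
          insert k ((Finset.univ.filter (· < k)) ∪ (Finset.univ.filter (k < ·))) := by
        ext j
        simp only [Finset.mem_univ, Finset.mem_insert, Finset.mem_union, Finset.mem_filter,
          true_and, true_iff]
        rcases lt_trichotomy j k with h | h | h <;> simp [h]
      rw [h1, Finset.prod_insert (by simp), Finset.prod_union, ← mul_assoc]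
      · congr 1
        · congr 1
          · simp [hc, hψ', hφ₁]
          · refine Finset.prod_congr (by rw [← h1]) fun j hj => ?_
            have hj' : j < k := (Finset.mem_filter.1 hj).2
            simp [hc, hj', hj'.ne]
        · refine Finset.prod_congr (by rw [← h1]) fun j hj => ?_
          have hj' : k < j := (Finset.mem_filter.1 hj).2
          simp [hc, hj'.ne', hj'.not_gt]
      · rw [Finset.disjoint_left]
        intro j hj hj'
        exact lt_asymm (Finset.mem_filter.1 hj).2 (Finset.mem_filter.1 hj').2
    simp_rw [hb]
    rw [← Finset.mul_sum, fderiv_prodKer_dirT d hA fun _ => hφ]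
    have h2 := Finset.prod_add_ordered (Finset.univ : Finset (Fin d)) (fun j => φ (z.2 j))
      (fun j => φ₁ (z.2 j) - φ (z.2 j))
    have h3 := eq_sub_of_add_eq' h2.symm
    rw [h3]
    simp only [prodKer, hA', hφ₁, hθ₁, add_sub_cancel, Finset.prod_mul_distrib, Finset.prod_const,
      Finset.card_univ, Fintype.card_fin, PiLp.smul_apply, smul_eq_mul]
    ring
  · rw [integral_prodKer, hθi]
    simp [hφi]

theorem contDiff_fderiv_apply {E : Type*} [NormedAddCommGroup E] [NormedSpace ℝ E] {f : E → ℝ}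
    (hf : ContDiff ℝ (⊤ : ℕ∞) f) (v : E) : ContDiff ℝ (⊤ : ℕ∞) fun z => fderiv ℝ f z v :=
  (hf.fderiv_right (m := (⊤ : ℕ∞)) (by simp)).clm_apply contDiff_const

theorem IsKer.fderiv_apply {d : ℕ} {k : SpT d → ℝ} (hk : IsKer d k) (v : SpT d) :
    IsKer d fun z => fderiv ℝ k z v :=
  ⟨contDiff_fderiv_apply hk.smooth v, hk.compact.fderiv_apply ℝ v,
    (tsupport_fderiv_apply_subset ℝ v).trans hk.supp⟩

theorem IsKer.neg {d : ℕ} {k : SpT d → ℝ} (hk : IsKer d k) : IsKer d fun z => -k z := by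
  have h : tsupport (fun z => -k z) = tsupport k := by
    rw [tsupport, tsupport]; congr 1; ext z; simp
  exact ⟨hk.smooth.neg, by rw [HasCompactSupport, h]; exact hk.compact, by rw [h]; exact hk.supp⟩

theorem fderiv_fderiv_comm {E : Type*} [NormedAddCommGroup E] [NormedSpace ℝ E] {f : E → ℝ}
    (hf : ContDiff ℝ (⊤ : ℕ∞) f) (u v z : E) :
    fderiv ℝ (fun w => fderiv ℝ f w u) z v = fderiv ℝ (fun w => fderiv ℝ f w v) z u := by
  have hd : DifferentiableAt ℝ (fderiv ℝ f) z :=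
    (hf.fderiv_right (m := (⊤ : ℕ∞)) (by simp)).differentiable (by simp) z
  have h : ∀ u v, fderiv ℝ (fun w => fderiv ℝ f w u) z v = fderiv ℝ (fderiv ℝ f) z v u := by
    intro u v
    rw [fderiv_clm_apply hd (differentiableAt_const u)]
    simp
  rw [h, h]
  refine (hf.contDiffAt.isSymmSndFDerivAt ?_).eq v u
  simp only [minSmoothness_of_isRCLikeNormedField]
  exact WithTop.coe_le_coe.2 (le_top (a := (2 : ℕ∞)))

theorem KerTriple.neg_fderiv {d : ℕ} {ω a : SpT d → ℝ} {b : Fin d → SpT d → ℝ}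
    (h : KerTriple d 0 ω a b) (j : Fin d) :
    KerTriple d 1 (fun z => -fderiv ℝ ω z (dirS d j)) (fun z => -fderiv ℝ a z (dirS d j))
      (fun i z => -fderiv ℝ (b i) z (dirS d j)) := by
  refine ⟨(h.isKer_ω.fderiv_apply _).neg, (h.isKer_a.fderiv_apply _).neg,
    fun i => ((h.isKer_b i).fderiv_apply _).neg, fun z => ?_⟩
  have hfun := funext h.eq
  have hL : HasFDerivAt (fun z : SpT d => (4 * z.1, (2 : ℝ) • z.2))
      (((4 : ℝ) • ContinuousLinearMap.fst ℝ ℝ (Spc d)).prod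
        ((2 : ℝ) • ContinuousLinearMap.snd ℝ ℝ (Spc d))) z :=
    (((4 : ℝ) • ContinuousLinearMap.fst ℝ ℝ (Spc d)).prod
        ((2 : ℝ) • ContinuousLinearMap.snd ℝ ℝ (Spc d))).hasFDerivAt
  have hω : ∀ z, HasFDerivAt ω (fderiv ℝ ω z) z := fun z =>
    (h.isKer_ω.smooth.differentiable (by simp) z).hasFDerivAt
  have h1 : HasFDerivAt (fun z : SpT d => 2 ^ (d + 2 + 0) * ω (4 * z.1, (2 : ℝ) • z.2) - ω z) _ z :=
    (((hω _).comp z hL).const_mul (2 ^ (d + 2 + 0))).sub (hω z)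
  have h2 : HasFDerivAt (fun z : SpT d => fderiv ℝ a z (dirT d) +
      ∑ i, fderiv ℝ (fun w => fderiv ℝ (b i) w (dirS d i)) z (dirS d i)) _ z :=
    ((contDiff_fderiv_apply h.isKer_a.smooth (dirT d)).differentiable (by simp) z).hasFDerivAt.add
      (HasFDerivAt.fun_sum (u := Finset.univ) fun i _ =>
        ((contDiff_fderiv_apply (contDiff_fderiv_apply (h.isKer_b i).smooth (dirS d i))
          (dirS d i)).differentiable (by simp) z).hasFDerivAt)
  rw [hfun] at h1
  have h3 := congrArg (fun l : SpT d →L[ℝ] ℝ => l (dirS d j)) (h1.unique h2)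
  have hdir : ((((4 : ℝ) • ContinuousLinearMap.fst ℝ ℝ (Spc d)).prod
        ((2 : ℝ) • ContinuousLinearMap.snd ℝ ℝ (Spc d))) (dirS d j)) = (2 : ℝ) • dirS d j := by
    simp [dirS]
  simp only [sub_apply, smul_apply,
    ContinuousLinearMap.comp_apply, hdir, map_smul, add_apply,
    sum_apply, smul_eq_mul] at h3
  have hcomm : ∀ i, fderiv ℝ (fun w => fderiv ℝ (fun w => fderiv ℝ (b i) w (dirS d i)) w
      (dirS d i)) z (dirS d j) =
      fderiv ℝ (fun w => fderiv ℝ (fun w => fderiv ℝ (b i) w (dirS d j)) w (dirS d i)) z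
        (dirS d i) := by
    intro i
    rw [fderiv_fderiv_comm (contDiff_fderiv_apply (h.isKer_b i).smooth (dirS d i))]
    congr 2
    funext w
    exact fderiv_fderiv_comm (h.isKer_b i).smooth _ _ w
  rw [fderiv_fderiv_comm h.isKer_a.smooth] at h3
  simp_rw [hcomm] at h3
  simp only [fderiv_fun_neg, neg_apply, Finset.sum_neg_distrib]
  rw [← neg_add, ← h3, pow_succ]
  ring

/-- The parabolic rescaling `(t, x) ↦ (t/δ², x/δ)`. -/
def dilMap (d : ℕ) (δ : ℝ) : SpT d →L[ℝ] SpT d :=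
  ((δ ^ 2)⁻¹ • ContinuousLinearMap.fst ℝ ℝ (Spc d)).prod
    (δ⁻¹ • ContinuousLinearMap.snd ℝ ℝ (Spc d))

theorem dilMap_apply (d : ℕ) (δ : ℝ) (z : SpT d) :
    dilMap d δ z = ((δ ^ 2)⁻¹ * z.1, δ⁻¹ • z.2) := rfl

theorem dilMap_dirT (d : ℕ) (δ : ℝ) : dilMap d δ (dirT d) = (δ ^ 2)⁻¹ • dirT d := by
  simp [dilMap_apply, dirT]

theorem dilMap_dirS (d : ℕ) (δ : ℝ) (i : Fin d) : dilMap d δ (dirS d i) = δ⁻¹ • dirS d i := by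
  simp [dilMap_apply, dirS]

/-- The reflected parabolic dilation of a kernel. -/
def dil (d : ℕ) (k : SpT d → ℝ) (δ : ℝ) (y : SpT d) : ℝ := k (dilMap d δ (-y))

/-- The open forward parabolic cylinder with bottom centre `z`. -/
def fCyl (d : ℕ) (δ : ℝ) (z : SpT d) : Set (SpT d) :=
  Ioo z.1 (z.1 + δ ^ 2) ×ˢ ball z.2 δ

theorem mem_fCyl_iff {d : ℕ} {δ : ℝ} (hδ : 0 < δ) (z₀ z : SpT d) :
    z ∈ fCyl d δ z₀ ↔ dilMap d δ (z - z₀) ∈ Ioo (0 : ℝ) 1 ×ˢ ball (0 : Spc d) 1 := by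
  rw [fCyl, mem_prod, mem_prod, dilMap_apply, mem_ball_zero_iff, mem_ball_iff_norm, norm_smul,
    norm_inv, Real.norm_of_nonneg hδ.le, inv_mul_lt_iff₀ hδ, mul_one, mem_Ioo, mem_Ioo,
    inv_mul_lt_iff₀ (by positivity), mul_one, Prod.fst_sub, Prod.snd_sub,
    mul_pos_iff_of_pos_left (by positivity), sub_pos, sub_lt_iff_lt_add']

theorem contDiff_dil {d : ℕ} {k : SpT d → ℝ} (hk : ContDiff ℝ (⊤ : ℕ∞) k) (δ : ℝ) :
    ContDiff ℝ (⊤ : ℕ∞) (dil d k δ) :=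
  hk.comp ((dilMap d δ).contDiff.comp contDiff_neg)

theorem contDiff_dil_sub {d : ℕ} {k : SpT d → ℝ} (hk : ContDiff ℝ (⊤ : ℕ∞) k) (δ : ℝ)
    (z₀ : SpT d) : ContDiff ℝ (⊤ : ℕ∞) fun z => dil d k δ (z₀ - z) :=
  (contDiff_dil hk δ).comp (contDiff_const.sub contDiff_id)

theorem tsupport_dil_sub {d : ℕ} {k : SpT d → ℝ} (hk : IsKer d k) {δ : ℝ} (hδ : 0 < δ)
    (z₀ : SpT d) : tsupport (fun z => dil d k δ (z₀ - z)) ⊆ fCyl d δ z₀ := by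
  have h : tsupport (fun z => dil d k δ (z₀ - z)) ⊆
      (fun z => dilMap d δ (z - z₀)) ⁻¹' tsupport k := by
    refine closure_minimal (fun z hz => subset_tsupport _ ?_)
      ((isClosed_tsupport k).preimage (by fun_prop))
    simpa [dil] using hz
  exact fun z hz => (mem_fCyl_iff hδ z₀ z).2 (hk.supp (h hz))

theorem hasCompactSupport_dil_sub {d : ℕ} {k : SpT d → ℝ} (hk : IsKer d k) {δ : ℝ} (hδ : 0 < δ)
    (z₀ : SpT d) : HasCompactSupport fun z => dil d k δ (z₀ - z) := by
  refine ((isCompact_Icc (a := z₀.1) (b := z₀.1 + δ ^ 2)).prod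
    (isCompact_closedBall z₀.2 δ)).of_isClosed_subset
    (isClosed_tsupport _) ((tsupport_dil_sub hk hδ z₀).trans ?_)
  exact prod_mono Ioo_subset_Icc_self ball_subset_closedBall

theorem hasCompactSupport_dil {d : ℕ} {k : SpT d → ℝ} (hk : IsKer d k) {δ : ℝ} (hδ : 0 < δ) :
    HasCompactSupport (dil d k δ) := by
  have := (hasCompactSupport_dil_sub hk hδ 0).comp_homeomorph (Homeomorph.neg (SpT d))
  simpa [Function.comp_def] using this

theorem fderiv_dil_sub {d : ℕ} {k : SpT d → ℝ} (hk : ContDiff ℝ (⊤ : ℕ∞) k) (δ : ℝ)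
    (z₀ z v : SpT d) : fderiv ℝ (fun z => dil d k δ (z₀ - z)) z v =
      fderiv ℝ k (dilMap d δ (z - z₀)) (dilMap d δ v) := by
  have h : HasFDerivAt (fun z => dilMap d δ (z - z₀)) (dilMap d δ) z :=
    (dilMap d δ).hasFDerivAt.comp z ((hasFDerivAt_id z).sub_const z₀)
  have h2 := (hk.differentiable (by simp) (dilMap d δ (z - z₀))).hasFDerivAt.comp z h
  have h3 : (fun z => dil d k δ (z₀ - z)) = k ∘ fun z => dilMap d δ (z - z₀) := by
    ext z; simp [dil]
  rw [h3, h2.fderiv]; rfl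

theorem fderiv_dil_sub_dirT {d : ℕ} {k : SpT d → ℝ} (hk : ContDiff ℝ (⊤ : ℕ∞) k) (δ : ℝ)
    (z₀ z : SpT d) : fderiv ℝ (fun z => dil d k δ (z₀ - z)) z (dirT d) =
      (δ ^ 2)⁻¹ * dil d (fun w => fderiv ℝ k w (dirT d)) δ (z₀ - z) := by
  rw [fderiv_dil_sub hk, dilMap_dirT, map_smul, smul_eq_mul, dil, neg_sub]

theorem fderiv_dil_sub_dirS {d : ℕ} {k : SpT d → ℝ} (hk : ContDiff ℝ (⊤ : ℕ∞) k) (δ : ℝ)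
    (i : Fin d) (z₀ z : SpT d) : fderiv ℝ (fun z => dil d k δ (z₀ - z)) z (dirS d i) =
      δ⁻¹ * dil d (fun w => fderiv ℝ k w (dirS d i)) δ (z₀ - z) := by
  rw [fderiv_dil_sub hk, dilMap_dirS, map_smul, smul_eq_mul, dil, neg_sub]

theorem integral_mul_swap {α : Type*} [MeasurableSpace α] {μ : Measure α} (f g : α → ℝ) :
    ∫ z, f z * g z ∂μ = ∫ z, g z * f z ∂μ := by
  simp_rw [mul_comm]

theorem integral_dil_dirT {d : ℕ} {k : SpT d → ℝ} (hk : IsKer d k) {δ : ℝ} (hδ : 0 < δ)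
    {Ω : Set (SpT d)} {u ut : SpT d → ℝ} (hu : IsWeakDerivOn d Ω u ut (dirT d)) {z₀ : SpT d}
    (hz : fCyl d δ z₀ ⊆ Ω) :
    ∫ z, dil d (fun w => fderiv ℝ k w (dirT d)) δ (z₀ - z) * u z =
      -(δ ^ 2 * ∫ z, dil d k δ (z₀ - z) * ut z) := by
  have h := hu _ (contDiff_dil_sub hk.smooth δ z₀) (hasCompactSupport_dil_sub hk hδ z₀)
    ((tsupport_dil_sub hk hδ z₀).trans hz)
  simp_rw [fderiv_dil_sub_dirT hk.smooth, mul_left_comm (u _), integral_const_mul] at h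
  rw [inv_mul_eq_iff_eq_mul₀ (by positivity)] at h
  rw [integral_mul_swap, h, integral_mul_swap]; ring

theorem integral_dil_dirS {d : ℕ} {k : SpT d → ℝ} (hk : IsKer d k) {δ : ℝ} (hδ : 0 < δ)
    {Ω : Set (SpT d)} {u v : SpT d → ℝ} {i : Fin d}
    (hu : IsWeakDeriv2On d Ω u v (dirS d i) (dirS d i)) {z₀ : SpT d} (hz : fCyl d δ z₀ ⊆ Ω) :
    ∫ z, dil d (fun w => fderiv ℝ (fun w => fderiv ℝ k w (dirS d i)) w (dirS d i)) δ (z₀ - z) * u z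
      = δ ^ 2 * ∫ z, dil d k δ (z₀ - z) * v z := by
  have h := hu _ (contDiff_dil_sub hk.smooth δ z₀) (hasCompactSupport_dil_sub hk hδ z₀)
    ((tsupport_dil_sub hk hδ z₀).trans hz)
  have hk' := contDiff_fderiv_apply hk.smooth (dirS d i)
  have h2 : ∀ z, fderiv ℝ (fun w => fderiv ℝ (fun z => dil d k δ (z₀ - z)) w (dirS d i)) z
      (dirS d i) = (δ ^ 2)⁻¹ *
        dil d (fun w => fderiv ℝ (fun w => fderiv ℝ k w (dirS d i)) w (dirS d i)) δ (z₀ - z) := by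
    intro z
    simp_rw [fderiv_dil_sub_dirS hk.smooth]
    rw [fderiv_const_mul ((contDiff_dil_sub hk' δ z₀).differentiable (by simp) z)]
    rw [_root_.smul_apply, fderiv_dil_sub_dirS hk', smul_eq_mul]
    ring
  simp_rw [h2, mul_left_comm (u _), integral_const_mul] at h
  rw [inv_mul_eq_iff_eq_mul₀ (by positivity)] at h
  rw [integral_mul_swap, h, integral_mul_swap]

/-- The approximation of (derivatives of) `f` at scale `δ` by averages against `ω`. -/
def avgKer (d γ : ℕ) (ω : SpT d → ℝ) (δ : ℝ) (f : SpT d → ℝ) (z₀ : SpT d) : ℝ :=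
  (δ ^ (d + 2 + γ))⁻¹ * ∫ z, dil d ω δ (z₀ - z) * f z

theorem integrable_dil_sub_mul {d : ℕ} {k : SpT d → ℝ} (hk : IsKer d k) {δ : ℝ} (hδ : 0 < δ)
    {f : SpT d → ℝ} (hf : Integrable f) (z₀ : SpT d) :
    Integrable fun z => dil d k δ (z₀ - z) * f z := by
  have hc := (contDiff_dil_sub hk.smooth δ z₀).continuous
  obtain ⟨C, hC⟩ := hc.bounded_above_of_compact_support (hasCompactSupport_dil_sub hk hδ z₀)
  exact hf.bdd_mul hc.aestronglyMeasurable (Eventually.of_forall hC)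

theorem KerTriple.avgKer_half_sub {d γ : ℕ} {ω a : SpT d → ℝ} {b : Fin d → SpT d → ℝ}
    (h : KerTriple d γ ω a b) {δ : ℝ} (hδ : 0 < δ) {Ω : Set (SpT d)} {u f ut : SpT d → ℝ}
    {D2u : Fin d → Fin d → SpT d → ℝ} (hf : Integrable f) (hfu : ∀ z ∈ Ω, f z = u z)
    (hut : IsWeakDerivOn d Ω u ut (dirT d))
    (hD : ∀ i j, IsWeakDeriv2On d Ω u (D2u i j) (dirS d i) (dirS d j))
    {z₀ : SpT d} (hz : fCyl d δ z₀ ⊆ Ω) :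
    avgKer d γ ω (δ / 2) f z₀ - avgKer d γ ω δ f z₀ =
      (δ ^ (d + γ))⁻¹ * (-(∫ z, dil d a δ (z₀ - z) * ut z) +
        ∑ i, ∫ z, dil d (b i) δ (z₀ - z) * D2u i i z) := by
  have hfu' : ∀ {k : SpT d → ℝ}, IsKer d k → ∀ z,
      dil d k δ (z₀ - z) * f z = dil d k δ (z₀ - z) * u z := by
    intro k hk z
    by_cases hzc : z ∈ fCyl d δ z₀
    · rw [hfu z (hz hzc)]
    · have : dil d k δ (z₀ - z) = 0 :=
        image_eq_zero_of_notMem_tsupport (f := fun z => dil d k δ (z₀ - z))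
          fun hh => hzc (tsupport_dil_sub hk hδ z₀ hh)
      rw [this, zero_mul, zero_mul]
  have hka : IsKer d fun w => fderiv ℝ a w (dirT d) := h.isKer_a.fderiv_apply _
  have hkb : ∀ i, IsKer d fun w => fderiv ℝ (fun w => fderiv ℝ (b i) w (dirS d i)) w (dirS d i) :=
    fun i => ((h.isKer_b i).fderiv_apply _).fderiv_apply _
  have hpt : ∀ z, 2 ^ (d + 2 + γ) * (dil d ω (δ / 2) (z₀ - z) * f z) - dil d ω δ (z₀ - z) * f z =
      dil d (fun w => fderiv ℝ a w (dirT d)) δ (z₀ - z) * f z +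
        ∑ i, dil d (fun w => fderiv ℝ (fun w => fderiv ℝ (b i) w (dirS d i)) w (dirS d i)) δ
          (z₀ - z) * f z := by
    intro z
    rw [← Finset.sum_mul, ← add_mul]
    have := h.eq (dilMap d δ (-(z₀ - z)))
    simp only [dil]
    rw [← this]
    have h2 : dilMap d (δ / 2) (-(z₀ - z)) =
        (4 * (dilMap d δ (-(z₀ - z))).1, (2 : ℝ) • (dilMap d δ (-(z₀ - z))).2) := by
      simp only [dilMap_apply, smul_smul]
      congr 1
      · field_simp; norm_num; ring
      · congr 1; field_simp
    rw [h2]; ring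
  have h_int := integral_congr_ae (μ := volume) (Eventually.of_forall hpt)
  rw [integral_sub ((integrable_dil_sub_mul h.isKer_ω (by positivity) hf z₀).const_mul _)
      (integrable_dil_sub_mul h.isKer_ω hδ hf z₀), integral_const_mul,
    integral_add (integrable_dil_sub_mul hka hδ hf z₀)
      (integrable_finsetSum _ fun i _ => integrable_dil_sub_mul (hkb i) hδ hf z₀),
    integral_finsetSum _ fun i _ => integrable_dil_sub_mul (hkb i) hδ hf z₀] at h_int
  simp_rw [hfu' hka, hfu' (hkb _)] at h_int
  rw [integral_dil_dirT h.isKer_a hδ hut hz] at h_int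
  simp_rw [integral_dil_dirS (h.isKer_b _) hδ (hD _ _) hz] at h_int
  rw [← Finset.mul_sum] at h_int
  rw [avgKer, avgKer, div_pow, inv_div, div_eq_mul_inv, mul_comm (2 ^ _ : ℝ), mul_assoc, ← mul_sub,
    h_int, show d + 2 + γ = d + γ + 2 by ring, pow_add]
  field_simp

theorem measurable_setLIntegral_fCyl (d : ℕ) (δ t : ℝ) {g : SpT d → ℝ≥0∞} (hg : Measurable g) :
    Measurable fun x : Spc d => ∫⁻ z in fCyl d δ (t, x), g z := by
  have hset : MeasurableSet {w : Spc d × SpT d | w.2 ∈ fCyl d δ (t, w.1)} := by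
    have h1 : MeasurableSet {w : Spc d × SpT d | w.2.1 ∈ Ioo t (t + δ ^ 2)} :=
      measurableSet_Ioo.preimage measurable_snd.fst
    have h2 : MeasurableSet {w : Spc d × SpT d | dist w.2.2 w.1 < δ} :=
      measurableSet_lt (measurable_snd.snd.dist measurable_fst) measurable_const
    exact h1.inter h2
  have h : Measurable fun x : Spc d => ∫⁻ z,
      {w : Spc d × SpT d | w.2 ∈ fCyl d δ (t, w.1)}.indicator (fun w => g w.2) (x, z) :=
    Measurable.lintegral_prod_right' ((hg.comp measurable_snd).indicator hset)
  have e : (fun x : Spc d => ∫⁻ z in fCyl d δ (t, x), g z) = fun x : Spc d => ∫⁻ z,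
      {w : Spc d × SpT d | w.2 ∈ fCyl d δ (t, w.1)}.indicator (fun w => g w.2) (x, z) := by
    funext x
    rw [← lintegral_indicator (show MeasurableSet (fCyl d δ (t, x)) from
      measurableSet_Ioo.prod measurableSet_ball)]
    rfl
  rw [e]; exact h

theorem lintegral_fCyl_rpow_le (d : ℕ) {p q r : ℝ} (hp : 1 < p) (hq : 1 < q) (hr : p ≤ r) :
    ∃ C : ℝ≥0, ∀ δ : ℝ, 0 < δ → ∀ (t : ℝ) (g : SpT d → ℝ≥0∞), Measurable g →
      (∫⁻ x, (∫⁻ z in fCyl d δ (t, x), g z) ^ r) ^ (1 / r) ≤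
        C * ENNReal.ofReal (δ ^ (d + 2 - (d / p + 2 / q - d / r))) * mixNorm d p q g := by
  have hp0 : 0 < p := by linarith
  have hr0 : 0 < r := by linarith
  have he1 : 0 ≤ 1 - 1 / p + 1 / r := by
    have : 1 / p ≤ 1 := by rw [div_le_one hp0]; exact hp.le
    have : 0 < 1 / r := by positivity
    linarith
  have he2 : 0 ≤ 1 - 1 / q := by
    rw [sub_nonneg, div_le_one (by linarith)]; exact hq.le
  have hV : volume (ball (0 : Spc d) 1) ^ (1 - 1 / p + 1 / r) ≠ ⊤ :=
    ENNReal.rpow_ne_top_of_nonneg he1 measure_ball_lt_top.ne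
  refine ⟨(volume (ball (0 : Spc d) 1) ^ (1 - 1 / p + 1 / r)).toNNReal, fun δ hδ t g hg => ?_⟩
  refine (lintegral_cyl_rpow_le d hp hq hr t hg).trans_eq ?_
  rw [ENNReal.coe_toNNReal hV, Measure.addHaar_ball_of_pos _ _ hδ,
    ENNReal.mul_rpow_of_nonneg _ _ he1, ENNReal.ofReal_rpow_of_pos (by positivity),
    ENNReal.ofReal_rpow_of_pos (by positivity), mul_comm (ENNReal.ofReal _) (volume _ ^ _),
    mul_assoc (volume _ ^ _), ← ENNReal.ofReal_mul (by positivity)]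
  congr 3
  rw [finrank_euclideanSpace_fin, ← Real.rpow_natCast, ← Real.rpow_natCast, ← Real.rpow_mul hδ.le,
    ← Real.rpow_mul hδ.le, ← Real.rpow_add hδ]
  congr 1
  push_cast
  ring

theorem IsKer.exists_bound {d : ℕ} {k : SpT d → ℝ} (hk : IsKer d k) : ∃ M : ℝ≥0, ∀ z, ‖k z‖ ≤ M := by
  obtain ⟨C, hC⟩ := hk.smooth.continuous.bounded_above_of_compact_support hk.compact
  exact ⟨C.toNNReal, fun z => (hC z).trans (Real.le_coe_toNNReal C)⟩

theorem enorm_integral_dil_le {d : ℕ} {k : SpT d → ℝ} (hk : IsKer d k) {M : ℝ≥0}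
    (hM : ∀ z, ‖k z‖ ≤ M) {δ : ℝ} (hδ : 0 < δ) {z₀ : SpT d} {Ω : Set (SpT d)}
    (hz : fCyl d δ z₀ ⊆ Ω) {f : SpT d → ℝ} {g : SpT d → ℝ≥0∞}
    (hfg : ∀ᵐ z, z ∈ Ω → ‖f z‖ₑ ≤ g z) :
    ‖∫ z, dil d k δ (z₀ - z) * f z‖ₑ ≤ M * ∫⁻ z in fCyl d δ z₀, g z := by
  have hm : MeasurableSet (fCyl d δ z₀) := measurableSet_Ioo.prod measurableSet_ball
  refine (enorm_integral_le_lintegral_enorm _).trans ?_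
  rw [← lintegral_const_mul' _ _ ENNReal.coe_ne_top, ← lintegral_indicator hm]
  refine lintegral_mono_ae ?_
  filter_upwards [hfg] with z hzg
  by_cases hzc : z ∈ fCyl d δ z₀
  · rw [indicator_of_mem hzc, enorm_mul]
    refine mul_le_mul' ?_ (hzg (hz hzc))
    rw [enorm_le_coe]
    exact_mod_cast hM _
  · have : dil d k δ (z₀ - z) = 0 :=
      image_eq_zero_of_notMem_tsupport (f := fun z => dil d k δ (z₀ - z))
        fun hh => hzc (tsupport_dil_sub hk hδ z₀ hh)
    simp [this]

theorem eLpNorm_ofReal_eq {α : Type*} [MeasurableSpace α] {μ : Measure α} {r : ℝ} (hr : 0 < r)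
    (f : α → ℝ) : eLpNorm f (ENNReal.ofReal r) μ = (∫⁻ x, ‖f x‖ₑ ^ r ∂μ) ^ (1 / r) := by
  rw [eLpNorm_eq_lintegral_rpow_enorm_toReal (by simpa using hr) (by simp),
    ENNReal.toReal_ofReal hr.le]

theorem eLpNorm_avgKer_le {d γ : ℕ} {ω : SpT d → ℝ} (hω : IsKer d ω) {p q r κ : ℝ} (hp : 1 < p)
    (hq : 1 < q) (hr : p ≤ r) (hκ : κ = γ + d / p + 2 / q - d / r) :
    ∃ C : ℝ≥0, ∀ δ : ℝ, 0 < δ → ∀ (t : ℝ) (S : Set (Spc d)) (Ω : Set (SpT d)), MeasurableSet S →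
      (∀ x ∈ S, fCyl d δ (t, x) ⊆ Ω) → ∀ (f : SpT d → ℝ) (g : SpT d → ℝ≥0∞), Measurable g →
      (∀ᵐ z, z ∈ Ω → ‖f z‖ₑ ≤ g z) →
      eLpNorm (fun x => avgKer d γ ω δ f (t, x)) (ENNReal.ofReal r) (volume.restrict S) ≤
        C * ENNReal.ofReal (δ ^ (-κ)) * mixNorm d p q g := by
  obtain ⟨M, hM⟩ := hω.exists_bound
  obtain ⟨C, hC⟩ := lintegral_fCyl_rpow_le d hp hq hr
  have hr0 : 0 < r := by linarith
  refine ⟨M * C, fun δ hδ t S Ω hS hcyl f g hg hfg => ?_⟩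
  set c : ℝ≥0∞ := ENNReal.ofReal ((δ ^ (d + 2 + γ))⁻¹) with hc
  rw [eLpNorm_ofReal_eq hr0]
  calc (∫⁻ x in S, ‖avgKer d γ ω δ f (t, x)‖ₑ ^ r) ^ (1 / r)
      ≤ (∫⁻ x in S, (c * M * ∫⁻ z in fCyl d δ (t, x), g z) ^ r) ^ (1 / r) := by
        refine ENNReal.rpow_le_rpow (setLIntegral_mono' hS fun x hx => ?_) (by positivity)
        refine ENNReal.rpow_le_rpow ?_ hr0.le
        rw [avgKer, enorm_mul, mul_assoc]
        refine mul_le_mul' ?_ (enorm_integral_dil_le hω hM hδ (hcyl x hx) hfg)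
        rw [Real.enorm_of_nonneg (by positivity)]
    _ ≤ (∫⁻ x, (c * M * ∫⁻ z in fCyl d δ (t, x), g z) ^ r) ^ (1 / r) :=
        ENNReal.rpow_le_rpow (setLIntegral_le_lintegral _ _) (by positivity)
    _ = c * M * (∫⁻ x, (∫⁻ z in fCyl d δ (t, x), g z) ^ r) ^ (1 / r) := by
        simp_rw [ENNReal.mul_rpow_of_nonneg (c * M) _ hr0.le]
        rw [lintegral_const_mul' _ _ (ENNReal.rpow_ne_top_of_nonneg hr0.le
          (ENNReal.mul_ne_top ENNReal.ofReal_ne_top ENNReal.coe_ne_top)),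
          ENNReal.mul_rpow_of_nonneg _ _ (by positivity), ← ENNReal.rpow_mul,
          mul_one_div_cancel hr0.ne', ENNReal.rpow_one]
    _ ≤ c * M * (C * ENNReal.ofReal (δ ^ (d + 2 - (d / p + 2 / q - d / r))) * mixNorm d p q g) :=
        mul_le_mul' le_rfl (hC δ hδ t g hg)
    _ = (M * C : ℝ≥0) * ENNReal.ofReal (δ ^ (-κ)) * mixNorm d p q g := by
        have : ENNReal.ofReal (δ ^ (-κ)) =
            c * ENNReal.ofReal (δ ^ (d + 2 - (d / p + 2 / q - d / r))) := by
          rw [hc, ← ENNReal.ofReal_mul (by positivity), ← Real.rpow_natCast, ← Real.rpow_neg hδ.le,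
            ← Real.rpow_add hδ, hκ]
          congr 2
          push_cast; ring
        rw [this]; push_cast; ring

theorem KerTriple.eLpNorm_avgKer_half_sub_le {d γ : ℕ} {ω a : SpT d → ℝ} {b : Fin d → SpT d → ℝ}
    (h : KerTriple d γ ω a b) {p q r κ : ℝ} (hp : 1 < p)
    (hq : 1 < q) (hr : p ≤ r) (hκ : κ = γ + d / p + 2 / q - d / r) :
    ∃ C : ℝ≥0, ∀ δ : ℝ, 0 < δ → ∀ (t : ℝ) (S : Set (Spc d)) (Ω : Set (SpT d)), MeasurableSet S →
      (∀ x ∈ S, fCyl d δ (t, x) ⊆ Ω) → ∀ (u f ut : SpT d → ℝ) (D2u : Fin d → Fin d → SpT d → ℝ)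
      (gt gh : SpT d → ℝ≥0∞), Measurable gt → Measurable gh → Integrable f →
      (∀ z ∈ Ω, f z = u z) → IsWeakDerivOn d Ω u ut (dirT d) →
      (∀ i j, IsWeakDeriv2On d Ω u (D2u i j) (dirS d i) (dirS d j)) →
      (∀ᵐ z, z ∈ Ω → ‖ut z‖ₑ ≤ gt z) → (∀ i, ∀ᵐ z, z ∈ Ω → ‖D2u i i z‖ₑ ≤ gh z) →
      eLpNorm (fun x => avgKer d γ ω (δ / 2) f (t, x) - avgKer d γ ω δ f (t, x))
          (ENNReal.ofReal r) (volume.restrict S) ≤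
        C * ENNReal.ofReal (δ ^ (2 - κ)) * (mixNorm d p q gt + mixNorm d p q gh) := by
  obtain ⟨M, hM⟩ := h.isKer_a.exists_bound
  choose Mb hMb using fun i => (h.isKer_b i).exists_bound
  obtain ⟨C, hC⟩ := lintegral_fCyl_rpow_le d hp hq hr
  have hr0 : 0 < r := by linarith
  set M' : ℝ≥0 := M + ∑ i, Mb i with hM'
  refine ⟨M' * C, fun δ hδ t S Ω hS hcyl u f ut D2u gt gh hgt hgh hf hfu hut hD hutg hDg => ?_⟩
  set c : ℝ≥0∞ := ENNReal.ofReal ((δ ^ (d + γ))⁻¹) with hc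
  have hmt := measurable_setLIntegral_fCyl d δ t hgt
  have hmh := measurable_setLIntegral_fCyl d δ t hgh
  rw [eLpNorm_ofReal_eq hr0]
  calc (∫⁻ x in S, ‖avgKer d γ ω (δ / 2) f (t, x) - avgKer d γ ω δ f (t, x)‖ₑ ^ r) ^ (1 / r)
      ≤ (∫⁻ x in S, (c * M' * ((∫⁻ z in fCyl d δ (t, x), gt z) +
          ∫⁻ z in fCyl d δ (t, x), gh z)) ^ r) ^ (1 / r) := by
        refine ENNReal.rpow_le_rpow (setLIntegral_mono' hS fun x hx => ?_) (by positivity)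
        refine ENNReal.rpow_le_rpow ?_ hr0.le
        rw [h.avgKer_half_sub hδ hf hfu hut hD (hcyl x hx), enorm_mul, mul_assoc]
        refine mul_le_mul' (by rw [Real.enorm_of_nonneg (by positivity)]) ?_
        refine (enorm_add_le _ _).trans ?_
        rw [mul_add, enorm_neg]
        refine add_le_add ?_ ?_
        · refine (enorm_integral_dil_le h.isKer_a hM hδ (hcyl x hx) hutg).trans
            (mul_le_mul' ?_ le_rfl)
          exact_mod_cast le_self_add
        · refine (enorm_sum_le _ _).trans ((Finset.sum_le_sum fun i _ =>
            enorm_integral_dil_le (h.isKer_b i) (hMb i) hδ (hcyl x hx) (hDg i)).trans ?_)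
          rw [← Finset.sum_mul]
          refine mul_le_mul' ?_ le_rfl
          rw [hM']; push_cast
          exact le_add_self
    _ ≤ (∫⁻ x, (c * M' * ((∫⁻ z in fCyl d δ (t, x), gt z) +
          ∫⁻ z in fCyl d δ (t, x), gh z)) ^ r) ^ (1 / r) :=
        ENNReal.rpow_le_rpow (setLIntegral_le_lintegral _ _) (by positivity)
    _ = c * M' * (∫⁻ x, ((∫⁻ z in fCyl d δ (t, x), gt z) +
          ∫⁻ z in fCyl d δ (t, x), gh z) ^ r) ^ (1 / r) := by
        simp_rw [ENNReal.mul_rpow_of_nonneg (c * M') _ hr0.le]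
        rw [lintegral_const_mul' _ _ (ENNReal.rpow_ne_top_of_nonneg hr0.le
          (ENNReal.mul_ne_top ENNReal.ofReal_ne_top ENNReal.coe_ne_top)),
          ENNReal.mul_rpow_of_nonneg _ _ (by positivity), ← ENNReal.rpow_mul,
          mul_one_div_cancel hr0.ne', ENNReal.rpow_one]
    _ ≤ c * M' * ((∫⁻ x, (∫⁻ z in fCyl d δ (t, x), gt z) ^ r) ^ (1 / r) +
          (∫⁻ x, (∫⁻ z in fCyl d δ (t, x), gh z) ^ r) ^ (1 / r)) :=
        mul_le_mul' le_rfl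
          (ENNReal.lintegral_Lp_add_le hmt.aemeasurable hmh.aemeasurable (by linarith))
    _ ≤ c * M' * (C * ENNReal.ofReal (δ ^ (d + 2 - (d / p + 2 / q - d / r))) * mixNorm d p q gt +
          C * ENNReal.ofReal (δ ^ (d + 2 - (d / p + 2 / q - d / r))) * mixNorm d p q gh) :=
        mul_le_mul' le_rfl (add_le_add (hC δ hδ t gt hgt) (hC δ hδ t gh hgh))
    _ = (M' * C : ℝ≥0) * ENNReal.ofReal (δ ^ (2 - κ)) *
          (mixNorm d p q gt + mixNorm d p q gh) := by
        have : ENNReal.ofReal (δ ^ (2 - κ)) =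
            c * ENNReal.ofReal (δ ^ (d + 2 - (d / p + 2 / q - d / r))) := by
          rw [hc, ← ENNReal.ofReal_mul (by positivity), ← Real.rpow_natCast, ← Real.rpow_neg hδ.le,
            ← Real.rpow_add hδ, hκ]
          congr 2
          push_cast; ring
        rw [this]; push_cast; ring

/-- The open cylinder `(0, (2ρ)²) × B_{2ρ}`. -/
def dCyl (d : ℕ) (ρ : ℝ) : Set (SpT d) := Ioo (0 : ℝ) ((2 * ρ) ^ 2) ×ˢ ball (0 : Spc d) (2 * ρ)

/-- A function on `(0, (2ρ)²) × B_{2ρ}` extended by zero, together with its weak derivatives and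
measurable majorants of finite mixed norm. -/
structure TraceData (d : ℕ) (p q ρ : ℝ) (u f ut : SpT d → ℝ) (D2u : Fin d → Fin d → SpT d → ℝ)
    (gu gt gh : SpT d → ℝ≥0∞) : Prop where
  measurable_gu : Measurable gu
  measurable_gt : Measurable gt
  measurable_gh : Measurable gh
  integrable : Integrable f
  eq_on : ∀ z ∈ dCyl d ρ, f z = u z
  eq_zero : ∀ z, z ∉ dCyl d ρ → f z = 0
  deriv_t : IsWeakDerivOn d (dCyl d ρ) u ut (dirT d)
  deriv_x : ∀ i j, IsWeakDeriv2On d (dCyl d ρ) u (D2u i j) (dirS d i) (dirS d j)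
  le_gu : ∀ᵐ z, z ∈ dCyl d ρ → ‖f z‖ₑ ≤ gu z
  le_gt : ∀ᵐ z, z ∈ dCyl d ρ → ‖ut z‖ₑ ≤ gt z
  le_gh : ∀ i, ∀ᵐ z, z ∈ dCyl d ρ → ‖D2u i i z‖ₑ ≤ gh z
  gu_ne_top : mixNorm d p q gu ≠ ⊤
  gt_ne_top : mixNorm d p q gt ≠ ⊤
  gh_ne_top : mixNorm d p q gh ≠ ⊤

instance (d : ℕ) : (volume : Measure (SpT d)).IsAddHaarMeasure :=
  inferInstanceAs (Measure.IsAddHaarMeasure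
    ((volume : Measure ℝ).prod (volume : Measure (Spc d))))

theorem avgKer_eq_convolution (d γ : ℕ) (ω : SpT d → ℝ) (δ : ℝ) (f : SpT d → ℝ) (z : SpT d) :
    avgKer d γ ω δ f z = (δ ^ (d + 2 + γ))⁻¹ *
      convolution (dil d ω δ) f (ContinuousLinearMap.lsmul ℝ ℝ) volume z := by
  rw [avgKer, convolution_eq_swap]; rfl

theorem continuous_avgKer {d γ : ℕ} {ω : SpT d → ℝ} (hω : IsKer d ω) {δ : ℝ} (hδ : 0 < δ)
    {f : SpT d → ℝ} (hf : Integrable f) : Continuous (avgKer d γ ω δ f) := by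
  rw [funext (avgKer_eq_convolution d γ ω δ f)]
  exact continuous_const.mul ((hasCompactSupport_dil hω hδ).continuous_convolution_left _
    (contDiff_dil hω.smooth δ).continuous hf.locallyIntegrable)

theorem fCyl_subset_dCyl {d : ℕ} {ρ δ t : ℝ} (hδρ : δ ≤ ρ / 2) (hδ : 0 < δ)
    (ht : t ∈ Icc 0 (ρ ^ 2)) {x : Spc d} (hx : x ∈ ball (0 : Spc d) (3 / 2 * ρ)) :
    fCyl d δ (t, x) ⊆ dCyl d ρ := by
  refine prod_mono (Ioo_subset_Ioo ht.1 ?_) (ball_subset_ball' ?_)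
  · have := ht.2
    simp only []
    nlinarith
  · rw [mem_ball] at hx
    simp only []
    linarith

theorem rpow_dyadic_succ {δ s : ℝ} (hδ : 0 < δ) (n : ℕ) :
    (δ * (1 / 2) ^ (n + 1)) ^ s = (1 / 2) ^ s * (δ * (1 / 2) ^ n) ^ s := by
  rw [← Real.mul_rpow (by positivity) (by positivity)]
  congr 1; ring

theorem KerTriple.eLpNorm_avgKer_dyadic_sub_le {d γ : ℕ} {ω a : SpT d → ℝ} {b : Fin d → SpT d → ℝ}
    (h : KerTriple d γ ω a b) {p q r κ : ℝ} (hp : 1 < p)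
    (hq : 1 < q) (hr : p ≤ r) (hκ : κ = γ + d / p + 2 / q - d / r) (hκ2 : κ < 2) :
    ∃ C : ℝ≥0, ∀ ρ δ : ℝ, 0 < δ → δ ≤ ρ / 2 → ∀ (u f ut : SpT d → ℝ)
      (D2u : Fin d → Fin d → SpT d → ℝ) (gu gt gh : SpT d → ℝ≥0∞),
      TraceData d p q ρ u f ut D2u gu gt gh → ∀ t ∈ Icc 0 (ρ ^ 2), ∀ n m : ℕ, n ≤ m →
      eLpNorm (fun x => avgKer d γ ω (δ * (1 / 2) ^ m) f (t, x) -
          avgKer d γ ω (δ * (1 / 2) ^ n) f (t, x))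
          (ENNReal.ofReal r) (volume.restrict (ball 0 (3 / 2 * ρ))) ≤
        C * ENNReal.ofReal ((δ * (1 / 2) ^ n) ^ (2 - κ)) *
          (mixNorm d p q gt + mixNorm d p q gh) := by
  obtain ⟨C, hC⟩ := h.eLpNorm_avgKer_half_sub_le hp hq hr hκ
  have hx1 : (1 / 2 : ℝ) ^ (2 - κ) < 1 := Real.rpow_lt_one (by norm_num) (by norm_num) (by linarith)
  set y : ℝ := 1 - (1 / 2 : ℝ) ^ (2 - κ) with hy
  have hy0 : 0 < y := by linarith
  have hr1 : 1 ≤ ENNReal.ofReal r := by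
    rw [← ENNReal.ofReal_one]; exact ENNReal.ofReal_le_ofReal (by linarith)
  refine ⟨C * y⁻¹.toNNReal, fun ρ δ hδ hδρ u f ut D2u gu gt gh hT t ht n m hnm => ?_⟩
  set F := mixNorm d p q gt + mixNorm d p q gh with hF
  have hcont : ∀ n : ℕ, Continuous fun x => avgKer d γ ω (δ * (1 / 2) ^ n) f (t, x) := fun n =>
    (continuous_avgKer h.isKer_ω (by positivity) hT.integrable).comp (by fun_prop)
  have hdec : ∀ n : ℕ, (δ * (1 / 2) ^ (n + 1)) ^ (2 - κ) ≤ (δ * (1 / 2) ^ n) ^ (2 - κ) := fun n => by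
    rw [rpow_dyadic_succ hδ]
    exact mul_le_of_le_one_left (by positivity) hx1.le
  have hanti : Antitone fun n : ℕ => (δ * (1 / 2) ^ n) ^ (2 - κ) := antitone_nat_of_succ_le hdec
  suffices hs : eLpNorm (fun x => avgKer d γ ω (δ * (1 / 2) ^ m) f (t, x) -
      avgKer d γ ω (δ * (1 / 2) ^ n) f (t, x)) (ENNReal.ofReal r)
      (volume.restrict (ball 0 (3 / 2 * ρ))) ≤ (C * y⁻¹.toNNReal : ℝ≥0) *
        ENNReal.ofReal ((δ * (1 / 2) ^ n) ^ (2 - κ) - (δ * (1 / 2) ^ m) ^ (2 - κ)) * F by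
    refine hs.trans (mul_le_mul' (mul_le_mul' le_rfl (ENNReal.ofReal_le_ofReal ?_)) le_rfl)
    have : 0 ≤ (δ * (1 / 2) ^ m) ^ (2 - κ) := by positivity
    linarith
  induction m, hnm using Nat.le_induction with
  | base => simp
  | succ m hnm ih =>
    have h1 := hC (δ * (1 / 2) ^ m) (by positivity) t (ball 0 (3 / 2 * ρ)) (dCyl d ρ)
      measurableSet_ball (fun x hx => fCyl_subset_dCyl
        ((mul_le_of_le_one_right hδ.le (pow_le_one₀ (by norm_num) (by norm_num))).trans hδρ)
        (by positivity) ht hx) u f ut D2u gt gh hT.measurable_gt hT.measurable_gh hT.integrable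
      hT.eq_on hT.deriv_t hT.deriv_x hT.le_gt hT.le_gh
    rw [show δ * (1 / 2) ^ m / 2 = δ * (1 / 2 : ℝ) ^ (m + 1) by ring] at h1
    have e : (fun x => avgKer d γ ω (δ * (1 / 2) ^ (m + 1)) f (t, x) -
        avgKer d γ ω (δ * (1 / 2) ^ n) f (t, x)) =
        (fun x => avgKer d γ ω (δ * (1 / 2) ^ (m + 1)) f (t, x) -
          avgKer d γ ω (δ * (1 / 2) ^ m) f (t, x)) +
        fun x => avgKer d γ ω (δ * (1 / 2) ^ m) f (t, x) -
          avgKer d γ ω (δ * (1 / 2) ^ n) f (t, x) := by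
      ext x; simp
    rw [e]
    refine (eLpNorm_add_le ((hcont _).sub (hcont _)).aestronglyMeasurable
      ((hcont _).sub (hcont _)).aestronglyMeasurable hr1).trans ((add_le_add h1 ih).trans_eq ?_)
    have h2 : ENNReal.ofReal ((δ * (1 / 2) ^ m) ^ (2 - κ)) = (y⁻¹.toNNReal : ℝ≥0∞) *
        ENNReal.ofReal ((δ * (1 / 2) ^ m) ^ (2 - κ) - (δ * (1 / 2) ^ (m + 1)) ^ (2 - κ)) := by
      rw [rpow_dyadic_succ hδ, ← one_sub_mul, ← hy, ENNReal.ofReal_mul hy0.le, ← mul_assoc,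
        ← ENNReal.ofReal, ← ENNReal.ofReal_mul (by positivity), inv_mul_cancel₀ hy0.ne',
        ENNReal.ofReal_one, one_mul]
    rw [h2, ENNReal.coe_mul, ← mul_assoc, ← add_mul, ← mul_add, ← ENNReal.ofReal_add
      (sub_nonneg.2 (hdec m)) (sub_nonneg.2 (hanti hnm))]
    congr 3
    ring

/-- The limit of the dyadic averages at time zero. -/
theorem KerTriple.exists_trace {d γ : ℕ} {ω a : SpT d → ℝ} {b : Fin d → SpT d → ℝ}
    (h : KerTriple d γ ω a b) {p q r κ : ℝ} (hp : 1 < p)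
    (hq : 1 < q) (hr : p ≤ r) (hκ : κ = γ + d / p + 2 / q - d / r) (hκ2 : κ < 2) :
    ∃ C : ℝ≥0, ∀ ρ δ : ℝ, 0 < δ → δ ≤ ρ / 2 → ∀ (u f ut : SpT d → ℝ)
      (D2u : Fin d → Fin d → SpT d → ℝ) (gu gt gh : SpT d → ℝ≥0∞),
      TraceData d p q ρ u f ut D2u gu gt gh →
      (∀ t ∈ Icc 0 (ρ ^ 2), ∀ n m : ℕ, n ≤ m →
        eLpNorm (fun x => avgKer d γ ω (δ * (1 / 2) ^ m) f (t, x) -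
          avgKer d γ ω (δ * (1 / 2) ^ n) f (t, x))
          (ENNReal.ofReal r) (volume.restrict (ball 0 (3 / 2 * ρ))) ≤
        C * ENNReal.ofReal ((δ * (1 / 2) ^ n) ^ (2 - κ)) *
          (mixNorm d p q gt + mixNorm d p q gh)) ∧
      ∃ v : Spc d → ℝ, MemLp v (ENNReal.ofReal r) (volume.restrict (ball 0 ρ)) ∧
        (∀ n : ℕ, eLpNorm (fun x => avgKer d γ ω (δ * (1 / 2) ^ n) f (0, x) - v x)
          (ENNReal.ofReal r) (volume.restrict (ball 0 ρ)) ≤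
          C * ENNReal.ofReal ((δ * (1 / 2) ^ n) ^ (2 - κ)) *
            (mixNorm d p q gt + mixNorm d p q gh)) ∧
        eLpNorm v (ENNReal.ofReal r) (volume.restrict (ball 0 ρ)) ≤
          C * ENNReal.ofReal (δ ^ (2 - κ)) * (mixNorm d p q gt + mixNorm d p q gh) +
          C * ENNReal.ofReal (δ ^ (-κ)) * mixNorm d p q gu := by
  obtain ⟨C₁, hC₁⟩ := h.eLpNorm_avgKer_dyadic_sub_le hp hq hr hκ hκ2
  obtain ⟨C₂, hC₂⟩ := eLpNorm_avgKer_le (γ := γ) h.isKer_ω hp hq hr hκ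
  have hr1 : 1 ≤ ENNReal.ofReal r := by
    rw [← ENNReal.ofReal_one]; exact ENNReal.ofReal_le_ofReal (by linarith)
  refine ⟨C₁ + C₂, fun ρ δ hδ hδρ u f ut D2u gu gt gh hT => ?_⟩
  have hρ : 0 < ρ := by linarith
  set F := mixNorm d p q gt + mixNorm d p q gh with hF
  have hFt : F ≠ ⊤ := ENNReal.add_ne_top.2 ⟨hT.gt_ne_top, hT.gh_ne_top⟩
  have hle₁ : (C₁ : ℝ≥0∞) ≤ (C₁ + C₂ : ℝ≥0) := by push_cast; exact le_self_add
  have hle₂ : (C₂ : ℝ≥0∞) ≤ (C₁ + C₂ : ℝ≥0) := by push_cast; exact le_add_self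
  refine ⟨fun t ht n m hnm => (hC₁ ρ δ hδ hδρ u f ut D2u gu gt gh hT t ht n m hnm).trans
    (mul_le_mul' (mul_le_mul' hle₁ le_rfl) le_rfl), ?_⟩
  set μ : Measure (Spc d) := volume.restrict (ball 0 ρ) with hμ
  have hμle : μ ≤ volume.restrict (ball 0 (3 / 2 * ρ)) :=
    Measure.restrict_mono (ball_subset_ball (by linarith)) le_rfl
  set Q : ℕ → Spc d → ℝ := fun n x => avgKer d γ ω (δ * (1 / 2) ^ n) f (0, x) with hQ
  have hQc : ∀ n, Continuous (Q n) := fun n =>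
    (continuous_avgKer h.isKer_ω (by positivity) hT.integrable).comp (by fun_prop)
  have hsub : ∀ n m, n ≤ m → eLpNorm (Q m - Q n) (ENNReal.ofReal r) μ ≤
      C₁ * ENNReal.ofReal ((δ * (1 / 2) ^ n) ^ (2 - κ)) * F := fun n m hnm =>
    (eLpNorm_mono_measure _ hμle).trans
      (hC₁ ρ δ hδ hδρ u f ut D2u gu gt gh hT 0 ⟨le_rfl, by positivity⟩ n m hnm)
  have hQb : ∀ n, eLpNorm (Q n) (ENNReal.ofReal r) μ ≤
      C₂ * ENNReal.ofReal ((δ * (1 / 2) ^ n) ^ (-κ)) * mixNorm d p q gu := fun n =>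
    (eLpNorm_mono_measure _ hμle).trans
      (hC₂ _ (by positivity) 0 _ (dCyl d ρ) measurableSet_ball (fun x hx => fCyl_subset_dCyl
        ((mul_le_of_le_one_right hδ.le (pow_le_one₀ (by norm_num) (by norm_num))).trans hδρ)
        (by positivity) ⟨le_rfl, by positivity⟩ hx) f gu hT.measurable_gu hT.le_gu)
  have hQm : ∀ n, MemLp (Q n) (ENNReal.ofReal r) μ := fun n =>
    ⟨(hQc n).aestronglyMeasurable, (hQb n).trans_lt
      (ENNReal.mul_lt_top (ENNReal.mul_lt_top ENNReal.coe_lt_top ENNReal.ofReal_lt_top)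
        hT.gu_ne_top.lt_top)⟩
  set x : ℝ := (1 / 2 : ℝ) ^ (2 - κ) with hx
  have hx0 : 0 ≤ x := by positivity
  have hx1 : x < 1 := Real.rpow_lt_one (by norm_num) (by norm_num) (by linarith)
  have hpow : ∀ n : ℕ, (δ * (1 / 2) ^ n) ^ (2 - κ) = δ ^ (2 - κ) * x ^ n := fun n => by
    rw [Real.mul_rpow hδ.le (by positivity), hx, ← Real.rpow_natCast, ← Real.rpow_natCast,
      ← Real.rpow_mul (by norm_num), ← Real.rpow_mul (by norm_num), mul_comm (n : ℝ)]
  set K : ℝ := C₁ * F.toReal * δ ^ (2 - κ) with hK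
  have hK0 : 0 ≤ K := by positivity
  have hbound : ∀ n : ℕ, C₁ * ENNReal.ofReal ((δ * (1 / 2) ^ n) ^ (2 - κ)) * F =
      ENNReal.ofReal (K * x ^ n) := fun n => by
    have e : K * x ^ n = C₁ * (δ ^ (2 - κ) * x ^ n) * F.toReal := by rw [hK]; ring
    have h0 : 0 ≤ δ ^ (2 - κ) * x ^ n := by positivity
    rw [hpow, e, ENNReal.ofReal_mul (mul_nonneg C₁.coe_nonneg h0), ENNReal.ofReal_toReal hFt,
      ENNReal.ofReal_mul C₁.coe_nonneg, ENNReal.ofReal_coe_nnreal]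
  obtain ⟨v, hvm, hvlim⟩ := Lp.cauchy_complete_eLpNorm hr1 hQm
    (B := fun n => ENNReal.ofReal (K * x ^ n + (1 / 2) ^ n)) (by
      rw [← ENNReal.ofReal_tsum_of_nonneg (fun n => by positivity)]
      · exact ENNReal.ofReal_ne_top
      exact ((summable_geometric_of_lt_one hx0 hx1).mul_left K).add summable_geometric_two) (by
      intro N n m hn hm
      have hlt : ENNReal.ofReal (K * x ^ N) < ENNReal.ofReal (K * x ^ N + (1 / 2) ^ N) :=
        (ENNReal.ofReal_lt_ofReal_iff (by positivity)).2 (lt_add_of_pos_right _ (by positivity))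
      have hdecr : ∀ k, N ≤ k → ENNReal.ofReal (K * x ^ k) ≤ ENNReal.ofReal (K * x ^ N) :=
        fun k hk => ENNReal.ofReal_le_ofReal (mul_le_mul_of_nonneg_left
          (pow_le_pow_of_le_one hx0 hx1.le hk) hK0)
      refine lt_of_le_of_lt ?_ hlt
      rcases le_total n m with hnm | hnm
      · rw [eLpNorm_sub_comm]
        exact ((hsub n m hnm).trans_eq (hbound n)).trans (hdecr n hn)
      · exact ((hsub m n hnm).trans_eq (hbound m)).trans (hdecr m hm))
  have hv : ∀ n, eLpNorm (Q n - v) (ENNReal.ofReal r) μ ≤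
      C₁ * ENNReal.ofReal ((δ * (1 / 2) ^ n) ^ (2 - κ)) * F := by
    intro n
    have hlim : Tendsto (fun m => C₁ * ENNReal.ofReal ((δ * (1 / 2) ^ n) ^ (2 - κ)) * F +
        eLpNorm (Q m - v) (ENNReal.ofReal r) μ) atTop
        (𝓝 (C₁ * ENNReal.ofReal ((δ * (1 / 2) ^ n) ^ (2 - κ)) * F + 0)) :=
      tendsto_const_nhds.add hvlim
    rw [add_zero] at hlim
    refine ge_of_tendsto hlim ?_
    filter_upwards [eventually_ge_atTop n] with m hm
    rw [← sub_add_sub_cancel (Q n) (Q m) v]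
    refine (eLpNorm_add_le ((hQm n).1.sub (hQm m).1) ((hQm m).1.sub hvm.1) hr1).trans
      (add_le_add ?_ le_rfl)
    rw [eLpNorm_sub_comm]
    exact hsub n m hm
  refine ⟨v, hvm, fun n => (hv n).trans (mul_le_mul' (mul_le_mul' hle₁ le_rfl) le_rfl), ?_⟩
  have h0 := hv 0
  have h1 := hQb 0
  simp only [pow_zero, mul_one] at h0 h1
  rw [← sub_sub_cancel (Q 0) v]
  refine (eLpNorm_sub_le (hQm 0).1 ((hQm 0).1.sub hvm.1) hr1).trans ?_
  rw [add_comm]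
  exact add_le_add (h0.trans (mul_le_mul' (mul_le_mul' hle₁ le_rfl) le_rfl))
    (h1.trans (mul_le_mul' (mul_le_mul' hle₂ le_rfl) le_rfl))

theorem integral_comp_dilation {d : ℕ} {k : SpT d → ℝ} (hk : Continuous k)
    (hc : HasCompactSupport k) {a b : ℝ} (ha : a ≠ 0) (hb : b ≠ 0) :
    ∫ z : SpT d, k (a * z.1, b • z.2) = |a⁻¹| * |(b ^ d)⁻¹| * ∫ z, k z := by
  have h_int : Integrable fun z : SpT d => k (a * z.1, b • z.2) := by
    refine Continuous.integrable_of_hasCompactSupport (hk.comp (by fun_prop)) ?_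
    exact hc.comp_homeomorph ((Homeomorph.mulLeft₀ a ha).prodCongr (Homeomorph.smulOfNeZero b hb))
  rw [Measure.volume_eq_prod, integral_prod _ h_int,
    integral_prod _ (hk.integrable_of_hasCompactSupport hc)]
  have h1 : ∀ t : ℝ, ∫ x : Spc d, k (a * t, b • x) = |(b ^ d)⁻¹| * ∫ x : Spc d, k (a * t, x) :=
    fun t => by
      rw [Measure.integral_comp_smul volume (fun x => k (a * t, x)) b, finrank_euclideanSpace,
        Fintype.card_fin, smul_eq_mul]
  simp_rw [h1]
  rw [integral_const_mul, Measure.integral_comp_mul_left (fun t => ∫ x : Spc d, k (t, x)) a,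
    smul_eq_mul]
  ring

theorem dist_avgKer_le {d : ℕ} {ω : SpT d → ℝ} (hω : IsKer d ω) (hi : ∫ z, ω z = 1)
    (h0 : ∀ z, 0 ≤ ω z) {δ η : ℝ} (hδ : 0 < δ) (hδ1 : δ ≤ 1) (hη : 0 ≤ η) {g : SpT d → ℝ}
    (hg : Continuous g) {z : SpT d} (hgz : ∀ y ∈ ball z δ, dist (g y) (g z) ≤ η) :
    dist (avgKer d 0 ω δ g z) (g z) ≤ η := by
  have e : avgKer d 0 ω δ g z = convolution (fun y => (δ ^ (d + 2))⁻¹ * dil d ω δ y) g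
      (ContinuousLinearMap.lsmul ℝ ℝ) volume z := by
    rw [avgKer, convolution_eq_swap, ← integral_const_mul]
    refine integral_congr_ae (Eventually.of_forall fun y => ?_)
    simp only [ContinuousLinearMap.lsmul_apply, smul_eq_mul]
    ring
  rw [e]
  refine dist_convolution_le hη ?_ (fun x => mul_nonneg (by positivity) (h0 _)) ?_
    hg.aestronglyMeasurable hgz
  · intro y hy
    have h1 : dilMap d δ (0 - y) ∈ tsupport ω := subset_tsupport _ (by
      simp only [Function.mem_support, dil] at hy
      rw [zero_sub]
      exact right_ne_zero_of_mul hy)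
    have h2 := (mem_fCyl_iff hδ y 0).2 (hω.supp h1)
    rw [fCyl, mem_prod] at h2
    obtain ⟨⟨h3, h4⟩, h5⟩ := h2
    simp only [Prod.fst_zero, Prod.snd_zero] at h3 h4 h5
    rw [mem_ball_zero_iff, Prod.norm_def, max_lt_iff, Real.norm_eq_abs, abs_lt]
    rw [mem_ball, dist_zero_left] at h5
    refine ⟨⟨?_, ?_⟩, h5⟩ <;> nlinarith
  · rw [integral_const_mul]
    have h1 : ∀ y : SpT d, dil d ω δ y = ω (-(δ ^ 2)⁻¹ * y.1, (-δ⁻¹) • y.2) := fun y => by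
      simp [dil, dilMap_apply]
    simp_rw [h1]
    rw [integral_comp_dilation hω.smooth.continuous hω.compact (by simp; positivity)
      (by simp; positivity), hi, abs_inv, abs_inv, abs_pow, abs_neg, abs_neg,
      abs_of_pos (show 0 < (δ ^ 2)⁻¹ by positivity), abs_of_pos (show 0 < δ⁻¹ by positivity)]
    rw [inv_inv, inv_pow, inv_inv, mul_one, pow_add, mul_comm (δ ^ 2), inv_mul_cancel₀ (by positivity)]

theorem tendsto_avgKer {d : ℕ} {ω : SpT d → ℝ} (hω : IsKer d ω) (hi : ∫ z, ω z = 1)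
    (h0 : ∀ z, 0 ≤ ω z) {δ : ℕ → ℝ} (hδ : ∀ n, 0 < δ n) (hδ0 : Tendsto δ atTop (𝓝 0))
    {g : SpT d → ℝ} (hg : Continuous g) (z : SpT d) :
    Tendsto (fun n => avgKer d 0 ω (δ n) g z) atTop (𝓝 (g z)) := by
  rw [Metric.tendsto_atTop']
  intro η hη
  obtain ⟨s, hs, hs'⟩ := Metric.continuous_iff.1 hg z (η / 2) (by positivity)
  obtain ⟨N, hN⟩ := eventually_atTop.1 ((hδ0.eventually_lt_const hs).and
    (hδ0.eventually_lt_const one_pos))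
  refine ⟨N, fun n hn => ?_⟩
  have := hN n hn.le
  refine (dist_avgKer_le hω hi h0 (hδ n) this.2.le (by positivity : 0 ≤ η / 2) hg
    fun y hy => (hs' y ?_).le).trans_lt (by linarith)
  exact (mem_ball.1 hy).trans this.1

theorem avgKer_neg_fderiv {d : ℕ} {ω : SpT d → ℝ} (hω : IsKer d ω) {δ : ℝ} (hδ : 0 < δ)
    {g : SpT d → ℝ} (hg : ContDiff ℝ (⊤ : ℕ∞) g) (j : Fin d) (z : SpT d) :
    avgKer d 1 (fun z => -fderiv ℝ ω z (dirS d j)) δ g z =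
      avgKer d 0 ω δ (fun z => fderiv ℝ g z (dirS d j)) z := by
  have hφ := contDiff_dil_sub hω.smooth δ z
  have hφc := hasCompactSupport_dil_sub hω hδ z
  have hg' := contDiff_fderiv_apply hg (dirS d j)
  have hφ' := contDiff_fderiv_apply hφ (dirS d j)
  have hφc' : HasCompactSupport fun w => fderiv ℝ (fun y => dil d ω δ (z - y)) w (dirS d j) :=
    (hφc.fderiv (𝕜 := ℝ)).comp_left (g := fun L : SpT d →L[ℝ] ℝ => L (dirS d j)) rfl
  have h := integral_mul_fderiv_eq_neg_fderiv_mul_of_integrable (μ := volume) (v := dirS d j)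
    (f := fun y => dil d ω δ (z - y)) (g := g)
    ((hφ'.continuous.mul hg.continuous).integrable_of_hasCompactSupport hφc'.mul_right)
    ((hφ.continuous.mul hg'.continuous).integrable_of_hasCompactSupport hφc.mul_right)
    ((hφ.continuous.mul hg.continuous).integrable_of_hasCompactSupport hφc.mul_right)
    (fun y _ => hφ.differentiable (by simp) y) (fun y _ => hg.differentiable (by simp) y)
  simp_rw [fderiv_dil_sub_dirS hω.smooth, mul_assoc, integral_const_mul] at h
  rw [avgKer, avgKer, h]
  have e : ∀ y, dil d (fun z => -fderiv ℝ ω z (dirS d j)) δ (z - y) * g y =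
      -(dil d (fun z => fderiv ℝ ω z (dirS d j)) δ (z - y) * g y) := fun y => by
    simp [dil]
  simp_rw [e, integral_neg, mul_neg]
  rw [← mul_assoc, add_zero, pow_succ δ (d + 2), mul_inv]

/-- The rescaled mollifying kernel. -/
def zetaE (d : ℕ) (ζ : SpT d → ℝ) (ε : ℝ) (w : SpT d) : ℝ :=
  ε ^ (-(d : ℝ) - 2) * ζ (w.1 / ε ^ 2, ε⁻¹ • w.2)

theorem mollify_eq_convolution (d : ℕ) (ζ : SpT d → ℝ) (ε : ℝ) (f : SpT d → ℝ) :
    mollify d ζ ε f = convolution (zetaE d ζ ε) f (ContinuousLinearMap.lsmul ℝ ℝ) volume := rfl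

theorem IsMollifier.hasCompactSupport {d : ℕ} {ζ : SpT d → ℝ} (h : IsMollifier d ζ) :
    HasCompactSupport ζ :=
  HasCompactSupport.of_support_subset_isCompact
    ((isCompact_Icc (a := (-1 : ℝ)) (b := 0)).prod (isCompact_closedBall (0 : Spc d) 1))
    (h.2.2.2.trans (prod_mono Ico_subset_Icc_self ball_subset_closedBall))

theorem contDiff_zetaE {d : ℕ} {ζ : SpT d → ℝ} (h : IsMollifier d ζ) (ε : ℝ) :
    ContDiff ℝ (⊤ : ℕ∞) (zetaE d ζ ε) :=
  contDiff_const.mul (h.1.comp ((contDiff_fst.div_const _).prodMk (contDiff_snd.const_smul _)))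

theorem support_zetaE {d : ℕ} {ζ : SpT d → ℝ} (h : IsMollifier d ζ) {ε : ℝ} (hε : 0 < ε) :
    Function.support (zetaE d ζ ε) ⊆ Ico (-ε ^ 2) 0 ×ˢ ball (0 : Spc d) ε := by
  intro w hw
  have h1 := h.2.2.2 (right_ne_zero_of_mul hw)
  rw [mem_prod, mem_ball_zero_iff, norm_smul, norm_inv, Real.norm_of_nonneg hε.le,
    inv_mul_lt_iff₀ hε, mul_one, mem_Ico, le_div_iff₀ (by positivity), div_lt_iff₀ (by positivity),
    zero_mul, neg_one_mul] at h1
  exact ⟨h1.1, mem_ball_zero_iff.2 h1.2⟩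

theorem hasCompactSupport_zetaE {d : ℕ} {ζ : SpT d → ℝ} (h : IsMollifier d ζ) {ε : ℝ}
    (hε : 0 < ε) : HasCompactSupport (zetaE d ζ ε) :=
  HasCompactSupport.of_support_subset_isCompact
    ((isCompact_Icc (a := (-ε ^ 2 : ℝ)) (b := 0)).prod (isCompact_closedBall (0 : Spc d) ε))
    ((support_zetaE h hε).trans (prod_mono Ico_subset_Icc_self ball_subset_closedBall))

theorem zetaE_nonneg {d : ℕ} {ζ : SpT d → ℝ} (h : IsMollifier d ζ) {ε : ℝ} (hε : 0 < ε)
    (w : SpT d) : 0 ≤ zetaE d ζ ε w :=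
  mul_nonneg (by positivity) (h.2.1 _)

theorem integral_zetaE {d : ℕ} {ζ : SpT d → ℝ} (h : IsMollifier d ζ) {ε : ℝ} (hε : 0 < ε) :
    ∫ w, zetaE d ζ ε w = 1 := by
  simp_rw [zetaE, div_eq_inv_mul]
  rw [integral_const_mul, integral_comp_dilation h.1.continuous h.hasCompactSupport
    (by positivity) (by positivity), h.2.2.1, inv_inv, inv_pow, inv_inv, abs_of_pos (by positivity),
    abs_of_pos (by positivity), mul_one, sub_eq_add_neg, Real.rpow_add hε, Real.rpow_neg hε.le,
    Real.rpow_neg hε.le, Real.rpow_natCast, Real.rpow_two]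
  field_simp

theorem contDiff_mollify {d : ℕ} {ζ : SpT d → ℝ} (h : IsMollifier d ζ) {ε : ℝ}
    (hε : 0 < ε) {f : SpT d → ℝ} (hf : LocallyIntegrable f) :
    ContDiff ℝ (⊤ : ℕ∞) (mollify d ζ ε f) := by
  rw [mollify_eq_convolution]
  exact (hasCompactSupport_zetaE h hε).contDiff_convolution_left _ (contDiff_zetaE h ε) hf

theorem convolution_left_comm {d : ℕ} {A B f : SpT d → ℝ} (hA : Continuous A)
    (hAc : HasCompactSupport A) (hB : Continuous B) (hBc : HasCompactSupport B)
    (hf : LocallyIntegrable f) (z : SpT d) :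
    convolution A (convolution B f (ContinuousLinearMap.lsmul ℝ ℝ) volume)
        (ContinuousLinearMap.lsmul ℝ ℝ) volume z =
      convolution B (convolution A f (ContinuousLinearMap.lsmul ℝ ℝ) volume)
        (ContinuousLinearMap.lsmul ℝ ℝ) volume z := by
  have hfn : LocallyIntegrable fun z => ‖f z‖ := fun z => (hf z).norm
  have key : ∀ {A B : SpT d → ℝ}, Continuous A → HasCompactSupport A → Continuous B →
      HasCompactSupport B → 
      convolution (convolution A B (ContinuousLinearMap.lsmul ℝ ℝ) volume) f
        (ContinuousLinearMap.lsmul ℝ ℝ) volume z =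
      convolution A (convolution B f (ContinuousLinearMap.lsmul ℝ ℝ) volume)
        (ContinuousLinearMap.lsmul ℝ ℝ) volume z := by
    intro A B hA hAc hB hBc
    refine convolution_assoc _ _ _ _ (fun x y z => by simp [mul_assoc]) hA.aestronglyMeasurable
      hB.aestronglyMeasurable hf.aestronglyMeasurable (Eventually.of_forall fun y => ?_)
      (Eventually.of_forall fun y => ?_) ?_
    · exact hBc.convolutionExists_right _ hA.locallyIntegrable hB y
    · exact hBc.norm.convolutionExists_left _ hB.norm hfn y
    · exact hAc.norm.convolutionExists_left _ hA.norm
        (hBc.norm.continuous_convolution_left _ hB.norm hfn).locallyIntegrable z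
  have hcomm : convolution A B (ContinuousLinearMap.lsmul ℝ ℝ) volume =
      convolution B A (ContinuousLinearMap.lsmul ℝ ℝ) volume := by
    ext y
    rw [convolution_eq_swap, convolution_def]
    refine integral_congr_ae (Eventually.of_forall fun t => ?_)
    simp [mul_comm]
  rw [← key hA hAc hB hBc, hcomm, key hB hBc hA hAc]

theorem avgKer_mollify {d γ : ℕ} {ω ζ : SpT d → ℝ} (hω : IsKer d ω) {δ : ℝ} (hδ : 0 < δ)
    (h : IsMollifier d ζ) {ε : ℝ} (hε : 0 < ε) {f : SpT d → ℝ} (hf : LocallyIntegrable f)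
    (z : SpT d) :
    avgKer d γ ω δ (mollify d ζ ε f) z = mollify d ζ ε (avgKer d γ ω δ f) z := by
  rw [avgKer_eq_convolution, mollify_eq_convolution, mollify_eq_convolution,
    convolution_left_comm (contDiff_dil hω.smooth δ).continuous (hasCompactSupport_dil hω hδ)
      (contDiff_zetaE h ε).continuous (hasCompactSupport_zetaE h hε) hf,
    funext (avgKer_eq_convolution d γ ω δ f), convolution, convolution, ← integral_const_mul]
  refine integral_congr_ae (Eventually.of_forall fun y => ?_)
  simp only [ContinuousLinearMap.lsmul_apply, smul_eq_mul]
  ring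

theorem eLpNorm_mollify_le {d : ℕ} {ζ : SpT d → ℝ} (hζ : IsMollifier d ζ) {ε ρ r : ℝ}
    (hε : 0 < ε) (hερ : ε ≤ ρ / 2) (hr : 1 ≤ r) {H : SpT d → ℝ} (hH : Continuous H) {B : ℝ≥0∞}
    (hB : ∀ t ∈ Icc 0 (ρ ^ 2), eLpNorm (fun x => H (t, x)) (ENNReal.ofReal r)
      (volume.restrict (ball 0 (3 / 2 * ρ))) ≤ B) :
    eLpNorm (fun x => mollify d ζ ε H (0, x)) (ENNReal.ofReal r)
      (volume.restrict (ball 0 ρ)) ≤ B := by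
  have hr0 : 0 < r := by linarith
  have hζc := (contDiff_zetaE hζ ε).continuous
  rw [eLpNorm_ofReal_eq hr0]
  set k : Spc d → SpT d → ℝ≥0∞ := fun x w => ‖zetaE d ζ ε w‖ₑ * ‖H ((0, x) - w)‖ₑ with hk
  have hkm : Measurable (Function.uncurry k) := by
    have : Continuous (Function.uncurry k) := by
      have h2 : Continuous fun z : Spc d × SpT d => zetaE d ζ ε z.2 * H ((0, z.1) - z.2) := by
        fun_prop
      convert h2.enorm using 2 with z
      simp [Function.uncurry, hk, enorm_mul]
    exact this.measurable
  calc (∫⁻ x in ball 0 ρ, ‖mollify d ζ ε H (0, x)‖ₑ ^ r) ^ (1 / r)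
      ≤ (∫⁻ x in ball 0 ρ, (∫⁻ w, k x w) ^ r) ^ (1 / r) := by
        gcongr with x
        refine (enorm_integral_le_lintegral_enorm _).trans_eq ?_
        refine lintegral_congr fun w => ?_
        exact enorm_mul (zetaE d ζ ε w) (H ((0, x) - w))
    _ ≤ ∫⁻ w, (∫⁻ x in ball 0 ρ, k x w ^ r) ^ (1 / r) := minkowski_lintegral _ _ hr hkm
    _ ≤ ∫⁻ w, ‖zetaE d ζ ε w‖ₑ * B := by
        refine lintegral_mono fun w => ?_
        by_cases hw : zetaE d ζ ε w = 0
        · simp [hk, hw, ENNReal.zero_rpow_of_pos hr0, ENNReal.zero_rpow_of_pos (inv_pos.2 hr0)]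
        obtain ⟨⟨hw1, hw2⟩, hw3⟩ := support_zetaE hζ hε hw
        rw [mem_ball_zero_iff] at hw3
        have hcm : Continuous fun x => ‖H (-w.1, x)‖ₑ ^ r :=
          ENNReal.continuous_rpow_const.comp (by fun_prop)
        simp only [hk]
        simp_rw [ENNReal.mul_rpow_of_nonneg _ _ hr0.le]
        rw [lintegral_const_mul' _ _ (ENNReal.rpow_ne_top_of_nonneg hr0.le enorm_ne_top),
          ENNReal.mul_rpow_of_nonneg _ _ (by positivity), ← ENNReal.rpow_mul, mul_one_div_cancel hr0.ne',
          ENNReal.rpow_one]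
        gcongr
        refine le_trans ?_ (hB (-w.1) ⟨by linarith, by nlinarith⟩)
        rw [eLpNorm_ofReal_eq hr0]
        gcongr ?_ ^ (1 / r)
        rw [← lintegral_indicator measurableSet_ball, ← lintegral_indicator measurableSet_ball,
          ← lintegral_sub_right_eq_self
            ((ball (0 : Spc d) (3 / 2 * ρ)).indicator fun x => ‖H (-w.1, x)‖ₑ ^ r) w.2]
        refine lintegral_mono fun x => indicator_apply_le' (fun hx => ?_) fun _ => zero_le
        have hxw : x - w.2 ∈ ball (0 : Spc d) (3 / 2 * ρ) := by
          rw [mem_ball_zero_iff] at hx ⊢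
          have := norm_sub_le x w.2
          linarith
        rw [indicator_of_mem hxw]
        refine le_of_eq ?_
        rw [show ((0 : ℝ), x) - w = (-w.1, x - w.2) from Prod.ext (zero_sub _) rfl]
    _ = B := by
        rw [lintegral_mul_const _ hζc.enorm.measurable]
        have : ∀ w, ‖zetaE d ζ ε w‖ₑ = ENNReal.ofReal (zetaE d ζ ε w) := fun w =>
          Real.enorm_of_nonneg (zetaE_nonneg hζ hε w)
        simp_rw [this]
        rw [← ofReal_integral_eq_lintegral_ofReal
          (hζc.integrable_of_hasCompactSupport (hasCompactSupport_zetaE hζ hε))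
          (Eventually.of_forall (zetaE_nonneg hζ hε)), integral_zetaE hζ hε, ENNReal.ofReal_one,
          one_mul]

theorem mollify_sub {d : ℕ} {ζ : SpT d → ℝ} (hζ : IsMollifier d ζ) {ε : ℝ} (hε : 0 < ε)
    {f g : SpT d → ℝ} (hf : LocallyIntegrable f) (hg : LocallyIntegrable g) (z : SpT d) :
    mollify d ζ ε (fun z => f z - g z) z = mollify d ζ ε f z - mollify d ζ ε g z := by
  have hi : ∀ {f : SpT d → ℝ}, LocallyIntegrable f → Integrable fun w =>
      zetaE d ζ ε w * f (z - w) := fun hf =>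
    (hasCompactSupport_zetaE hζ hε).convolutionExists_left (ContinuousLinearMap.lsmul ℝ ℝ)
      (contDiff_zetaE hζ ε).continuous hf z
  have h := integral_sub (hi hf) (hi hg)
  simp_rw [← mul_sub] at h
  exact h

theorem tendsto_mollify_sub_self {d : ℕ} {ζ : SpT d → ℝ} (hζ : IsMollifier d ζ) {r : ℝ}
    {g : SpT d → ℝ} (hg : Continuous g) (hgc : HasCompactSupport g) {ρ : ℝ} :
    Tendsto (fun ε => eLpNorm (fun x => mollify d ζ ε g (0, x) - g (0, x)) (ENNReal.ofReal r)
      (volume.restrict (ball 0 ρ))) (𝓝[>] 0) (𝓝 0) := by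
  set M : ℝ≥0∞ := (volume.restrict (ball (0 : Spc d) ρ)) univ ^ (ENNReal.ofReal r).toReal⁻¹ with hM
  have hMt : M ≠ ⊤ := ENNReal.rpow_ne_top_of_nonneg (by positivity) (by
    rw [Measure.restrict_apply_univ]; exact measure_ball_lt_top.ne)
  have hlim : Tendsto (fun c : ℝ => M * ENNReal.ofReal c) (𝓝[>] 0) (𝓝 0) := by
    have h1 : Tendsto (fun c : ℝ => M * ENNReal.ofReal c) (𝓝 0) (𝓝 (M * ENNReal.ofReal 0)) :=
      ENNReal.Tendsto.const_mul (ENNReal.tendsto_ofReal tendsto_id) (Or.inr hMt)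
    rw [ENNReal.ofReal_zero, mul_zero] at h1
    exact h1.mono_left nhdsWithin_le_nhds
  rw [ENNReal.tendsto_nhds_zero]
  intro η hη
  obtain ⟨c, hc, hc0⟩ := ((ENNReal.tendsto_nhds_zero.1 hlim η hη).and self_mem_nhdsWithin).exists
  obtain ⟨s, hs, hs'⟩ := Metric.uniformContinuous_iff.1
    (hgc.uniformContinuous_of_continuous hg) c hc0
  filter_upwards [Ioo_mem_nhdsGT (lt_min hs one_pos)] with ε hε
  have hε0 := hε.1
  have hε1 := hε.2.trans_le (min_le_right _ _)
  have hεs := hε.2.trans_le (min_le_left _ _)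
  refine (eLpNorm_le_of_ae_bound (C := c) (Eventually.of_forall fun x => ?_)).trans hc
  rw [← dist_eq_norm]
  refine dist_convolution_le (R := s) (le_of_lt hc0) ?_ (zetaE_nonneg hζ hε0) (integral_zetaE hζ hε0)
    hg.aestronglyMeasurable fun y hy => (hs' (mem_ball.1 hy)).le
  intro w hw
  obtain ⟨⟨hw1, hw2⟩, hw3⟩ := support_zetaE hζ hε0 hw
  rw [mem_ball_zero_iff] at hw3
  rw [mem_ball_zero_iff, Prod.norm_def, max_lt_iff, Real.norm_eq_abs, abs_lt]
  refine ⟨⟨?_, ?_⟩, ?_⟩ <;> nlinarith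

theorem hasCompactSupport_avgKer {d γ : ℕ} {ω : SpT d → ℝ} (hω : IsKer d ω) {δ : ℝ} (hδ : 0 < δ)
    {f : SpT d → ℝ} (hf : HasCompactSupport f) : HasCompactSupport (avgKer d γ ω δ f) := by
  rw [funext (avgKer_eq_convolution d γ ω δ f)]
  exact HasCompactSupport.mul_left ((hasCompactSupport_dil hω hδ).convolution _ hf)

theorem TraceData.hasCompactSupport {d : ℕ} {p q ρ : ℝ} {u f ut : SpT d → ℝ}
    {D2u : Fin d → Fin d → SpT d → ℝ} {gu gt gh : SpT d → ℝ≥0∞}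
    (h : TraceData d p q ρ u f ut D2u gu gt gh) : HasCompactSupport f :=
  HasCompactSupport.of_support_subset_isCompact
    ((isCompact_Icc (a := (0 : ℝ)) (b := (2 * ρ) ^ 2)).prod
      (isCompact_closedBall (0 : Spc d) (2 * ρ)))
    (fun z hz => prod_mono Ioo_subset_Icc_self ball_subset_closedBall
      (not_imp_comm.1 (h.eq_zero z) hz))

theorem tendsto_trace {d γ : ℕ} {ω ζ : SpT d → ℝ} (hω : IsKer d ω) (hζ : IsMollifier d ζ)
    {p q r κ ρ δ : ℝ} (hr : 1 ≤ r) (hκ : κ < 2) (hρ : 0 < ρ) (hδ : 0 < δ) {u f ut : SpT d → ℝ}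
    {D2u : Fin d → Fin d → SpT d → ℝ} {gu gt gh : SpT d → ℝ≥0∞}
    (hT : TraceData d p q ρ u f ut D2u gu gt gh) {C : ℝ≥0}
    (hdy : ∀ t ∈ Icc 0 (ρ ^ 2), ∀ n m : ℕ, n ≤ m →
        eLpNorm (fun x => avgKer d γ ω (δ * (1 / 2) ^ m) f (t, x) -
          avgKer d γ ω (δ * (1 / 2) ^ n) f (t, x))
          (ENNReal.ofReal r) (volume.restrict (ball 0 (3 / 2 * ρ))) ≤
        C * ENNReal.ofReal ((δ * (1 / 2) ^ n) ^ (2 - κ)) *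
          (mixNorm d p q gt + mixNorm d p q gh))
    {v : Spc d → ℝ} (hvm : MemLp v (ENNReal.ofReal r) (volume.restrict (ball 0 ρ)))
    (hv : ∀ n : ℕ, eLpNorm (fun x => avgKer d γ ω (δ * (1 / 2) ^ n) f (0, x) - v x)
          (ENNReal.ofReal r) (volume.restrict (ball 0 ρ)) ≤
          C * ENNReal.ofReal ((δ * (1 / 2) ^ n) ^ (2 - κ)) *
            (mixNorm d p q gt + mixNorm d p q gh))
    {G : ℝ → SpT d → ℝ} (hG : ∀ ε, 0 < ε → ∀ z, Tendsto (fun n : ℕ =>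
      avgKer d γ ω (δ * (1 / 2) ^ n) (mollify d ζ ε f) z) atTop (𝓝 (G ε z))) :
    Tendsto (fun ε => eLpNorm (fun x => G ε (0, x) - v x) (ENNReal.ofReal r)
      (volume.restrict (ball 0 ρ))) (𝓝[>] 0) (𝓝 0) := by
  have hr1 : 1 ≤ ENNReal.ofReal r := by
    rw [← ENNReal.ofReal_one]; exact ENNReal.ofReal_le_ofReal hr
  set F := mixNorm d p q gt + mixNorm d p q gh with hF
  have hFt : F ≠ ⊤ := ENNReal.add_ne_top.2 ⟨hT.gt_ne_top, hT.gh_ne_top⟩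
  set Q : ℕ → SpT d → ℝ := fun n => avgKer d γ ω (δ * (1 / 2) ^ n) f with hQ
  have hQc : ∀ n, Continuous (Q n) := fun n =>
    continuous_avgKer hω (by positivity) hT.integrable
  set E : ℕ → ℝ≥0∞ := fun n => C * ENNReal.ofReal ((δ * (1 / 2) ^ n) ^ (2 - κ)) * F with hE
  have hE0 : Tendsto E atTop (𝓝 0) := by
    have h1 : Tendsto (fun n : ℕ => (δ * (1 / 2 : ℝ) ^ n) ^ (2 - κ)) atTop (𝓝 0) := by
      have h2 : Tendsto (fun n : ℕ => δ * (1 / 2 : ℝ) ^ n) atTop (𝓝 (δ * 0)) :=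
        (tendsto_pow_atTop_nhds_zero_of_lt_one (r := (1 / 2 : ℝ)) (by norm_num)
          (by norm_num)).const_mul δ
      rw [mul_zero] at h2
      have h3 := h2.rpow_const (p := 2 - κ) (Or.inr (by linarith))
      rwa [Real.zero_rpow (by linarith)] at h3
    have h2 := ENNReal.Tendsto.mul_const (b := F) (ENNReal.Tendsto.const_mul (a := (C : ℝ≥0∞))
      (ENNReal.tendsto_ofReal h1) (Or.inr ENNReal.coe_ne_top)) (Or.inr hFt)
    simpa only [ENNReal.ofReal_zero, mul_zero, zero_mul] using h2
  have hmc : ∀ ε, 0 < ε → ∀ n, Continuous (mollify d ζ ε (Q n)) := fun ε hε n =>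
    (contDiff_mollify hζ hε (hQc n).locallyIntegrable).continuous
  have hslice : ∀ {g : SpT d → ℝ}, Continuous g → Continuous fun x : Spc d => g (0, x) :=
    fun hg => hg.comp (by fun_prop)
  have hG' : ∀ ε, 0 < ε → ∀ z, Tendsto (fun n : ℕ => mollify d ζ ε (Q n) z) atTop
      (𝓝 (G ε z)) := fun ε hε z => by
    refine (hG ε hε z).congr fun n => ?_
    rw [avgKer_mollify hω (by positivity) hζ hε hT.integrable.locallyIntegrable]
  have hGm : ∀ ε, 0 < ε → AEStronglyMeasurable (fun x : Spc d => G ε (0, x))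
      (volume.restrict (ball 0 ρ)) := fun ε hε =>
    aestronglyMeasurable_of_tendsto_ae atTop (fun n => (hslice (hmc ε hε n)).aestronglyMeasurable)
      (Eventually.of_forall fun x => hG' ε hε (0, x))
  have step : ∀ n, ∀ ε, 0 < ε → ε ≤ ρ / 2 →
      eLpNorm (fun x => G ε (0, x) - mollify d ζ ε (Q n) (0, x)) (ENNReal.ofReal r)
        (volume.restrict (ball 0 ρ)) ≤ E n := by
    intro n ε hε hερ
    refine (Lp.eLpNorm_lim_le_liminf_eLpNorm
      (f := fun m x => mollify d ζ ε (Q m) (0, x) - mollify d ζ ε (Q n) (0, x))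
      (fun m => ((hslice (hmc ε hε m)).sub (hslice (hmc ε hε n))).aestronglyMeasurable) _
      (Eventually.of_forall fun x => (hG' ε hε (0, x)).sub_const _)).trans ?_
    refine liminf_le_of_frequently_le' (Eventually.frequently ?_)
    filter_upwards [eventually_ge_atTop n] with m hm
    refine le_trans (le_of_eq ?_) (eLpNorm_mollify_le hζ hε hερ hr ((hQc m).sub (hQc n))
      fun t ht => hdy t ht n m hm)
    congr 1
    ext x
    exact (mollify_sub hζ hε (hQc m).locallyIntegrable (hQc n).locallyIntegrable _).symm
  rw [ENNReal.tendsto_nhds_zero]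
  intro η hη
  have hη3 : 0 < η / 3 := ENNReal.div_pos hη.ne' (by simp)
  obtain ⟨n, hn⟩ := (ENNReal.tendsto_nhds_zero.1 hE0 _ hη3).exists
  filter_upwards [ENNReal.tendsto_nhds_zero.1 (tendsto_mollify_sub_self hζ
    (hQc n) (hasCompactSupport_avgKer hω (by positivity) hT.hasCompactSupport) (ρ := ρ)) _ hη3,
    Ioc_mem_nhdsGT (half_pos hρ)] with ε h1 hε
  have e : (fun x => G ε (0, x) - v x) = (fun x => G ε (0, x) - mollify d ζ ε (Q n) (0, x)) +
      ((fun x => mollify d ζ ε (Q n) (0, x) - Q n (0, x)) + fun x => Q n (0, x) - v x) := by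
    ext x; simp
  have hm1 := (hslice (hmc ε hε.1 n)).aestronglyMeasurable (μ := volume.restrict (ball 0 ρ))
  have hm2 := (hslice (hQc n)).aestronglyMeasurable (μ := volume.restrict (ball 0 ρ))
  rw [e]
  refine (eLpNorm_add_le ((hGm ε hε.1).sub hm1) ((hm1.sub hm2).add (hm2.sub hvm.1)) hr1).trans ?_
  refine (add_le_add le_rfl (eLpNorm_add_le (hm1.sub hm2) (hm2.sub hvm.1) hr1)).trans ?_
  refine (add_le_add ((step n ε hε.1 hε.2).trans hn) (add_le_add h1 ((hv n).trans hn))).trans ?_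
  rw [← add_assoc, ENNReal.add_thirds]

theorem KerTriple.exists_tendsto_trace {d γ : ℕ} {ω a : SpT d → ℝ} {b : Fin d → SpT d → ℝ}
    (h : KerTriple d γ ω a b) {p q r κ : ℝ} (hp : 1 < p)
    (hq : 1 < q) (hr : p ≤ r) (hκ : κ = γ + d / p + 2 / q - d / r) (hκ2 : κ < 2)
    {D : (SpT d → ℝ) → SpT d → ℝ} (hD : ∀ g, ContDiff ℝ (⊤ : ℕ∞) g → ∀ δ : ℝ, 0 < δ → ∀ z,
      Tendsto (fun n : ℕ => avgKer d γ ω (δ * (1 / 2) ^ n) g z) atTop (𝓝 (D g z))) :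
    ∃ C : ℝ≥0, ∀ ρ δ : ℝ, 0 < δ → δ ≤ ρ / 2 → ∀ (u f ut : SpT d → ℝ)
      (D2u : Fin d → Fin d → SpT d → ℝ) (gu gt gh : SpT d → ℝ≥0∞),
      TraceData d p q ρ u f ut D2u gu gt gh → ∀ ζ, IsMollifier d ζ →
      ∃ v : Spc d → ℝ, MemLp v (ENNReal.ofReal r) (volume.restrict (ball 0 ρ)) ∧
        Tendsto (fun ε => eLpNorm (fun x => D (mollify d ζ ε f) (0, x) - v x) (ENNReal.ofReal r)
          (volume.restrict (ball 0 ρ))) (𝓝[>] 0) (𝓝 0) ∧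
        eLpNorm v (ENNReal.ofReal r) (volume.restrict (ball 0 ρ)) ≤
          C * ENNReal.ofReal (δ ^ (2 - κ)) * (mixNorm d p q gt + mixNorm d p q gh) +
          C * ENNReal.ofReal (δ ^ (-κ)) * mixNorm d p q gu := by
  obtain ⟨C, hC⟩ := h.exists_trace hp hq hr hκ hκ2
  refine ⟨C, fun ρ δ hδ hδρ u f ut D2u gu gt gh hT ζ hζ => ?_⟩
  obtain ⟨hdy, v, hvm, hv, hvb⟩ := hC ρ δ hδ hδρ u f ut D2u gu gt gh hT
  exact ⟨v, hvm, tendsto_trace h.isKer_ω hζ (by linarith) hκ2 (by linarith) hδ hT hdy hvm hv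
    (G := fun ε => D (mollify d ζ ε f)) fun ε hε z =>
      hD _ (contDiff_mollify hζ hε hT.integrable.locallyIntegrable) δ hδ z, hvb⟩

theorem tendsto_mul_half_pow (δ : ℝ) : Tendsto (fun n : ℕ => δ * (1 / 2 : ℝ) ^ n) atTop (𝓝 0) := by
  have h2 : Tendsto (fun n : ℕ => δ * (1 / 2 : ℝ) ^ n) atTop (𝓝 (δ * 0)) :=
    (tendsto_pow_atTop_nhds_zero_of_lt_one (r := (1 / 2 : ℝ)) (by norm_num)
      (by norm_num)).const_mul δ
  rwa [mul_zero] at h2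

theorem exists_tendsto_trace_zero (d : ℕ) {p q r κ : ℝ} (hp : 1 < p)
    (hq : 1 < q) (hr : p ≤ r) (hκ : κ = (0 : ℕ) + d / p + 2 / q - d / r) (hκ2 : κ < 2) :
    ∃ C : ℝ≥0, ∀ ρ δ : ℝ, 0 < δ → δ ≤ ρ / 2 → ∀ (u f ut : SpT d → ℝ)
      (D2u : Fin d → Fin d → SpT d → ℝ) (gu gt gh : SpT d → ℝ≥0∞),
      TraceData d p q ρ u f ut D2u gu gt gh → ∀ ζ, IsMollifier d ζ →
      ∃ v : Spc d → ℝ, MemLp v (ENNReal.ofReal r) (volume.restrict (ball 0 ρ)) ∧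
        Tendsto (fun ε => eLpNorm (fun x => mollify d ζ ε f (0, x) - v x) (ENNReal.ofReal r)
          (volume.restrict (ball 0 ρ))) (𝓝[>] 0) (𝓝 0) ∧
        eLpNorm v (ENNReal.ofReal r) (volume.restrict (ball 0 ρ)) ≤
          C * ENNReal.ofReal (δ ^ (2 - κ)) * (mixNorm d p q gt + mixNorm d p q gh) +
          C * ENNReal.ofReal (δ ^ (-κ)) * mixNorm d p q gu := by
  obtain ⟨ω, a, b, h, hi, h0⟩ := exists_kerTriple_zero d
  exact h.exists_tendsto_trace hp hq hr hκ hκ2 (D := fun g => g) fun g hg δ hδ z =>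
    tendsto_avgKer h.isKer_ω hi h0 (fun n => by positivity) (tendsto_mul_half_pow δ)
      hg.continuous z

theorem exists_tendsto_trace_one (d : ℕ) {p q r κ : ℝ} (hp : 1 < p)
    (hq : 1 < q) (hr : p ≤ r) (hκ : κ = (1 : ℕ) + d / p + 2 / q - d / r) (hκ2 : κ < 2) :
    ∃ C : ℝ≥0, ∀ ρ δ : ℝ, 0 < δ → δ ≤ ρ / 2 → ∀ (u f ut : SpT d → ℝ)
      (D2u : Fin d → Fin d → SpT d → ℝ) (gu gt gh : SpT d → ℝ≥0∞),
      TraceData d p q ρ u f ut D2u gu gt gh → ∀ ζ, IsMollifier d ζ → ∀ j : Fin d,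
      ∃ v : Spc d → ℝ, MemLp v (ENNReal.ofReal r) (volume.restrict (ball 0 ρ)) ∧
        Tendsto (fun ε => eLpNorm (fun x => fderiv ℝ (mollify d ζ ε f) (0, x) (dirS d j) - v x)
          (ENNReal.ofReal r) (volume.restrict (ball 0 ρ))) (𝓝[>] 0) (𝓝 0) ∧
        eLpNorm v (ENNReal.ofReal r) (volume.restrict (ball 0 ρ)) ≤
          C * ENNReal.ofReal (δ ^ (2 - κ)) * (mixNorm d p q gt + mixNorm d p q gh) +
          C * ENNReal.ofReal (δ ^ (-κ)) * mixNorm d p q gu := by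
  obtain ⟨ω, a, b, h, hi, h0⟩ := exists_kerTriple_zero d
  have key := fun j : Fin d => (h.neg_fderiv j).exists_tendsto_trace hp hq hr hκ hκ2
    (D := fun g z => fderiv ℝ g z (dirS d j)) fun g hg δ hδ z => by
      refine (tendsto_avgKer h.isKer_ω hi h0 (δ := fun n : ℕ => δ * (1 / 2) ^ n)
        (fun n => by positivity) (tendsto_mul_half_pow δ)
        (contDiff_fderiv_apply hg (dirS d j)).continuous z).congr fun n => ?_
      rw [avgKer_neg_fderiv h.isKer_ω (by positivity) hg]
  choose C hC using key
  refine ⟨∑ j, C j, fun ρ δ hδ hδρ u f ut D2u gu gt gh hT ζ hζ j => ?_⟩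
  obtain ⟨v, hvm, hv, hvb⟩ := hC j ρ δ hδ hδρ u f ut D2u gu gt gh hT ζ hζ
  have hle : (C j : ℝ≥0∞) ≤ ((∑ j, C j : ℝ≥0) : ℝ≥0∞) :=
    ENNReal.coe_le_coe.2 (Finset.single_le_sum (fun _ _ => zero_le) (Finset.mem_univ j))
  refine ⟨v, hvm, hv, hvb.trans ?_⟩
  gcongr

/-- The set of points near which `u` fails to be integrable. -/
def singSet (d : ℕ) (u : SpT d → ℝ) : Set (SpT d) := {z | ¬ IntegrableAtFilter u (𝓝 z)}

theorem isOpen_compl_singSet (d : ℕ) (u : SpT d → ℝ) : IsOpen (singSet d u)ᶜ := by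
  refine isOpen_iff_mem_nhds.2 fun z hz => ?_
  obtain ⟨s, hs, hu⟩ : IntegrableAtFilter u (𝓝 z) volume := not_not.1 hz
  filter_upwards [eventually_mem_nhds_iff.2 hs] with w hw
  exact not_not.2 ⟨s, hw, hu⟩

theorem exists_integrable_convolution_eventuallyEq {d : ℕ} {k u : SpT d → ℝ}
    (hk : HasCompactSupport k) {z₀ : SpT d} (h : ∀ w ∈ tsupport k, z₀ - w ∉ singSet d u) :
    ∃ g : SpT d → ℝ, Integrable g ∧
      (fun z => ∫ w, k w * u (z - w)) =ᶠ[𝓝 z₀] fun z => ∫ w, k w * g (z - w) := by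
  have hK : IsCompact ((fun w => z₀ - w) '' tsupport k) :=
    IsCompact.image hk (by fun_prop)
  obtain ⟨L, hL, hKL, hLU⟩ := exists_compact_between hK (isOpen_compl_singSet d u)
    (by rintro _ ⟨w, hw, rfl⟩; exact h w hw)
  refine ⟨L.indicator u, (integrable_indicator_iff hL.measurableSet).2 ?_, ?_⟩
  · exact LocallyIntegrableOn.integrableOn_isCompact
      (fun z hz => (not_not.1 (hLU hz) : IntegrableAtFilter u (𝓝 z) volume).filter_mono nhdsWithin_le_nhds) hL
  · have h1 : ∀ᶠ z in 𝓝 z₀, ∀ w ∈ tsupport k, z - w ∈ interior L := by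
      refine IsCompact.eventually_forall_of_forall_eventually hk fun w hw => ?_
      exact (continuous_fst.sub continuous_snd).continuousAt.eventually
        (isOpen_interior.mem_nhds (hKL ⟨w, hw, rfl⟩))
    filter_upwards [h1] with z hz
    refine integral_congr_ae (Eventually.of_forall fun w => ?_)
    by_cases hw : w ∈ tsupport k
    · simp only [indicator_of_mem (interior_subset (hz w hw))]
    · simp only [image_eq_zero_of_notMem_tsupport hw, zero_mul]

theorem differentiableAt_convolution_of_notMem {d : ℕ} {k u : SpT d → ℝ}
    (hk : HasCompactSupport k) (hks : ContDiff ℝ (⊤ : ℕ∞) k) {z₀ : SpT d}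
    (h : ∀ w ∈ tsupport k, z₀ - w ∉ singSet d u) :
    DifferentiableAt ℝ (fun z => ∫ w, k w * u (z - w)) z₀ := by
  obtain ⟨g, hg, he⟩ := exists_integrable_convolution_eventuallyEq hk h
  have := (hk.contDiff_convolution_left (ContinuousLinearMap.lsmul ℝ ℝ) hks
    hg.locallyIntegrable (n := ⊤)).differentiable (by simp) z₀
  exact this.congr_of_eventuallyEq he

theorem convolution_eq_zero_of_mem_singSet {d : ℕ} {k u : SpT d → ℝ} (hks : Continuous k)
    {z₀ y : SpT d} (hy : y ∈ tsupport k) (h : z₀ - y ∈ singSet d u)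
    (hc : ContinuousAt (fun z => ∫ w, k w * u (z - w)) z₀) :
    ∫ w, k w * u (z₀ - w) = 0 := by
  have h1 : Tendsto (fun w => ∫ w', k w' * u (z₀ - y + w - w')) (𝓝 y)
      (𝓝 (∫ w, k w * u (z₀ - w))) := by
    refine Tendsto.comp (g := fun z => ∫ w, k w * u (z - w)) hc ?_
    have : Tendsto (fun w => z₀ - y + w) (𝓝 y) (𝓝 (z₀ - y + y)) :=
      (continuous_const.add continuous_id).tendsto y
    rwa [sub_add_cancel] at this
  refine (isClosed_singleton (x := (0 : ℝ))).mem_of_frequently_of_tendsto ?_ h1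
  refine (mem_closure_iff_frequently.1 hy).mono fun w hw => ?_
  refine integral_undef fun hi => h ?_
  have hw : k w ≠ 0 := hw
  have h2 : IntegrableAtFilter (fun w' => u (z₀ - y + w - w')) (𝓝 w) := by
    obtain ⟨s, hs, hso, hws⟩ : ∃ s ⊆ {w' | |k w| / 2 < |k w'|}, IsOpen s ∧ w ∈ s :=
      mem_nhds_iff.1 (hks.abs.continuousAt.eventually_const_lt
        (by have := abs_pos.2 hw; linarith))
    refine ⟨s, hso.mem_nhds hws, ?_⟩
    have h0 := abs_pos.2 hw
    have hne : ∀ w' ∈ s, k w' ≠ 0 := fun w' hw' h0' => by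
      have : |k w| / 2 < |k w'| := hs hw'
      rw [h0', abs_zero] at this
      linarith
    have h3 : IntegrableOn (fun w' => (k w')⁻¹ * (k w' * u (z₀ - y + w - w'))) s := by
      refine hi.integrableOn.bdd_mul (c := (|k w| / 2)⁻¹) ?_ ?_
      · exact hks.measurable.inv.aestronglyMeasurable
      · filter_upwards [ae_restrict_mem hso.measurableSet] with w' hw'
        rw [norm_inv, Real.norm_eq_abs]
        exact inv_anti₀ (by linarith) (hs hw').le
    refine h3.congr_fun (fun w' hw' => ?_) hso.measurableSet
    simp only
    rw [inv_mul_cancel_left₀ (hne w' hw')]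
  obtain ⟨s, hs, hsi⟩ := h2
  let e : SpT d → SpT d := fun w' => z₀ - y + w - w'
  have he : MeasurePreserving e := volume.measurePreserving_sub_left _
  have hem : MeasurableEmbedding e := (Homeomorph.subLeft (z₀ - y + w)).measurableEmbedding
  refine ⟨e ⁻¹' s, ?_, ?_⟩
  · have hc : Continuous e := by fun_prop
    refine hc.continuousAt.preimage_mem_nhds ?_
    have : e (z₀ - y) = w := by simp [e]
    rwa [this]
  · have h4 := (he.integrableOn_comp_preimage hem (f := u) (s := e ⁻¹' s)).1
    refine h4 ?_
    have : e ⁻¹' (e ⁻¹' s) = s := by ext; simp [e]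
    rwa [this]

theorem fderiv_apply_eq_of_eventuallyEq_line {E : Type*} [NormedAddCommGroup E] [NormedSpace ℝ E]
    {f g : E → ℝ} {z e : E} (hf : DifferentiableAt ℝ f z) (hg : DifferentiableAt ℝ g z)
    (h : ∀ᶠ s : ℝ in 𝓝 0, f (z + s • e) = g (z + s • e)) : fderiv ℝ f z e = fderiv ℝ g z e := by
  rw [← hf.lineDeriv_eq_fderiv, ← hg.lineDeriv_eq_fderiv]
  exact EventuallyEq.deriv_eq h

theorem ae_deriv_eq_zero_of_eq_zero {g : ℝ → ℝ} (hg : Differentiable ℝ g) :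
    ∀ᵐ t, g t = 0 → deriv g t = 0 := by
  let Z : Set ℝ := {t | g t = 0 ∧ deriv g t ≠ 0}
  have hZ : Z.Countable := by
    suffices h : Z ⊆ {t ∈ Z | 𝓝[Z ∩ Ioi t] t = ⊥} from
      countable_setOfPred_isolated_right_within.mono h
    refine fun t ht => ⟨ht, ?_⟩
    have h1 : ∀ᶠ s in 𝓝[>] t, g s ≠ 0 :=
      ((hg t).hasDerivAt.eventually_ne ht.2).filter_mono
        (nhdsWithin_mono t fun s (hs : t < s) => hs.ne')
    rw [inter_comm, nhdsWithin_inter']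
    exact inf_principal_eq_bot.2 (h1.mono fun s hs hsZ => hs hsZ.1)
  filter_upwards [hZ.ae_notMem volume] with t ht h0
  by_contra h1
  exact ht ⟨h0, h1⟩

theorem ae_fderiv_apply_eq_zero_of_eq_zero {d : ℕ} {g : Spc d → ℝ} (hg : ContDiff ℝ 1 g)
    (e : Spc d) : ∀ᵐ x, g x = 0 → fderiv ℝ g x e = 0 := by
  have hm : MeasurableSet {x | g x = 0 → fderiv ℝ g x e = 0} := by
    have h1 : Measurable fun x => fderiv ℝ g x e :=
      ((hg.continuous_fderiv one_ne_zero).clm_apply continuous_const).measurable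
    have : {x | g x = 0 → fderiv ℝ g x e = 0} = {x | g x = 0}ᶜ ∪ {x | fderiv ℝ g x e = 0} := by
      ext x
      simp only [mem_ofPred_eq, mem_union, mem_compl_iff]
      tauto
    rw [this]
    exact (hg.continuous.measurable (measurableSet_singleton 0)).compl.union
      (h1 (measurableSet_singleton 0))
  let L : ℝ →L[ℝ] Spc d := ContinuousLinearMap.smulRight (1 : ℝ →L[ℝ] ℝ) e
  suffices h : ∀ y, ∀ᵐ t : ℝ, y + L.toLinearMap t ∈ {x | g x = 0 → fderiv ℝ g x e = 0} from
    ae_mem_of_ae_add_linearMap_mem L.toLinearMap volume volume hm h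
  intro y
  have hd : ∀ t : ℝ, HasDerivAt (fun t : ℝ => g (y + t • e)) (fderiv ℝ g (y + t • e) e) t := by
    intro t
    have h1 : HasDerivAt (fun t : ℝ => y + t • e) e t := by
      simpa using ((hasDerivAt_id t).smul_const e).const_add y
    exact ((hg.differentiable one_ne_zero) _).hasFDerivAt.comp_hasDerivAt t h1
  filter_upwards [ae_deriv_eq_zero_of_eq_zero (fun t => (hd t).differentiableAt)] with t ht
  rw [(hd t).deriv] at ht
  simpa [L] using ht

theorem exists_symmDiff_small {d : ℕ} {K A : Set (Spc d)} (hA : IsClosed A)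
    (hK : ∀ y ∈ K, ‖y‖ ≤ 1) (ρ : ℝ) :
    ∃ S : Set (Spc d), ∃ T : ℝ → Set (Spc d), (∀ ε, MeasurableSet (T ε)) ∧
      Tendsto (fun ε => volume (T ε)) (𝓝[>] 0) (𝓝 0) ∧
      ∀ ε ∈ Ioo 0 ρ, ∀ x ∈ ball (0 : Spc d) ρ, x ∉ T ε →
        ((∃ y ∈ K, x - ε • y ∈ A) ↔ x ∈ S) := by
  rcases K.eq_empty_or_nonempty with rfl | ⟨y₀, hy₀⟩
  · exact ⟨∅, fun _ => ∅, fun _ => MeasurableSet.empty, by simp, by simp⟩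
  let A' := A ∩ closedBall 0 (2 * ρ)
  have hA' : IsCompact A' := (isCompact_closedBall _ _).inter_left hA
  let P : ℝ → Set (Spc d) := fun ε => (fun x => x - ε • y₀) ⁻¹' A'
  have hPm : ∀ ε, MeasurableSet (P ε) := fun ε =>
    (measurable_id.sub_const (ε • y₀)) hA'.measurableSet
  have hPv : ∀ ε, volume (P ε) = volume A' := fun ε =>
    (measurePreserving_sub_right volume (ε • y₀)).measure_preimage hA'.measurableSet.nullMeasurableSet
  have hcm : ∀ ε, MeasurableSet (cthickening ε A') := fun ε => isClosed_cthickening.measurableSet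
  refine ⟨A, fun ε => (cthickening ε A' \ A') ∪ (cthickening ε A' \ P ε), fun ε =>
    ((hcm ε).diff hA'.measurableSet).union ((hcm ε).diff (hPm ε)), ?_, ?_⟩
  · have h1 : Tendsto (fun ε => volume (cthickening ε A') - volume A') (𝓝[>] 0) (𝓝 0) := by
      have := ENNReal.Tendsto.sub ((tendsto_measure_cthickening_of_isCompact (μ := volume) hA').mono_left
        (nhdsWithin_le_nhds (s := Ioi 0))) (tendsto_const_nhds (x := volume A'))
        (Or.inl hA'.measure_ne_top)
      rwa [tsub_self] at this
    have h2 := h1.add h1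
    rw [add_zero] at h2
    refine tendsto_of_tendsto_of_tendsto_of_le_of_le' tendsto_const_nhds h2
      (Eventually.of_forall fun _ => zero_le) ?_
    filter_upwards [self_mem_nhdsWithin] with ε (hε : 0 < ε)
    refine (measure_union_le _ _).trans (add_le_add ?_ ?_)
    · rw [measure_sdiff (self_subset_cthickening A') hA'.measurableSet.nullMeasurableSet
        hA'.measure_ne_top]
    · have hsub : P ε ⊆ cthickening ε A' := fun x hx =>
        mem_cthickening_of_dist_le x (x - ε • y₀) ε A' hx (by
          rw [dist_eq_norm, _root_.sub_sub_cancel, norm_smul, Real.norm_of_nonneg hε.le]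
          nlinarith [hK y₀ hy₀])
      rw [measure_sdiff hsub (hPm ε).nullMeasurableSet (by rw [hPv]; exact hA'.measure_ne_top), hPv]
  · intro ε hε x hx hxT
    rw [mem_ball_zero_iff] at hx
    have hn : ∀ y ∈ K, ‖ε • y‖ ≤ ε := fun y hy => by
      rw [norm_smul, Real.norm_of_nonneg hε.1.le]
      nlinarith [hK y hy, hε.1]
    simp only [mem_union, Set.mem_sdiff, not_or, not_and, not_not] at hxT
    constructor
    · rintro ⟨y, hy, hyA⟩
      refine (hxT.1 (mem_cthickening_of_dist_le x (x - ε • y) ε A' ⟨hyA, ?_⟩ ?_)).1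
      · rw [mem_closedBall_zero_iff]
        linarith [norm_sub_le x (ε • y), hn y hy, hε.2]
      · rw [dist_eq_norm, _root_.sub_sub_cancel]
        exact hn y hy
    · intro hxA
      exact ⟨y₀, hy₀, (hxT.2 (self_subset_cthickening A' ⟨hxA, mem_closedBall_zero_iff.2
        (by linarith [norm_nonneg x])⟩)).1⟩

theorem map_mem_tsupport {d : ℕ} {ζ : SpT d → ℝ} {ε : ℝ} {w : SpT d}
    (hw : w ∈ tsupport (zetaE d ζ ε)) : (w.1 / ε ^ 2, ε⁻¹ • w.2) ∈ tsupport ζ :=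
  map_mem_closure (f := fun w : SpT d => (w.1 / ε ^ 2, ε⁻¹ • w.2)) (by fun_prop) hw
    fun _ hw' => right_ne_zero_of_mul hw'

theorem map_mem_tsupport_zetaE {d : ℕ} {ζ : SpT d → ℝ} {ε : ℝ} (hε : 0 < ε) {w : SpT d}
    (hw : w ∈ tsupport ζ) : (w.1 * ε ^ 2, ε • w.2) ∈ tsupport (zetaE d ζ ε) := by
  refine map_mem_closure (f := fun w : SpT d => (w.1 * ε ^ 2, ε • w.2)) (by fun_prop) hw
    fun w' hw' => ?_
  rw [Function.mem_support, zetaE]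
  refine mul_ne_zero (by positivity) ?_
  rwa [mul_div_cancel_right₀ _ (by positivity), inv_smul_smul₀ hε.ne']

theorem tsupport_zetaE {d : ℕ} {ζ : SpT d → ℝ} (h : IsMollifier d ζ) {ε : ℝ} (hε : 0 < ε) :
    tsupport (zetaE d ζ ε) ⊆ Icc (-ε ^ 2) 0 ×ˢ closedBall (0 : Spc d) ε :=
  closure_minimal ((support_zetaE h hε).trans (prod_mono Ico_subset_Icc_self ball_subset_closedBall))
    (isClosed_Icc.prod isClosed_closedBall)

theorem sub_mem_dCyl {d : ℕ} {ρ ε : ℝ} (hε : ε ∈ Ioo 0 ρ) {x : Spc d} (hx : x ∈ ball 0 ρ)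
    {w : SpT d} (hw : w ∈ Icc (-ε ^ 2) 0 ×ˢ closedBall (0 : Spc d) ε) (hw0 : w.1 ≠ 0) :
    (0, x) - w ∈ dCyl d ρ := by
  obtain ⟨hw1, hw2⟩ := hw
  rw [mem_closedBall_zero_iff] at hw2
  rw [mem_ball_zero_iff] at hx
  refine ⟨⟨?_, ?_⟩, mem_ball_zero_iff.2 ?_⟩
  · have := lt_of_le_of_ne hw1.2 hw0
    simpa using this
  · have h1 : -w.1 ≤ ε ^ 2 := by linarith [hw1.1]
    have h2 := hε.1
    have h3 := hε.2
    simp only [Prod.fst_sub, zero_sub]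
    nlinarith
  · have := norm_sub_le x w.2
    have h3 := hε.2
    simp only [Prod.snd_sub]
    linarith

theorem mollify_congr_of_eqOn {d : ℕ} {ζ : SpT d → ℝ} (hζ : IsMollifier d ζ) {ρ ε : ℝ}
    (hε : ε ∈ Ioo 0 ρ) {u f : SpT d → ℝ} (hfu : ∀ z ∈ dCyl d ρ, f z = u z) {x : Spc d}
    (hx : x ∈ ball 0 ρ) : mollify d ζ ε u (0, x) = mollify d ζ ε f (0, x) := by
  refine integral_congr_ae (Eventually.of_forall fun w => ?_)
  change zetaE d ζ ε w * u ((0, x) - w) = zetaE d ζ ε w * f ((0, x) - w)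
  by_cases hw : zetaE d ζ ε w = 0
  · rw [hw, zero_mul, zero_mul]
  · have h1 := support_zetaE hζ hε.1 hw
    rw [hfu _ (sub_mem_dCyl hε hx (prod_mono Ico_subset_Icc_self ball_subset_closedBall h1)
      h1.1.2.ne)]

theorem exists_fderiv_mollify_eq_indicator {d : ℕ} {ζ : SpT d → ℝ} (hζ : IsMollifier d ζ) {ρ : ℝ}
    {u f : SpT d → ℝ} (hf : Integrable f) (hfu : ∀ z ∈ dCyl d ρ, f z = u z) :
    ∃ S : Set (Spc d), ∃ R T : ℝ → Set (Spc d), (∀ ε, MeasurableSet (T ε)) ∧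
      Tendsto (fun ε => volume (T ε)) (𝓝[>] 0) (𝓝 0) ∧
      ∀ ε ∈ Ioo 0 ρ, (∀ x ∈ ball (0 : Spc d) ρ, x ∉ T ε → (x ∈ R ε ↔ x ∈ S)) ∧
        ∀ j, ∀ᵐ x, x ∈ ball (0 : Spc d) ρ → fderiv ℝ (mollify d ζ ε u) (0, x) (dirS d j) =
          (R ε)ᶜ.indicator (fun x => fderiv ℝ (mollify d ζ ε f) (0, x) (dirS d j)) x := by
  let K : Set (Spc d) := {y | (0, y) ∈ tsupport ζ}
  let A : Set (Spc d) := {x | (0, x) ∈ singSet d u}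
  have hζs : tsupport ζ ⊆ Icc (-1) 0 ×ˢ closedBall (0 : Spc d) 1 :=
    closure_minimal (hζ.2.2.2.trans (prod_mono Ico_subset_Icc_self ball_subset_closedBall))
      (isClosed_Icc.prod isClosed_closedBall)
  have hA : IsClosed A := (isOpen_compl_iff.1 (isOpen_compl_singSet d u)).preimage (by fun_prop)
  obtain ⟨S, T, hTm, hT, hST⟩ := exists_symmDiff_small (K := K) hA
    (fun y hy => mem_closedBall_zero_iff.1 (hζs hy).2) ρ
  refine ⟨S, fun ε => {x | ∃ y ∈ K, x - ε • y ∈ A}, T, hTm, hT, fun ε hε =>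
    ⟨fun x hx hxT => hST ε hε x hx hxT, fun j => ?_⟩⟩
  have hW : ContDiff ℝ (⊤ : ℕ∞) (mollify d ζ ε f) :=
    contDiff_mollify hζ hε.1 hf.locallyIntegrable
  have hWs : ContDiff ℝ (⊤ : ℕ∞) fun x : Spc d => mollify d ζ ε f (0, x) :=
    hW.comp (contDiff_const.prodMk contDiff_id)
  filter_upwards [ae_fderiv_apply_eq_zero_of_eq_zero (hWs.of_le (by simp))
    (EuclideanSpace.single j 1)] with x hx0 hx
  have hline : ∀ᶠ s : ℝ in 𝓝 0, mollify d ζ ε u ((0, x) + s • dirS d j) =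
      mollify d ζ ε f ((0, x) + s • dirS d j) := by
    have h1 : ∀ᶠ s : ℝ in 𝓝 0, x + s • EuclideanSpace.single j 1 ∈ ball (0 : Spc d) ρ := by
      have hc : Continuous fun s : ℝ => x + s • (EuclideanSpace.single j 1 : Spc d) := by fun_prop
      exact hc.continuousAt.eventually (isOpen_ball.mem_nhds (by simpa using hx))
    filter_upwards [h1] with s hs
    have : (0, x) + s • dirS d j = ((0, x + s • EuclideanSpace.single j 1) : SpT d) := by
      simp [dirS]
    rw [this]
    exact mollify_congr_of_eqOn hζ hε hfu hs
  have hWd : DifferentiableAt ℝ (mollify d ζ ε f) (0, x) := hW.differentiable (by simp) _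
  by_cases hxR : x ∈ {x | ∃ y ∈ K, x - ε • y ∈ A}
  · rw [indicator_of_notMem (not_not.2 hxR)]
    by_cases hd : DifferentiableAt ℝ (mollify d ζ ε u) (0, x)
    · obtain ⟨y, hy, hyA⟩ := hxR
      have hy' : ((0, ε • y) : SpT d) ∈ tsupport (zetaE d ζ ε) := by
        simpa using map_mem_tsupport_zetaE hε.1 hy
      have h1 : mollify d ζ ε u (0, x) = 0 :=
        convolution_eq_zero_of_mem_singSet (contDiff_zetaE hζ ε).continuous hy'
          (by simpa [A] using hyA) hd.continuousAt
      rw [mollify_congr_of_eqOn hζ hε hfu hx] at h1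
      rw [fderiv_apply_eq_of_eventuallyEq_line hd hWd hline]
      refine Eq.trans ?_ (hx0 h1)
      have h2 : HasFDerivAt (fun x : Spc d => ((0, x) : SpT d))
          ((0 : Spc d →L[ℝ] ℝ).prod (ContinuousLinearMap.id ℝ (Spc d))) x :=
        (hasFDerivAt_const (0 : ℝ) x).prodMk (hasFDerivAt_id x)
      exact (DFunLike.congr_fun (hWd.hasFDerivAt.comp x h2).fderiv _).symm
    · rw [fderiv_zero_of_not_differentiableAt hd]
      rfl
  · rw [indicator_of_mem (mem_compl hxR)]
    refine fderiv_apply_eq_of_eventuallyEq_line ?_ hWd hline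
    refine differentiableAt_convolution_of_notMem (hasCompactSupport_zetaE hζ hε.1)
      (contDiff_zetaE hζ ε) fun w hw => ?_
    have hws := tsupport_zetaE hζ hε.1 hw
    by_cases hw0 : w.1 = 0
    · intro hwF
      refine hxR ⟨ε⁻¹ • w.2, ?_, ?_⟩
      · simpa [K, hw0] using map_mem_tsupport hw
      · rw [smul_inv_smul₀ hε.1.ne']
        simpa [A, hw0, Prod.sub_def] using hwF
    · refine not_not.2 ⟨dCyl d ρ, (isOpen_Ioo.prod isOpen_ball).mem_nhds
        (sub_mem_dCyl hε hx hws hw0), ?_⟩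
      exact hf.integrableOn.congr_fun hfu (measurableSet_Ioo.prod measurableSet_ball)

theorem exists_tendsto_fderiv_mollify {d : ℕ} {ζ : SpT d → ℝ} (hζ : IsMollifier d ζ) {ρ r : ℝ}
    (hρ : 0 < ρ) (hr : 1 ≤ r)
    {u f : SpT d → ℝ} (hf : Integrable f) (hfu : ∀ z ∈ dCyl d ρ, f z = u z) {v : Fin d → Spc d → ℝ}
    (hv : ∀ j, MemLp (v j) (ENNReal.ofReal r) (volume.restrict (ball 0 ρ)))
    (h : ∀ j, Tendsto (fun ε => eLpNorm (fun x => fderiv ℝ (mollify d ζ ε f) (0, x) (dirS d j) - v j x)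
      (ENNReal.ofReal r) (volume.restrict (ball 0 ρ))) (𝓝[>] 0) (𝓝 0)) :
    ∃ w : Fin d → Spc d → ℝ, (∀ j x, ‖w j x‖ ≤ ‖v j x‖) ∧
      ∀ j, Tendsto (fun ε => eLpNorm (fun x => fderiv ℝ (mollify d ζ ε u) (0, x) (dirS d j) - w j x)
        (ENNReal.ofReal r) (volume.restrict (ball 0 ρ))) (𝓝[>] 0) (𝓝 0) := by
  obtain ⟨S, R, T, hTm, hT, hRT⟩ := exists_fderiv_mollify_eq_indicator hζ hf hfu
  refine ⟨fun j => Sᶜ.indicator (v j), fun j x => norm_indicator_le_norm_self _ _, fun j => ?_⟩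
  have hvT : Tendsto (fun ε => eLpNorm ((T ε).indicator (v j)) (ENNReal.ofReal r)
      (volume.restrict (ball 0 ρ))) (𝓝[>] 0) (𝓝 0) := by
    have hr0 : 0 < r := by linarith
    have h1 := tendsto_setLIntegral_zero (μ := volume.restrict (ball (0 : Spc d) ρ)) (s := T) (l := 𝓝[>] 0)
      (f := fun x => ‖v j x‖ₑ ^ r) ?_ ?_
    · have h2 := ((ENNReal.continuous_rpow_const (y := 1 / r)).tendsto 0).comp h1
      rw [ENNReal.zero_rpow_of_pos (by positivity)] at h2
      refine h2.congr fun ε => ?_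
      rw [eLpNorm_indicator_eq_eLpNorm_restrict (hTm ε), eLpNorm_ofReal_eq hr0]
      rfl
    · have h2 := (hv j).2
      rw [eLpNorm_ofReal_eq hr0] at h2
      exact fun h3 => h2.ne (by rw [h3, ENNReal.top_rpow_of_pos (by positivity)])
    · exact tendsto_of_tendsto_of_tendsto_of_le_of_le tendsto_const_nhds hT (fun _ => zero_le)
        fun ε => Measure.restrict_apply_le _ _
  have hsum := (h j).add hvT
  rw [add_zero] at hsum
  refine tendsto_of_tendsto_of_tendsto_of_le_of_le' tendsto_const_nhds hsum
    (Eventually.of_forall fun _ => zero_le) ?_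
  filter_upwards [Ioo_mem_nhdsGT hρ] with ε hε
  obtain ⟨hRS, hae⟩ := hRT ε hε
  set G := fun x => fderiv ℝ (mollify d ζ ε f) (0, x) (dirS d j)
  have hGc : Continuous G :=
    (contDiff_fderiv_apply (contDiff_mollify hζ hε.1 hf.locallyIntegrable)
      (dirS d j)).continuous.comp (by fun_prop)
  have hm1 : AEStronglyMeasurable (fun x => ‖G x - v j x‖) (volume.restrict (ball 0 ρ)) :=
    (hGc.aestronglyMeasurable.sub (hv j).1).norm
  have hm2 : AEStronglyMeasurable (fun x => ‖(T ε).indicator (v j) x‖) (volume.restrict (ball 0 ρ)) :=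
    ((hv j).1.indicator (hTm ε)).norm
  have h3 := eLpNorm_add_le hm1 hm2 (p := ENNReal.ofReal r) (by simpa using hr)
  rw [eLpNorm_norm, eLpNorm_norm] at h3
  refine le_trans (eLpNorm_mono_ae ?_) h3
  filter_upwards [ae_restrict_of_ae (hae j), ae_restrict_mem measurableSet_ball] with x hx hxb
  rw [hx hxb, Pi.add_apply, Real.norm_of_nonneg (add_nonneg (norm_nonneg _) (norm_nonneg _))]
  have h4 := hRS x hxb
  change ‖(R ε)ᶜ.indicator G x - Sᶜ.indicator (v j) x‖ ≤ _
  clear_value G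
  have h5 := norm_nonneg (G x - v j x)
  have h6 := norm_nonneg (v j x)
  have h7 : ‖G x‖ ≤ ‖G x - v j x‖ + ‖v j x‖ := norm_le_norm_sub_add _ _
  by_cases hxT : x ∈ T ε <;> by_cases hxR : x ∈ R ε <;> by_cases hxS : x ∈ S <;>
    simp only [indicator, mem_compl_iff, hxT, hxR, hxS, not_true_eq_false, not_false_eq_true,
      if_true, if_false, sub_zero, zero_sub, norm_neg, norm_zero, add_zero, forall_true_left,
      iff_true, iff_false] at h4 ⊢ <;> linarith

theorem mixNorm_mono_ae {d : ℕ} {p q : ℝ} (hp : 0 < p) (hq : 0 < q) {f g : SpT d → ℝ≥0∞}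
    (h : ∀ᵐ z, f z ≤ g z) : mixNorm d p q f ≤ mixNorm d p q g := by
  refine ENNReal.rpow_le_rpow (lintegral_mono_ae ?_) (by positivity)
  filter_upwards [Measure.ae_ae_of_ae_prod h] with t ht
  refine ENNReal.rpow_le_rpow (lintegral_mono_ae ?_) (by positivity)
  filter_upwards [ht] with x hx
  exact ENNReal.rpow_le_rpow hx hp.le

theorem mixNorm_congr_ae {d : ℕ} {p q : ℝ} (hp : 0 < p) (hq : 0 < q) {f g : SpT d → ℝ≥0∞}
    (h : ∀ᵐ z, f z = g z) : mixNorm d p q f = mixNorm d p q g :=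
  le_antisymm (mixNorm_mono_ae hp hq (h.mono fun _ hz => hz.le))
    (mixNorm_mono_ae hp hq (h.mono fun _ hz => hz.ge))

theorem mixNorm_eq_nested {d : ℕ} {p q : ℝ} (f : SpT d → ℝ≥0∞) :
    mixNorm d p q f = (∫⁻ t : ℝ, ((∫⁻ x : Spc d, f (t, x) ^ p) ^ (1 / p)) ^ q) ^ (1 / q) := by
  simp_rw [mixNorm, ← ENNReal.rpow_mul, one_div_mul_eq_div]

theorem measurable_lintegral_rpow {d : ℕ} (p : ℝ) {f : SpT d → ℝ≥0∞} (hf : Measurable f) :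
    Measurable fun t : ℝ => (∫⁻ x : Spc d, f (t, x) ^ p) ^ (1 / p) :=
  (Measurable.lintegral_prod_right' (hf.pow_const p)).pow_const _

theorem mixNorm_add_le {d : ℕ} {p q : ℝ} (hp : 1 ≤ p) (hq : 1 ≤ q) {f g : SpT d → ℝ≥0∞}
    (hf : Measurable f) (hg : Measurable g) :
    mixNorm d p q (fun z => f z + g z) ≤ mixNorm d p q f + mixNorm d p q g := by
  simp_rw [mixNorm_eq_nested]
  refine le_trans ?_ (ENNReal.lintegral_Lp_add_le (measurable_lintegral_rpow p hf).aemeasurable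
    (measurable_lintegral_rpow p hg).aemeasurable hq)
  refine ENNReal.rpow_le_rpow (lintegral_mono fun t => ENNReal.rpow_le_rpow ?_ (by positivity))
    (by positivity)
  exact ENNReal.lintegral_Lp_add_le (hf.comp measurable_prodMk_left).aemeasurable
    (hg.comp measurable_prodMk_left).aemeasurable hp

theorem mixNorm_sum_ne_top {d : ℕ} {p q : ℝ} (hp : 1 ≤ p) (hq : 1 ≤ q) {ι : Type*} (s : Finset ι)
    {f : ι → SpT d → ℝ≥0∞} (hf : ∀ i, Measurable (f i)) (h : ∀ i, mixNorm d p q (f i) ≠ ⊤) :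
    mixNorm d p q (fun z => ∑ i ∈ s, f i z) ≠ ⊤ := by
  classical
  induction s using Finset.induction_on with
  | empty =>
    have hp0 : 0 < p := by linarith
    have hq0 : 0 < q := by linarith
    simp [mixNorm, hp0, hq0, div_pos hq0 hp0]
  | insert i s hi ih =>
    simp_rw [Finset.sum_insert hi]
    exact ne_top_of_le_ne_top (ENNReal.add_ne_top.2 ⟨h i, ih⟩)
      (mixNorm_add_le hp hq (hf i) (Finset.measurable_fun_sum _ fun i _ => hf i))

theorem measurableSet_pCyl (d : ℕ) (ρ t : ℝ) (x : Spc d) : MeasurableSet (pCyl d ρ t x) :=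
  measurableSet_Ico.prod measurableSet_ball

/-- A measurable representative of the modulus of a function on a measurable set. -/
theorem exists_measurable_enorm {d : ℕ} {p q : ℝ} (hp : 0 < p) (hq : 0 < q) {A : Set (SpT d)}
    (hA : MeasurableSet A) {h : SpT d → ℝ} (hm : AEStronglyMeasurable h (volume.restrict A)) :
    ∃ g : SpT d → ℝ≥0∞, Measurable g ∧ (∀ᵐ z, g z = A.indicator (fun z => ‖h z‖ₑ) z) ∧
      mixNorm d p q g = lpqNorm d p q h A := by
  have h1 : AEMeasurable (A.indicator fun z => ‖h z‖ₑ) volume :=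
    (aemeasurable_indicator_iff hA).2 hm.enorm
  refine ⟨h1.mk _, h1.measurable_mk, h1.ae_eq_mk.symm, ?_⟩
  rw [mixNorm_congr_ae hp hq h1.ae_eq_mk.symm, mixNorm, lpqNorm]
  refine congrArg (· ^ (1 / q)) (lintegral_congr fun t => congrArg (· ^ (q / p))
    (lintegral_congr fun x => ?_))
  by_cases hz : (t, x) ∈ A
  · rw [indicator_of_mem hz, indicator_of_mem hz, Real.enorm_eq_ofReal_abs]
  · rw [indicator_of_notMem hz, indicator_of_notMem hz, ENNReal.zero_rpow_of_pos hp]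

theorem lintegral_pCyl_lt_top {d : ℕ} {p q ρ : ℝ} (hp : 1 < p) (hq : 1 < q) {g : SpT d → ℝ≥0∞}
    (hg : Measurable g) (h : mixNorm d p q g ≠ ⊤) (t : ℝ) (x : Spc d) :
    ∫⁻ z in pCyl d ρ t x, g z < ⊤ := by
  rw [mixNorm_eq_nested] at h
  have hV : volume (ball x ρ) ≠ ⊤ := measure_ball_lt_top.ne
  have hT : volume (Ico t (t + ρ ^ 2)) ≠ ⊤ := by simp
  have hp' : 0 ≤ 1 - 1 / p := by
    rw [sub_nonneg, div_le_one (by linarith)]; exact hp.le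
  have hq' : 0 ≤ 1 - 1 / q := by
    rw [sub_nonneg, div_le_one (by linarith)]; exact hq.le
  rw [pCyl, Measure.volume_eq_prod, ← Measure.prod_restrict, lintegral_prod _ hg.aemeasurable]
  calc ∫⁻ s in Ico t (t + ρ ^ 2), ∫⁻ y in ball x ρ, g (s, y)
      ≤ ∫⁻ s in Ico t (t + ρ ^ 2), (∫⁻ y, g (s, y) ^ p) ^ (1 / p) *
          volume (ball x ρ) ^ (1 - 1 / p) := by
        refine lintegral_mono fun s => ?_
        refine (lintegral_le_rpow_mul_measure _ hp
          (hg.comp measurable_prodMk_left).aemeasurable).trans ?_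
        rw [Measure.restrict_apply_univ]
        have := Measure.restrict_le_self (μ := (volume : Measure (Spc d))) (s := ball x ρ)
        gcongr
        exact le_rfl
    _ = (∫⁻ s in Ico t (t + ρ ^ 2), (∫⁻ y, g (s, y) ^ p) ^ (1 / p)) *
          volume (ball x ρ) ^ (1 - 1 / p) :=
        lintegral_mul_const _ (measurable_lintegral_rpow p hg)
    _ ≤ ((∫⁻ s, ((∫⁻ y, g (s, y) ^ p) ^ (1 / p)) ^ q) ^ (1 / q) *
          volume (Ico t (t + ρ ^ 2)) ^ (1 - 1 / q)) * volume (ball x ρ) ^ (1 - 1 / p) := by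
        gcongr
        refine (lintegral_le_rpow_mul_measure _ hq
          (measurable_lintegral_rpow p hg).aemeasurable).trans ?_
        rw [Measure.restrict_apply_univ]
        gcongr
        exact Measure.restrict_le_self
    _ < ⊤ := ENNReal.mul_lt_top (ENNReal.mul_lt_top h.lt_top
        (ENNReal.rpow_lt_top_of_nonneg hq' hT)) (ENNReal.rpow_lt_top_of_nonneg hp' hV)

theorem lpqNorm_pCyl_eq {d : ℕ} {p q ρ : ℝ} (hp : 0 < p) (hq : 0 < q) (hρ : 0 < ρ) (t : ℝ)
    (x : Spc d) (f : SpT d → ℝ) :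
    lpqNorm d p q f (pCyl d ρ t x) = volume (ball x ρ) ^ (1 / p) *
      ENNReal.ofReal (ρ ^ 2) ^ (1 / q) * avgLpq d p q ρ t x f := by
  have hV : volume (ball x ρ) ≠ ⊤ := measure_ball_lt_top.ne
  have hV0 : volume (ball x ρ) ≠ 0 := (measure_ball_pos _ _ hρ).ne'
  have hT0 : ENNReal.ofReal (ρ ^ 2) ≠ 0 := by simp [hρ.ne']
  have h1 : ∀ s, (∫⁻ y, (pCyl d ρ t x).indicator (fun z => ENNReal.ofReal |f z| ^ p) (s, y)) ^
      (q / p) = (Ico t (t + ρ ^ 2)).indicator (fun s => (∫⁻ y in ball x ρ,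
        ENNReal.ofReal |f (s, y)| ^ p) ^ (q / p)) s := by
    intro s
    by_cases hs : s ∈ Ico t (t + ρ ^ 2)
    · rw [indicator_of_mem hs, ← lintegral_indicator measurableSet_ball]
      refine congrArg (· ^ (q / p)) (lintegral_congr fun y => ?_)
      by_cases hy : y ∈ ball x ρ
      · rw [indicator_of_mem hy, indicator_of_mem (show (s, y) ∈ pCyl d ρ t x from ⟨hs, hy⟩)]
      · rw [indicator_of_notMem hy, indicator_of_notMem (fun h => hy h.2)]
    · rw [indicator_of_notMem hs]
      have : ∀ y, (pCyl d ρ t x).indicator (fun z => ENNReal.ofReal |f z| ^ p) (s, y) = 0 :=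
        fun y => indicator_of_notMem (fun h => hs h.1) _
      simp [this, div_pos hq hp]
  simp_rw [lpqNorm, avgLpq, h1]
  rw [lintegral_indicator measurableSet_Ico]
  simp_rw [div_eq_mul_inv (_ : ℝ≥0∞), ENNReal.mul_rpow_of_nonneg _ _ (div_nonneg hq.le hp.le)]
  rw [lintegral_mul_const' _ _ (ENNReal.rpow_ne_top_of_nonneg (by positivity)
    (ENNReal.inv_ne_top.2 hV0)), ENNReal.mul_rpow_of_nonneg _ _ (by positivity),
    ENNReal.mul_rpow_of_nonneg _ _ (by positivity), ← ENNReal.rpow_mul,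
    show q / p * (1 / q) = 1 / p by field_simp, ENNReal.inv_rpow, ENNReal.inv_rpow]
  set a := volume (ball x ρ) ^ (1 / p) with ha
  set b := ENNReal.ofReal (ρ ^ 2) ^ (1 / q) with hb
  have ha0 : a ≠ 0 := by simp [ha, ENNReal.rpow_eq_zero_iff, hV, hV0]
  have hat : a ≠ ⊤ := ENNReal.rpow_ne_top_of_nonneg (by positivity) hV
  have hb0 : b ≠ 0 := by simp [hb, ENNReal.rpow_eq_zero_iff, hT0]
  have hbt : b ≠ ⊤ := ENNReal.rpow_ne_top_of_nonneg (by positivity) ENNReal.ofReal_ne_top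
  generalize (∫⁻ s in Ico t (t + ρ ^ 2), _ : ℝ≥0∞) ^ (1 / q) = X
  rw [show a * b * (X * a⁻¹ * b⁻¹) = X * (a * a⁻¹) * (b * b⁻¹) by ring,
    ENNReal.mul_inv_cancel ha0 hat, ENNReal.mul_inv_cancel hb0 hbt, mul_one, mul_one]

theorem dCyl_subset_pCyl (d : ℕ) (ρ : ℝ) : dCyl d ρ ⊆ pCyl d (2 * ρ) 0 0 := by
  rintro ⟨t, x⟩ ⟨ht, hx⟩
  exact ⟨⟨ht.1.le, by simpa using ht.2⟩, hx⟩

theorem abs_le_hessMag {d : ℕ} (D2u : Fin d → Fin d → SpT d → ℝ) (i j : Fin d) (z : SpT d) :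
    |D2u i j z| ≤ hessMag d D2u z := by
  refine Real.abs_le_sqrt ?_
  refine (Finset.single_le_sum (f := fun j => D2u i j z ^ 2) (fun j _ => sq_nonneg _)
    (Finset.mem_univ j)).trans ?_
  exact Finset.single_le_sum (f := fun i => ∑ j, D2u i j z ^ 2)
    (fun i _ => Finset.sum_nonneg fun j _ => sq_nonneg _) (Finset.mem_univ i)

theorem sqrt_sum_sq_le_sum_abs {ι : Type*} (s : Finset ι) (a : ι → ℝ) :
    √(∑ i ∈ s, a i ^ 2) ≤ ∑ i ∈ s, |a i| := by
  refine Real.sqrt_le_iff.2 ⟨Finset.sum_nonneg fun i _ => abs_nonneg _, ?_⟩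
  simpa using Finset.sum_sq_le_sq_sum_of_nonneg (s := s) (f := fun i => |a i|)
    fun i _ => abs_nonneg _

theorem hessMag_le_sum {d : ℕ} (D2u : Fin d → Fin d → SpT d → ℝ) (z : SpT d) :
    hessMag d D2u z ≤ ∑ i, ∑ j, |D2u i j z| := by
  rw [hessMag, ← Finset.sum_product', ← Finset.sum_product']
  exact sqrt_sum_sq_le_sum_abs _ fun k : Fin d × Fin d => D2u k.1 k.2 z

theorem aestronglyMeasurable_hessMag {d : ℕ} {μ : Measure (SpT d)}
    {D2u : Fin d → Fin d → SpT d → ℝ} (h : ∀ i j, AEStronglyMeasurable (D2u i j) μ) :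
    AEStronglyMeasurable (hessMag d D2u) μ := by
  refine Real.continuous_sqrt.comp_aestronglyMeasurable ?_
  refine Finset.aestronglyMeasurable_fun_sum _ fun i _ =>
    Finset.aestronglyMeasurable_fun_sum _ fun j _ => ?_
  exact (h i j).pow 2

theorem exists_traceData {d : ℕ} {p q ρ : ℝ} (hp : 1 < p) (hq : 1 < q)
    {u ut : SpT d → ℝ} {D2u : Fin d → Fin d → SpT d → ℝ}
    (hu : MemLpqOn d p q u (pCyl d (2 * ρ) 0 0))
    (hD2u : ∀ i j, MemLpqOn d p q (D2u i j) (pCyl d (2 * ρ) 0 0))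
    (hut : MemLpqOn d p q ut (pCyl d (2 * ρ) 0 0))
    (hx : ∀ i j, IsWeakDeriv2On d (dCyl d ρ) u (D2u i j) (dirS d i) (dirS d j))
    (ht : IsWeakDerivOn d (dCyl d ρ) u ut (dirT d)) :
    ∃ f gu gt gh, TraceData d p q ρ u f ut D2u gu gt gh ∧
      mixNorm d p q gu = lpqNorm d p q u (pCyl d (2 * ρ) 0 0) ∧
      mixNorm d p q gt = lpqNorm d p q ut (pCyl d (2 * ρ) 0 0) ∧
      mixNorm d p q gh = lpqNorm d p q (hessMag d D2u) (pCyl d (2 * ρ) 0 0) := by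
  have hp0 : 0 < p := by linarith
  have hq0 : 0 < q := by linarith
  have hC := measurableSet_pCyl d (2 * ρ) 0 0
  have hD : MeasurableSet (dCyl d ρ) := measurableSet_Ioo.prod measurableSet_ball
  have hDC := dCyl_subset_pCyl d ρ
  obtain ⟨gu, gum, gue, gun⟩ := exists_measurable_enorm hp0 hq0 hC hu.1
  obtain ⟨gt, gtm, gte, gtn⟩ := exists_measurable_enorm hp0 hq0 hC hut.1
  obtain ⟨gh, ghm, ghe, ghn⟩ := exists_measurable_enorm hp0 hq0 hC
    (aestronglyMeasurable_hessMag fun i j => (hD2u i j).1)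
  choose g gm ge gn using fun i j => exists_measurable_enorm hp0 hq0 hC (hD2u i j).1
  have key {h : SpT d → ℝ} {k : SpT d → ℝ≥0∞}
      (hk : ∀ᵐ z, k z = (pCyl d (2 * ρ) 0 0).indicator (fun z => ‖h z‖ₑ) z) :
      ∀ᵐ z, z ∈ dCyl d ρ → ‖h z‖ₑ ≤ k z := by
    filter_upwards [hk] with z hz hzD
    rw [hz, indicator_of_mem (hDC hzD)]
  refine ⟨(dCyl d ρ).indicator u, gu, gt, gh, ⟨gum, gtm, ghm, ?_, fun z hz => indicator_of_mem hz _,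
    fun z hz => indicator_of_notMem hz _, ht, hx, ?_, key gte, fun i => ?_,
    gun ▸ hu.2, gtn ▸ hut.2, ?_⟩, gun, gtn, ghn⟩
  · rw [integrable_indicator_iff hD]
    refine ⟨hu.1.mono_set hDC, ?_⟩
    refine lt_of_le_of_lt ?_ (lintegral_pCyl_lt_top hp hq gum (gun ▸ hu.2) 0 0 (ρ := 2 * ρ))
    refine le_trans ?_ (lintegral_mono_set hDC)
    exact setLIntegral_mono_ae' hD (key gue)
  · filter_upwards [key gue] with z hz hzD
    rw [indicator_of_mem hzD]
    exact hz hzD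
  · filter_upwards [key ghe] with z hz hzD
    refine le_trans ?_ (hz hzD)
    rw [Real.enorm_eq_ofReal_abs, Real.enorm_eq_ofReal_abs]
    exact ENNReal.ofReal_le_ofReal ((abs_le_hessMag D2u i i z).trans (le_abs_self _))
  · refine ne_top_of_le_ne_top (mixNorm_sum_ne_top hp.le hq.le Finset.univ
      (f := fun k : Fin d × Fin d => g k.1 k.2) (fun k => gm _ _)
      fun k => gn k.1 k.2 ▸ (hD2u k.1 k.2).2) (mixNorm_mono_ae hp0 hq0 ?_)
    have hge : ∀ᵐ z, ∀ k : Fin d × Fin d, g k.1 k.2 z =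
        (pCyl d (2 * ρ) 0 0).indicator (fun z => ‖D2u k.1 k.2 z‖ₑ) z :=
      ae_all_iff.2 fun k => ge k.1 k.2
    filter_upwards [ghe, hge] with z hz hzg
    rw [hz]
    by_cases hzC : z ∈ pCyl d (2 * ρ) 0 0
    · rw [indicator_of_mem hzC, Real.enorm_eq_ofReal (show 0 ≤ hessMag d D2u z from Real.sqrt_nonneg _)]
      refine (ENNReal.ofReal_le_ofReal (hessMag_le_sum D2u z)).trans_eq ?_
      rw [← Finset.sum_product', ENNReal.ofReal_sum_of_nonneg fun _ _ => abs_nonneg _]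
      refine Finset.sum_congr rfl fun k _ => ?_
      rw [hzg, indicator_of_mem hzC, Real.enorm_eq_ofReal_abs]
    · rw [indicator_of_notMem hzC]
      exact zero_le

theorem exists_trace_scale {κ γ ρ ε : ℝ} (hκ : κ < 2) (hρ : 0 < ρ) (hε : 0 < ε) :
    ∃ δ, 0 < δ ∧ δ ≤ ρ / 2 ∧ ρ ^ (κ - γ) * δ ^ (2 - κ) ≤ ε ∧
      ρ ^ (κ - γ) * δ ^ (-κ) ≤ 4 * (ε * ρ ^ (-2 : ℝ) +
        ε ^ (-κ / (2 - κ)) * ρ ^ ((2 * κ - 2 * γ) / (2 - κ))) := by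
  have hκ' : 0 < 2 - κ := by linarith
  set n := (ε * ρ ^ (γ - κ)) ^ (1 / (2 - κ)) with hn
  have hn0 : 0 < n := by positivity
  have hnp : n ^ (2 - κ) = ε * ρ ^ (γ - κ) := by
    rw [hn, ← Real.rpow_mul (by positivity), one_div_mul_cancel hκ'.ne', Real.rpow_one]
  set m := min ρ n with hm
  have hm0 : 0 < m := lt_min hρ hn0
  have hmp : m ^ (2 - κ) ≤ ε * ρ ^ (γ - κ) :=
    hnp ▸ Real.rpow_le_rpow hm0.le (min_le_right _ _) hκ'.le
  have hcancel : ρ ^ (κ - γ) * (ε * ρ ^ (γ - κ)) = ε := by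
    rw [mul_left_comm, ← Real.rpow_add hρ, show κ - γ + (γ - κ) = 0 by ring, Real.rpow_zero,
      mul_one]
  refine ⟨m / 2, by positivity, by linarith [min_le_left ρ n], ?_, ?_⟩
  · calc ρ ^ (κ - γ) * (m / 2) ^ (2 - κ) ≤ ρ ^ (κ - γ) * (ε * ρ ^ (γ - κ)) := by
          gcongr
          exact (Real.rpow_le_rpow (by positivity) (by linarith) hκ'.le).trans hmp
      _ = ε := hcancel
  · have h2 : (m / 2) ^ (-κ) ≤ 4 * m ^ (-κ) := by
      rw [Real.div_rpow hm0.le zero_le_two, Real.rpow_neg zero_le_two, div_inv_eq_mul, mul_comm]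
      gcongr
      refine (Real.rpow_le_rpow_of_exponent_le one_le_two hκ.le).trans ?_
      norm_num
    have h3 : ρ ^ (κ - γ) * m ^ (-κ) ≤ ε * ρ ^ (-2 : ℝ) +
        ε ^ (-κ / (2 - κ)) * ρ ^ ((2 * κ - 2 * γ) / (2 - κ)) := by
      rcases le_total ρ n with h | h
      · have hmρ : m = ρ := min_eq_left h
        rw [hmρ] at hmp ⊢
        have : ρ ^ (κ - γ) * ρ ^ (-κ) = ρ ^ (κ - γ) * ρ ^ (2 - κ) * ρ ^ (-2 : ℝ) := by
          rw [← Real.rpow_add hρ, ← Real.rpow_add hρ, ← Real.rpow_add hρ]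
          congr 1; ring
        rw [this]
        refine le_add_of_le_of_nonneg ?_ (by positivity)
        gcongr
        exact (mul_le_mul_of_nonneg_left hmp (by positivity)).trans_eq hcancel
      · refine le_add_of_nonneg_of_le (by positivity) (le_of_eq ?_)
        rw [min_eq_right h] at hm
        rw [hm, hn, ← Real.rpow_mul (by positivity), Real.mul_rpow hε.le (by positivity),
          ← Real.rpow_mul hρ.le, mul_left_comm, ← Real.rpow_add hρ]
        congr 2
        · field_simp
        · field_simp
          ring
    calc ρ ^ (κ - γ) * (m / 2) ^ (-κ) ≤ ρ ^ (κ - γ) * (4 * m ^ (-κ)) := by gcongr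
      _ = 4 * (ρ ^ (κ - γ) * m ^ (-κ)) := by ring
      _ ≤ _ := by gcongr

theorem volume_ball_eq_ofReal {d : ℕ} (s : ℝ) (hs : 0 < s) :
    volume (ball (0 : Spc d) s) =
      ENNReal.ofReal (s ^ d * (volume (ball (0 : Spc d) 1)).toReal) := by
  rw [Measure.addHaar_ball_of_pos _ _ hs, ENNReal.ofReal_mul (by positivity),
    ENNReal.ofReal_toReal measure_ball_lt_top.ne, finrank_euclideanSpace_fin]

theorem exists_cylinder_div_ball_eq (d : ℕ) (p q r : ℝ) :
    ∃ K : ℝ≥0, ∀ ρ : ℝ, 0 < ρ → volume (ball (0 : Spc d) (2 * ρ)) ^ (1 / p) *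
      ENNReal.ofReal ((2 * ρ) ^ 2) ^ (1 / q) * volume (ball (0 : Spc d) ρ) ^ (-(1 / r)) =
        K * ENNReal.ofReal (ρ ^ (d / p + 2 / q - d / r)) := by
  set v := (volume (ball (0 : Spc d) 1)).toReal with hv
  have hv0 : 0 < v := ENNReal.toReal_pos (measure_ball_pos _ _ one_pos).ne' measure_ball_lt_top.ne
  refine ⟨((2 ^ d * v) ^ (1 / p) * (2 ^ 2) ^ (1 / q) * v ^ (-(1 / r))).toNNReal, fun ρ hρ => ?_⟩
  rw [volume_ball_eq_ofReal _ hρ, volume_ball_eq_ofReal (2 * ρ) (by positivity), ← hv,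
    ENNReal.ofReal_rpow_of_pos (by positivity), ENNReal.ofReal_rpow_of_pos (by positivity),
    ENNReal.ofReal_rpow_of_pos (by positivity), ← ENNReal.ofReal_mul (by positivity),
    ← ENNReal.ofReal_mul (by positivity)]
  change _ = ENNReal.ofReal _ * _
  rw [← ENNReal.ofReal_mul (by positivity)]
  congr 1
  rw [mul_pow, mul_pow, mul_right_comm (2 ^ d),
    Real.mul_rpow (x := 2 ^ d * v) (by positivity) (by positivity),
    Real.mul_rpow (x := 2 ^ 2) (by positivity) (by positivity),
    Real.mul_rpow (x := ρ ^ d) (by positivity) (by positivity),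
    ← Real.rpow_natCast_mul hρ.le, ← Real.rpow_natCast_mul hρ.le, ← Real.rpow_natCast_mul hρ.le,
    show (d : ℝ) / p + 2 / q - d / r = d * (1 / p) + (2 : ℕ) * (1 / q) + d * -(1 / r) by
      push_cast; ring, Real.rpow_add hρ, Real.rpow_add hρ]
  ring

/-- Choice of the averaging scale turning the trace estimate into the interpolation inequality. -/
theorem exists_trace_bound (d : ℕ) {p q r κ γ : ℝ}
    (hκ : κ = γ + d / p + 2 / q - d / r) (hκ2 : κ < 2) (C : ℝ≥0) :
    ∃ N : ℝ≥0, ∀ ρ ε : ℝ, 0 < ρ → 0 < ε → ∃ δ, 0 < δ ∧ δ ≤ ρ / 2 ∧ ∀ X a b c W : ℝ≥0∞,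
      W = volume (ball (0 : Spc d) (2 * ρ)) ^ (1 / p) * ENNReal.ofReal ((2 * ρ) ^ 2) ^ (1 / q) →
      X ≤ C * ENNReal.ofReal (δ ^ (2 - κ)) * (W * a + W * b) +
        C * ENNReal.ofReal (δ ^ (-κ)) * (W * c) →
      X * volume (ball (0 : Spc d) ρ) ^ (-(1 / r)) ≤
        N * ENNReal.ofReal ε * (a + b) + N * ENNReal.ofReal (ε * ρ ^ (-2 : ℝ) +
          ε ^ (-κ / (2 - κ)) * ρ ^ ((2 * κ - 2 * γ) / (2 - κ))) * c := by
  obtain ⟨K, hK⟩ := exists_cylinder_div_ball_eq d p q r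
  refine ⟨4 * C * K, fun ρ ε hρ hε => ?_⟩
  obtain ⟨δ, hδ, hδρ, h1, h2⟩ := exists_trace_scale (γ := γ) hκ2 hρ hε
  refine ⟨δ, hδ, hδρ, fun X a b c W hW hX => ?_⟩
  have hKρ := hK ρ hρ
  rw [← hW, show (d : ℝ) / p + 2 / q - d / r = κ - γ by rw [hκ]; ring] at hKρ
  have h1' : ENNReal.ofReal (δ ^ (2 - κ)) * ENNReal.ofReal (ρ ^ (κ - γ)) ≤ ENNReal.ofReal ε := by
    rw [← ENNReal.ofReal_mul (by positivity), mul_comm]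
    exact ENNReal.ofReal_le_ofReal h1
  have h2' := ENNReal.ofReal_le_ofReal h2
  rw [mul_comm, ENNReal.ofReal_mul (by positivity), ENNReal.ofReal_mul (by positivity)] at h2'
  set V := volume (ball (0 : Spc d) ρ) ^ (-(1 / r))
  calc X * V ≤ (C * ENNReal.ofReal (δ ^ (2 - κ)) * (W * a + W * b) +
        C * ENNReal.ofReal (δ ^ (-κ)) * (W * c)) * V := by gcongr
    _ = C * ENNReal.ofReal (δ ^ (2 - κ)) * (W * V) * (a + b) +
        C * ENNReal.ofReal (δ ^ (-κ)) * (W * V) * c := by ring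
    _ = C * K * (ENNReal.ofReal (δ ^ (2 - κ)) * ENNReal.ofReal (ρ ^ (κ - γ))) * (a + b) +
        C * K * (ENNReal.ofReal (δ ^ (-κ)) * ENNReal.ofReal (ρ ^ (κ - γ))) * c := by
        rw [hKρ]; ring
    _ ≤ 4 * (C * K * ENNReal.ofReal ε * (a + b)) + C * K * (ENNReal.ofReal 4 *
        ENNReal.ofReal (ε * ρ ^ (-2 : ℝ) +
          ε ^ (-κ / (2 - κ)) * ρ ^ ((2 * κ - 2 * γ) / (2 - κ)))) * c := by
        refine add_le_add ?_ (by gcongr)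
        refine le_trans (by gcongr) (le_mul_of_one_le_left' (by norm_num))
    _ = _ := by
        rw [ENNReal.ofReal_ofNat]
        push_cast
        ring

theorem rpow_avg_eq_eLpNorm_mul {d : ℕ} {r ρ : ℝ} (hr : 0 < r) (v : Spc d → ℝ) :
    ((∫⁻ x in ball (0 : Spc d) ρ, ENNReal.ofReal |v x| ^ r) / volume (ball (0 : Spc d) ρ)) ^ (1 / r) =
      eLpNorm v (ENNReal.ofReal r) (volume.restrict (ball 0 ρ)) *
        volume (ball (0 : Spc d) ρ) ^ (-(1 / r)) := by
  simp_rw [eLpNorm_ofReal_eq hr, Real.enorm_eq_ofReal_abs]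
  rw [ENNReal.div_rpow_of_nonneg _ _ (by positivity), ENNReal.rpow_neg, div_eq_mul_inv]

theorem tendstoLr_iff {d : ℕ} {r : ℝ} (hr : 0 < r) {B : Set (Spc d)} {F : ℝ → Spc d → ℝ}
    {v : Spc d → ℝ} : TendstoLr d r B F v ↔ Tendsto (fun ε =>
      eLpNorm (fun x => F ε x - v x) (ENNReal.ofReal r) (volume.restrict B)) (𝓝[>] 0) (𝓝 0) := by
  simp_rw [eLpNorm_ofReal_eq hr, Real.enorm_eq_ofReal_abs]
  rfl

theorem eLpNorm_sqrt_sum_sq_le {ι α : Type*} [MeasurableSpace α] {μ : Measure α} {r : ℝ≥0∞}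
    (hr : 1 ≤ r) (s : Finset ι) {v w : ι → α → ℝ} (hv : ∀ i, MemLp (v i) r μ)
    (hwv : ∀ i x, ‖w i x‖ ≤ ‖v i x‖) :
    eLpNorm (fun x => √(∑ i ∈ s, w i x ^ 2)) r μ ≤ ∑ i ∈ s, eLpNorm (v i) r μ := by
  calc eLpNorm (fun x => √(∑ i ∈ s, w i x ^ 2)) r μ
      ≤ eLpNorm (∑ i ∈ s, fun x => ‖v i x‖) r μ := by
        refine eLpNorm_mono_real fun x => ?_
        rw [Real.norm_of_nonneg (Real.sqrt_nonneg _), Finset.sum_apply]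
        exact (sqrt_sum_sq_le_sum_abs _ _).trans (Finset.sum_le_sum fun i _ => hwv i x)
    _ ≤ ∑ i ∈ s, eLpNorm (fun x => ‖v i x‖) r μ :=
        eLpNorm_sum_le (fun i _ => (hv i).1.norm) hr
    _ = ∑ i ∈ s, eLpNorm (v i) r μ := by simp_rw [eLpNorm_norm]

/-- Corollary 6,19.1: for `ρ ∈ (0,1]`, `ε > 0` and
    `u ∈ W^{1,2}_{p,q}(C_{2ρ})`, the trace `D^γ u(0,·)` (the `L_r(B_ρ)`-limit
    of `D^γ u^{(ε')}(0,·)`) satisfies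
    `⨍‖D^γ u(0,·)‖_{L_r(B_ρ)} ≤ Nε ⨍‖∂ₜu, D²u‖_{L_{p,q}(C_{2ρ})}
      + N(ερ⁻² + ε^{-κ/(2-κ)} ρ^{(2κ-2γ)/(2-κ)}) ⨍‖u‖_{L_{p,q}(C_{2ρ})}`. -/
theorem statement12 (d : ℕ) (hd : 1 ≤ d) (p q r : ℝ)
    (hp : 1 < p) (hq : 1 < q) (hr : p ≤ r) (γ : ℕ) (hγ : γ = 0 ∨ γ = 1)
    (κ : ℝ) (hκdef : κ = (γ : ℝ) + (d : ℝ) / p + 2 / q - (d : ℝ) / r) (hκ : κ < 2) :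
    ∃ N : ℝ≥0, ∀ ζ : SpT d → ℝ, IsMollifier d ζ →
      ∀ ρ : ℝ, 0 < ρ → ρ ≤ 1 → ∀ ε : ℝ, 0 < ε →
      ∀ (u : SpT d → ℝ) (Du : Fin d → SpT d → ℝ)
        (D2u : Fin d → Fin d → SpT d → ℝ) (ut : SpT d → ℝ),
        MemLpqOn d p q u (pCyl d (2 * ρ) 0 0) →
        (∀ i, MemLpqOn d p q (Du i) (pCyl d (2 * ρ) 0 0)) →
        (∀ i j, MemLpqOn d p q (D2u i j) (pCyl d (2 * ρ) 0 0)) →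
        MemLpqOn d p q ut (pCyl d (2 * ρ) 0 0) →
        (∀ i, IsWeakDerivOn d (Set.Ioo (0 : ℝ) ((2 * ρ) ^ 2) ×ˢ Metric.ball (0 : Spc d) (2 * ρ))
          u (Du i) (dirS d i)) →
        (∀ i j, IsWeakDeriv2On d (Set.Ioo (0 : ℝ) ((2 * ρ) ^ 2) ×ˢ Metric.ball (0 : Spc d) (2 * ρ))
          u (D2u i j) (dirS d i) (dirS d j)) →
        IsWeakDerivOn d (Set.Ioo (0 : ℝ) ((2 * ρ) ^ 2) ×ˢ Metric.ball (0 : Spc d) (2 * ρ))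
          u ut (dirT d) →
        (γ = 0 → ∃ v : Spc d → ℝ,
          TendstoLr d r (Metric.ball (0 : Spc d) ρ) (fun ε' x => mollify d ζ ε' u (0, x)) v ∧
          ((∫⁻ x in Metric.ball (0 : Spc d) ρ, ENNReal.ofReal |v x| ^ r) /
              volume (Metric.ball (0 : Spc d) ρ)) ^ (1 / r) ≤
            N * ENNReal.ofReal ε *
                (avgLpq d p q (2 * ρ) 0 0 ut + avgLpq d p q (2 * ρ) 0 0 (hessMag d D2u))
              + N * ENNReal.ofReal (ε * ρ ^ (-2 : ℝ)
                    + ε ^ (-κ / (2 - κ)) * ρ ^ ((2 * κ - 2 * (γ : ℝ)) / (2 - κ))) *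
                  avgLpq d p q (2 * ρ) 0 0 u) ∧
        (γ = 1 → ∃ v : Fin d → Spc d → ℝ,
          (∀ i, TendstoLr d r (Metric.ball (0 : Spc d) ρ)
            (fun ε' x => fderiv ℝ (mollify d ζ ε' u) (0, x) (dirS d i)) (v i)) ∧
          ((∫⁻ x in Metric.ball (0 : Spc d) ρ,
                ENNReal.ofReal (Real.sqrt (∑ i, (v i x) ^ 2)) ^ r) /
              volume (Metric.ball (0 : Spc d) ρ)) ^ (1 / r) ≤
            N * ENNReal.ofReal ε *
                (avgLpq d p q (2 * ρ) 0 0 ut + avgLpq d p q (2 * ρ) 0 0 (hessMag d D2u))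
              + N * ENNReal.ofReal (ε * ρ ^ (-2 : ℝ)
                    + ε ^ (-κ / (2 - κ)) * ρ ^ ((2 * κ - 2 * (γ : ℝ)) / (2 - κ))) *
                  avgLpq d p q (2 * ρ) 0 0 u) := by
  have hp0 : 0 < p := by linarith
  have hq0 : 0 < q := by linarith
  have hr0 : 0 < r := by linarith
  have hr1 : 1 ≤ r := by linarith
  rcases hγ with rfl | rfl
  · obtain ⟨C, hC⟩ := exists_tendsto_trace_zero d hp hq hr hκdef hκ
    obtain ⟨N, hN⟩ := exists_trace_bound d hκdef hκ C
    refine ⟨N, fun ζ hζ ρ hρ _ ε hε u Du D2u ut hu _ hD2u hut _ hx ht =>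
      ⟨fun _ => ?_, fun h => absurd h zero_ne_one⟩⟩
    obtain ⟨δ, hδ, hδρ, hN⟩ := hN ρ ε hρ hε
    obtain ⟨f, gu, gt, gh, hf, hgu, hgt, hgh⟩ := exists_traceData hp hq hu hD2u hut hx ht
    obtain ⟨v, -, hv, hvle⟩ := hC ρ δ hδ hδρ u f ut D2u gu gt gh hf ζ hζ
    refine ⟨v, (tendstoLr_iff hr0).2 (hv.congr' ?_), ?_⟩
    · filter_upwards [Ioo_mem_nhdsGT hρ] with ε' hε'
      refine eLpNorm_congr_ae ?_
      filter_upwards [ae_restrict_mem measurableSet_ball] with x hx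
      rw [mollify_congr_of_eqOn hζ hε' hf.eq_on hx]
    · rw [rpow_avg_eq_eLpNorm_mul hr0]
      refine hN _ _ _ _ _ rfl (hvle.trans_eq ?_)
      rw [hgu, hgt, hgh, lpqNorm_pCyl_eq hp0 hq0 (by positivity),
        lpqNorm_pCyl_eq hp0 hq0 (by positivity), lpqNorm_pCyl_eq hp0 hq0 (by positivity)]
  · obtain ⟨C, hC⟩ := exists_tendsto_trace_one d hp hq hr hκdef hκ
    obtain ⟨N, hN⟩ := exists_trace_bound d hκdef hκ (d * C)
    refine ⟨N, fun ζ hζ ρ hρ _ ε hε u Du D2u ut hu _ hD2u hut _ hx ht =>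
      ⟨fun h => absurd h one_ne_zero, fun _ => ?_⟩⟩
    obtain ⟨δ, hδ, hδρ, hN⟩ := hN ρ ε hρ hε
    obtain ⟨f, gu, gt, gh, hf, hgu, hgt, hgh⟩ := exists_traceData hp hq hu hD2u hut hx ht
    choose v hvm hv hvle using hC ρ δ hδ hδρ u f ut D2u gu gt gh hf ζ hζ
    obtain ⟨w, hwv, hw⟩ := exists_tendsto_fderiv_mollify hζ hρ hr1 hf.integrable hf.eq_on hvm hv
    refine ⟨w, fun i => (tendstoLr_iff hr0).2 (hw i), ?_⟩
    have havg := rpow_avg_eq_eLpNorm_mul (ρ := ρ) hr0 fun x => √(∑ i, w i x ^ 2)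
    simp_rw [abs_of_nonneg (Real.sqrt_nonneg _)] at havg
    rw [havg]
    refine hN _ _ _ _ _ rfl ?_
    refine (eLpNorm_sqrt_sum_sq_le (by simpa using hr1) _ hvm hwv).trans ?_
    refine (Finset.sum_le_sum fun i _ => hvle i).trans_eq ?_
    rw [Finset.sum_const, Finset.card_univ, Fintype.card_fin, nsmul_eq_mul, hgu, hgt, hgh,
      lpqNorm_pCyl_eq hp0 hq0 (by positivity), lpqNorm_pCyl_eq hp0 hq0 (by positivity),
      lpqNorm_pCyl_eq hp0 hq0 (by positivity)]
    push_cast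
    ring
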